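/- (Kuwata's summation formula for lc thresholds) Let f(x,y) = g(x) + h(y) where g and h are holomorphic function germs at 0 ∈ ℂ^m and 0 ∈ ℂ^n respectively, with g(0) = h(0) = 0. Then lct₀(ℂ^{m+n}, {f=0}) = min{1, lct₀(ℂ^m, {g=0}) + lct₀(ℂ^n, {h=0})}. -/

import Mathlib

open MeasureTheory

/-- The (analytic) log canonical threshold at the origin of a holomorphic
function `f`: the supremum of the set of `c > 0` such that `‖f‖^(-2c)` is
integrable in some neighborhood of `0`.  This agrees with the algebraic
log canonical threshold `lct₀(ℂⁿ, {f = 0})`. -/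
noncomputable def lct₀ {E : Type*} [NormedAddCommGroup E] [MeasureSpace E]
    (f : E → ℂ) : ℝ :=
  sSup {c : ℝ | 0 < c ∧ ∃ ε > 0,
    IntegrableOn (fun z => ‖f z‖ ^ (-(2 * c))) (Metric.ball 0 ε)}

namespace Kuw

/-- truncated tropical absolute value -/
noncomputable def lg (M T : ℝ) (a : ℂ) : ℝ := -Real.log (‖a‖ + Real.exp (-(M * T))) / T

lemma lg_exp (M : ℝ) {T : ℝ} (hT : 0 < T) (a : ℂ) :
    Real.exp (-(T * lg M T a)) = ‖a‖ + Real.exp (-(M * T)) := by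
  have h : 0 < ‖a‖ + Real.exp (-(M * T)) := by positivity
  have : -(T * lg M T a) = Real.log (‖a‖ + Real.exp (-(M * T))) := by
    unfold lg; field_simp
  rw [this, Real.exp_log h]

lemma lg_exp' (M : ℝ) {T : ℝ} (hT : 0 < T) (a : ℂ) :
    Real.exp (T * lg M T a) * (‖a‖ + Real.exp (-(M * T))) = 1 := by
  rw [← lg_exp M hT a, ← Real.exp_add]; simp

lemma lg_le (M : ℝ) {T : ℝ} (hT : 0 < T) (a : ℂ) : lg M T a ≤ M := by
  have h1 := lg_exp M hT a
  have h2 : Real.exp (-(M * T)) ≤ Real.exp (-(T * lg M T a)) := by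
    rw [h1]; have := norm_nonneg a; linarith
  have := Real.exp_le_exp.1 h2
  nlinarith

/-- monomial class -/
noncomputable def cls {d : ℕ} {R : Type} (ψ : Fin d → R) : R →₀ ℕ :=
  ∑ j, Finsupp.single (ψ j) 1

/-- coefficients of a product of linear forms -/
noncomputable def Cf {d : ℕ} {R : Type} [Fintype R] (ψ : Fin d → R) (b : Fin d → R → ℂ) : ℂ :=
  MvPolynomial.coeff (cls ψ)
    (∏ j, ∑ r, MvPolynomial.C (b j r) * MvPolynomial.X r : MvPolynomial R ℂ)

lemma prod_lin {d : ℕ} {R : Type} [Fintype R] (b : Fin d → R → ℂ) :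
    (∏ j, ∑ r, MvPolynomial.C (b j r) * MvPolynomial.X r : MvPolynomial R ℂ) =
      ∑ φ : Fin d → R, MvPolynomial.monomial (cls φ) (∏ j, b j (φ j)) := by
  classical
  rw [Fintype.prod_sum]
  refine Finset.sum_congr rfl fun φ _ => ?_
  rw [Finset.prod_mul_distrib]
  unfold cls
  rw [MvPolynomial.monomial_sum_index]
  rw [map_prod]
  rfl

open Classical in
lemma Cf_eq {d : ℕ} {R : Type} [Fintype R] (ψ : Fin d → R) (b : Fin d → R → ℂ) :
    Cf ψ b = ∑ φ : Fin d → R, if cls φ = cls ψ then ∏ j, b j (φ j) else 0 := by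
  unfold Cf
  rw [prod_lin, MvPolynomial.coeff_sum]
  simp only [MvPolynomial.coeff_monomial]

lemma prod_cls {d : ℕ} {R : Type} (φ ψ : Fin d → R) (h : cls φ = cls ψ) {A : Type*} [CommMonoid A]
    (ζ : R → A) : ∏ j, ζ (φ j) = ∏ j, ζ (ψ j) := by
  classical
  have key : ∀ φ : Fin d → R, ∏ j, ζ (φ j) = (cls φ).prod fun r k => ζ r ^ k := by
    intro φ
    unfold cls
    rw [← Finsupp.prod_finsetSum_index]
    · simp
    · simp
    · intro a b c; exact pow_add _ _ _
  rw [key, key, h]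

lemma Cf_scale {d : ℕ} {R : Type} [Fintype R] (ψ : Fin d → R) (b : Fin d → R → ℂ) (ζ : R → ℂ) :
    Cf ψ (fun j r => b j r * ζ r) = Cf ψ b * ∏ j, ζ (ψ j) := by
  classical
  rw [Cf_eq, Cf_eq, Finset.sum_mul]
  refine Finset.sum_congr rfl fun φ _ => ?_
  split_ifs with h
  · rw [Finset.prod_mul_distrib, prod_cls φ ψ h]
  · simp

lemma Cf_scale' {d : ℕ} {R : Type} [Fintype R] (ψ : Fin d → R) (b : Fin d → R → ℂ) (s : Fin d → ℂ) :
    Cf ψ (fun j r => s j * b j r) = (∏ j, s j) * Cf ψ b := by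
  classical
  rw [Cf_eq, Cf_eq, Finset.mul_sum]
  refine Finset.sum_congr rfl fun φ _ => ?_
  split_ifs with h
  · rw [Finset.prod_mul_distrib]
  · simp

lemma Cf_zero {d : ℕ} {R : Type} [Fintype R] (b : Fin d → R → ℂ) (h : ∀ ψ, Cf ψ b = 0) :
    ∃ j, ∀ r, b j r = 0 := by
  classical
  have h0 : (∏ j, ∑ r, MvPolynomial.C (b j r) * MvPolynomial.X r : MvPolynomial R ℂ) = 0 := by
    ext m
    by_cases hm : ∃ ψ : Fin d → R, cls ψ = m
    · obtain ⟨ψ, rfl⟩ := hm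
      simpa [Cf] using h ψ
    · rw [prod_lin, MvPolynomial.coeff_sum]
      simp only [MvPolynomial.coeff_monomial]
      push Not at hm
      simp [hm]
  rw [Finset.prod_eq_zero_iff] at h0
  obtain ⟨j, -, hj⟩ := h0
  refine ⟨j, fun r => ?_⟩
  have := congrArg (MvPolynomial.coeff (Finsupp.single r 1)) hj
  rw [MvPolynomial.coeff_sum] at this
  simpa [MvPolynomial.coeff_C_mul, MvPolynomial.coeff_X, Finsupp.single_left_inj] using this

lemma Cf_cont {d : ℕ} {R : Type} [Fintype R] (ψ : Fin d → R) :
    Continuous fun b : Fin d → R → ℂ => Cf ψ b := by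
  classical
  simp_rw [Cf_eq]
  refine continuous_finsetSum _ fun φ _ => ?_
  split_ifs
  · fun_prop
  · fun_prop

lemma gauss1 (d : ℕ) (R : Type) [Fintype R] :
    ∃ c0 > 0, ∀ b : Fin d → R → ℂ, c0 * ∏ j, ∑ r, ‖b j r‖ ≤ ∑ ψ : Fin d → R, ‖Cf ψ b‖ := by
  classical
  let K : Set (Fin d → R → ℂ) := {b | ∀ j, ∑ r, ‖b j r‖ = 1}
  have hKc : IsCompact K := by
    refine Metric.isCompact_of_isClosed_isBounded ?_ ?_
    · have : K = ⋂ j, {b | ∑ r, ‖b j r‖ = 1} := by ext; simp [K]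
      rw [this]
      exact isClosed_iInter fun j => isClosed_eq (by fun_prop) continuous_const
    · refine (Metric.isBounded_closedBall (x := 0) (r := 1)).subset fun b hb => ?_
      rw [mem_closedBall_zero_iff, pi_norm_le_iff_of_nonneg zero_le_one]
      intro j
      rw [pi_norm_le_iff_of_nonneg zero_le_one]
      intro r
      rw [← hb j]
      exact Finset.single_le_sum (f := fun r => ‖b j r‖) (fun _ _ => norm_nonneg _) (Finset.mem_univ r)
  have hcont : Continuous fun b : Fin d → R → ℂ => ∑ ψ : Fin d → R, ‖Cf ψ b‖ :=
    continuous_finsetSum _ fun ψ _ => (Cf_cont ψ).norm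
  have hpos : ∀ b ∈ K, 0 < ∑ ψ : Fin d → R, ‖Cf ψ b‖ := by
    intro b hb
    by_contra hcon
    have h0 : ∑ ψ : Fin d → R, ‖Cf ψ b‖ = 0 :=
      le_antisymm (not_lt.1 hcon) (Finset.sum_nonneg fun _ _ => norm_nonneg _)
    rw [Finset.sum_eq_zero_iff_of_nonneg (fun _ _ => norm_nonneg _)] at h0
    obtain ⟨j, hj⟩ := Cf_zero b (fun ψ => norm_eq_zero.1 (h0 ψ (Finset.mem_univ _)))
    have := hb j
    simp [hj] at this
  obtain ⟨c0, hc0, hmin⟩ : ∃ c0 > 0, ∀ b ∈ K, c0 ≤ ∑ ψ : Fin d → R, ‖Cf ψ b‖ := by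
    rcases K.eq_empty_or_nonempty with h | h
    · exact ⟨1, one_pos, by simp [h]⟩
    · obtain ⟨b, hb, hm⟩ := hKc.exists_isMinOn h hcont.continuousOn
      exact ⟨_, hpos b hb, fun b' hb' => hm hb'⟩
  refine ⟨c0, hc0, fun b => ?_⟩
  by_cases hz : ∃ j, ∑ r, ‖b j r‖ = 0
  · obtain ⟨j, hj⟩ := hz
    rw [Finset.prod_eq_zero (Finset.mem_univ j) hj]
    simpa using Finset.sum_nonneg fun _ _ => norm_nonneg _
  push Not at hz
  set s : Fin d → ℝ := fun j => ∑ r, ‖b j r‖ with hs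
  have hs0 : ∀ j, 0 < s j := fun j =>
    lt_of_le_of_ne (Finset.sum_nonneg fun _ _ => norm_nonneg _) (hz j).symm
  have hb' : (fun j r => ((s j)⁻¹ : ℂ) * b j r) ∈ K := by
    intro j
    simp only [norm_mul, ← Finset.mul_sum, norm_inv, Complex.norm_real, Real.norm_eq_abs,
      abs_of_pos (hs0 j)]
    exact inv_mul_cancel₀ (hz j)
  have := hmin _ hb'
  simp only [Cf_scale', norm_mul, ← Finset.mul_sum, norm_prod, norm_inv, Complex.norm_real,
    Real.norm_eq_abs, abs_of_pos (hs0 _), Finset.prod_inv_distrib] at this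
  have hp : 0 < ∏ j, s j := Finset.prod_pos fun j _ => hs0 j
  rw [inv_mul_eq_div, le_div_iff₀ hp] at this
  exact this

lemma gauss2 (d : ℕ) (R : Type) [Fintype R] (b : Fin d → R → ℂ) (ψ : Fin d → R) :
    ‖Cf ψ b‖ ≤ ∏ j, ∑ r, ‖b j r‖ := by
  classical
  rw [Cf_eq, Fintype.prod_sum]
  refine (norm_sum_le _ _).trans (Finset.sum_le_sum fun φ _ => ?_)
  split_ifs
  · rw [norm_prod]
  · simpa using Finset.prod_nonneg fun _ _ => norm_nonneg _

end Kuw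

namespace Kuw

/-- index set -/
abbrev RI (Q : Type) := Option Q ⊕ Finset Q

/-- auxiliary monomials -/
noncomputable def bb {Q : Type} [Fintype Q] {A : Type*} [CommSemiring A] (a : Q → A) : RI Q → A :=
  Sum.elim (fun o => o.elim 1 fun q => a q ^ (Fintype.card Q + 1)) fun J => ∏ q ∈ J, a q

/-- log-sum-exp comparison -/
lemma lse {ι : Type*} [Fintype ι] [Nonempty ι] {T S δ : ℝ} (hT : 0 < T) (hS : 0 < S) (v v' : ι → ℝ)
    (h : ∀ i, v i ≤ v' i + δ) :
    Real.log (∑ i, Real.exp (T * v i)) / T ≤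
      Real.log (∑ i, Real.exp (S * v' i)) / S + δ + Real.log (Fintype.card ι) / T := by
  set g := Real.log (∑ i, Real.exp (S * v' i)) / S with hg
  have hpS : 0 < ∑ i, Real.exp (S * v' i) :=
    Finset.sum_pos (fun _ _ => Real.exp_pos _) Finset.univ_nonempty
  have h1 : ∀ i, v' i ≤ g := by
    intro i
    rw [hg, le_div_iff₀ hS, mul_comm, Real.le_log_iff_exp_le hpS]
    exact Finset.single_le_sum (f := fun i => Real.exp (S * v' i)) (fun _ _ => (Real.exp_pos _).le)
      (Finset.mem_univ i)
  have hpT : 0 < ∑ i, Real.exp (T * v i) :=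
    Finset.sum_pos (fun _ _ => Real.exp_pos _) Finset.univ_nonempty
  have h2 : ∑ i, Real.exp (T * v i) ≤ Fintype.card ι * Real.exp (T * (g + δ)) := by
    rw [← nsmul_eq_mul, ← Finset.card_univ]
    refine Finset.sum_le_card_nsmul _ _ _ fun i _ => Real.exp_le_exp.2 ?_
    exact mul_le_mul_of_nonneg_left (by linarith [h i, h1 i]) hT.le
  have hc : (0 : ℝ) < Fintype.card ι := by exact_mod_cast Fintype.card_pos
  have h3 := Real.log_le_log hpT h2
  rw [Real.log_mul hc.ne' (Real.exp_pos _).ne', Real.log_exp] at h3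
  rw [div_le_iff₀ hT]
  calc _ ≤ _ := h3
    _ = _ := by field_simp; ring

/-- comparing the products with weights -/
lemma match1 (d : ℕ) (R : Type) [Fintype R] [Nonempty R] : ∃ C : ℝ, 0 ≤ C ∧
    ∀ (Z M' : ℝ), d * Z ≤ M' → ∀ (z : R → ℝ), (∀ r, z r ≤ Z) →
    ∀ (r0 : R), z r0 = 0 → ∀ T S δ : ℝ, 0 < T → 0 < S →
    ∀ b b' : Fin d → R → ℂ, (∀ j, b j r0 = 1) → (∀ j, b' j r0 = 1) →
    (∀ ψ : Fin d → R, lg M' S (Cf ψ b') ≤ lg M' T (Cf ψ b) + δ) →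
    (∑ j, Real.log (∑ r, ‖b j r‖ * Real.exp (T * z r)) / T) ≤
      (∑ j, Real.log (∑ r, ‖b' j r‖ * Real.exp (S * z r)) / S) + δ + C / T + C / S := by
  classical
  obtain ⟨c0, hc0, hg1⟩ := gauss1 d R
  set n : ℝ := (Fintype.card (Fin d → R) : ℝ) with hn
  have hn1 : 1 ≤ n := by
    rw [hn]; exact_mod_cast Fintype.card_pos (α := Fin d → R)
  refine ⟨|Real.log c0| + Real.log n + Real.log (2 * n), by
    have := Real.log_nonneg hn1
    have := Real.log_nonneg (x := 2 * n) (by linarith)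
    positivity, ?_⟩
  intro Z M' hM' z hz r0 hr0 T S δ hT hS b b' hb hb' hψ
  -- key bounds
  have main : ∀ (T : ℝ), 0 < T → ∀ b : Fin d → R → ℂ, (∀ j, b j r0 = 1) →
      c0 * ∏ j, (∑ r, ‖b j r‖ * Real.exp (T * z r)) ≤
        ∑ ψ : Fin d → R, Real.exp (T * (-lg M' T (Cf ψ b) + ∑ j, z (ψ j))) ∧
      ∑ ψ : Fin d → R, Real.exp (T * (-lg M' T (Cf ψ b) + ∑ j, z (ψ j))) ≤
        (2 * n) * ∏ j, (∑ r, ‖b j r‖ * Real.exp (T * z r)) ∧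
      ∀ j, 1 ≤ (∑ r, ‖b j r‖ * Real.exp (T * z r)) := by
    intro T hT b hb
    have e1 : ∀ ψ : Fin d → R, Real.exp (T * (-lg M' T (Cf ψ b) + ∑ j, z (ψ j))) =
        ‖Cf ψ (fun j r => b j r * (Real.exp (T * z r) : ℂ))‖ +
          Real.exp (-(M' * T)) * ∏ j, Real.exp (T * z (ψ j)) := by
      intro ψ
      rw [Cf_scale, norm_mul, norm_prod]
      have : ∀ j, ‖(Real.exp (T * z (ψ j)) : ℂ)‖ = Real.exp (T * z (ψ j)) := by
        intro j
        rw [Complex.norm_real, Real.norm_eq_abs, abs_of_pos (Real.exp_pos _)]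
      push_cast at this ⊢
      simp only [this]
      rw [← add_mul, ← lg_exp M' hT, ← Real.exp_sum, ← Real.exp_add, ← Finset.mul_sum]
      congr 1; ring
    have e2 : ∀ j r, ‖b j r * (Real.exp (T * z r) : ℂ)‖ = ‖b j r‖ * Real.exp (T * z r) := by
      intro j r
      rw [norm_mul, Complex.norm_real, Real.norm_eq_abs, abs_of_pos (Real.exp_pos _)]
    have g1 := hg1 (fun j r => b j r * (Real.exp (T * z r) : ℂ))
    have g2 := fun ψ => gauss2 d R (fun j r => b j r * (Real.exp (T * z r) : ℂ)) ψ
    simp only [e2] at g1 g2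
    have hone : ∀ j, 1 ≤ (∑ r, ‖b j r‖ * Real.exp (T * z r)) := by
      intro j
      have := Finset.single_le_sum (f := fun r => ‖b j r‖ * Real.exp (T * z r))
        (fun _ _ => by positivity) (Finset.mem_univ r0)
      simpa [hb j, hr0] using this
    have hpone : 1 ≤ ∏ j, (∑ r, ‖b j r‖ * Real.exp (T * z r)) := by
      have := Finset.prod_le_prod (s := Finset.univ) (f := fun _ : Fin d => (1 : ℝ))
        (fun _ _ => zero_le_one) (fun j _ => hone j)
      simpa using this
    have hsmall : ∀ ψ : Fin d → R, Real.exp (-(M' * T)) * ∏ j, Real.exp (T * z (ψ j)) ≤ 1 := by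
      intro ψ
      rw [← Real.exp_sum, ← Real.exp_add, Real.exp_le_one_iff, ← Finset.mul_sum]
      have : ∑ j, z (ψ j) ≤ d * Z := by
        have := Finset.sum_le_card_nsmul Finset.univ (fun j => z (ψ j)) Z (fun j _ => hz _)
        simpa using this
      nlinarith
    refine ⟨?_, ?_, hone⟩
    · refine g1.trans (Finset.sum_le_sum fun ψ _ => ?_)
      rw [e1]
      have : 0 ≤ Real.exp (-(M' * T)) * ∏ j, Real.exp (T * z (ψ j)) := by positivity
      linarith
    · have : ∀ ψ ∈ (Finset.univ : Finset (Fin d → R)),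
          Real.exp (T * (-lg M' T (Cf ψ b) + ∑ j, z (ψ j))) ≤
          2 * ∏ j, (∑ r, ‖b j r‖ * Real.exp (T * z r)) := by
        intro ψ _
        rw [e1]; linarith [g2 ψ, hsmall ψ]
      have := Finset.sum_le_card_nsmul _ _ _ this
      rw [nsmul_eq_mul, Finset.card_univ, ← hn] at this
      linarith
  obtain ⟨a1, -, a3⟩ := main T hT b hb
  obtain ⟨-, a2', a3'⟩ := main S hS b' hb'
  have l := lse hT hS (δ := δ) (fun ψ => -lg M' T (Cf ψ b) + ∑ j, z (ψ j))
    (fun ψ => -lg M' S (Cf ψ b') + ∑ j, z (ψ j)) (fun ψ => by linarith [hψ ψ])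
  set P := ∏ j, (∑ r, ‖b j r‖ * Real.exp (T * z r)) with hP
  set P' := ∏ j, (∑ r, ‖b' j r‖ * Real.exp (S * z r)) with hP'
  have hPp : 0 < P := Finset.prod_pos fun j _ => by linarith [a3 j]
  have hPp' : 0 < P' := Finset.prod_pos fun j _ => by linarith [a3' j]
  have l1 : Real.log c0 + Real.log P ≤
      Real.log (∑ ψ : Fin d → R, Real.exp (T * (-lg M' T (Cf ψ b) + ∑ j, z (ψ j)))) := by
    rw [← Real.log_mul hc0.ne' hPp.ne']
    exact Real.log_le_log (by positivity) a1
  have l2 : Real.log (∑ ψ : Fin d → R, Real.exp (S * (-lg M' S (Cf ψ b') + ∑ j, z (ψ j)))) ≤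
      Real.log (2 * n) + Real.log P' := by
    rw [← Real.log_mul (by positivity) hPp'.ne']
    exact Real.log_le_log (Finset.sum_pos (fun _ _ => Real.exp_pos _) Finset.univ_nonempty) a2'
  have s1 : Real.log P = ∑ j, Real.log (∑ r, ‖b j r‖ * Real.exp (T * z r)) :=
    Real.log_prod (fun j _ => by linarith [a3 j])
  have s2 : Real.log P' = ∑ j, Real.log (∑ r, ‖b' j r‖ * Real.exp (S * z r)) :=
    Real.log_prod (fun j _ => by linarith [a3' j])
  rw [← Finset.sum_div, ← Finset.sum_div, ← s1, ← s2]
  have k1 : Real.log P / T ≤ (|Real.log c0|) / T +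
      Real.log (∑ ψ : Fin d → R, Real.exp (T * (-lg M' T (Cf ψ b) + ∑ j, z (ψ j)))) / T := by
    rw [← add_div]; gcongr; linarith [neg_abs_le (Real.log c0)]
  have k2 : Real.log (∑ ψ : Fin d → R, Real.exp (S * (-lg M' S (Cf ψ b') + ∑ j, z (ψ j)))) / S ≤
     Real.log (2 * n) / S + Real.log P' / S := by
    rw [← add_div]; gcongr
  have k3 : 0 ≤ Real.log n := Real.log_nonneg hn1
  have k4 : 0 ≤ Real.log (2 * n) := Real.log_nonneg (x := 2 * n) (by linarith)
  have k5 : (|Real.log c0| + Real.log n + Real.log (2 * n)) / T ≥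
      |Real.log c0| / T + Real.log n / T := by
    rw [← add_div]; exact div_le_div_of_nonneg_right (by linarith) hT.le
  have k6 : (|Real.log c0| + Real.log n + Real.log (2 * n)) / S ≥ Real.log (2 * n) / S := by
    exact div_le_div_of_nonneg_right (by linarith [abs_nonneg (Real.log c0)]) hS.le
  linarith


/-- the weights used in the matching lemma -/
noncomputable def wt {Q : Type} [Fintype Q] (M κ : ℝ) (μ : Q → ℝ) : RI Q → ℝ :=
  Sum.elim (fun o => o.elim 0 fun q => (Fintype.card Q + 1 : ℕ) * μ q)
    fun J => κ + ∑ q, μ q - M * (Fintype.card Q - J.card : ℝ)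

lemma wt_sum {Q : Type} [Fintype Q] (M κ : ℝ) (μ : Q → ℝ) (a : Q → ℂ) (T : ℝ) :
    ∑ r, ‖bb a r‖ * Real.exp (T * wt M κ μ r) =
      1 + ∑ q, (Real.exp (T * μ q) * ‖a q‖) ^ (Fintype.card Q + 1) +
      Real.exp (T * κ) * ∏ q, (Real.exp (T * μ q) * (‖a q‖ + Real.exp (-(M * T)))) := by
  classical
  rw [Fintype.sum_sum_type, Fintype.sum_option]
  congr 1
  · congr 1
    · simp [bb, wt]
    · refine Finset.sum_congr rfl fun q _ => ?_
      simp only [bb, wt, Sum.elim_inl, Option.elim_some, norm_pow, mul_pow, ← Real.exp_nat_mul]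
      rw [mul_comm]; congr 2; ring
  · rw [Finset.prod_mul_distrib, Fintype.prod_add, Finset.mul_sum, Finset.mul_sum]
    refine Finset.sum_congr rfl fun J _ => ?_
    simp only [bb, wt, Sum.elim_inr, norm_prod, Finset.prod_const]
    rw [← Real.exp_sum, ← Real.exp_nat_mul, Finset.card_compl]
    have : (J.card : ℕ) ≤ Fintype.card Q := Finset.card_le_univ J
    rw [mul_left_comm, mul_left_comm (Real.exp _) (∏ _ ∈ _, _), ← Real.exp_add, mul_left_comm (Real.exp _) (∏ _ ∈ _, _),
      ← Real.exp_add]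
    congr 2
    rw [← Finset.mul_sum]
    push_cast [this]
    ring

lemma wt_le {Q : Type} [Fintype Q] (M κ : ℝ) (hM : 0 ≤ M) (hκ : κ ≤ 1) (μ : Q → ℝ) (hμ : ∀ q, μ q ≤ M) (r : RI Q) :
    wt M κ μ r ≤ (Fintype.card Q + 1 : ℕ) * M + 1 := by
  rcases r with (_ | q) | J
  · simp [wt]; positivity
  · simp only [wt, Sum.elim_inl, Option.elim_some]
    have := mul_le_mul_of_nonneg_left (hμ q) (Nat.cast_nonneg (α := ℝ) (Fintype.card Q + 1))
    linarith
  · simp only [wt, Sum.elim_inr]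
    have h1 : ∑ q, μ q ≤ Fintype.card Q * M := by
      have := Finset.sum_le_card_nsmul Finset.univ μ M (fun j _ => hμ _)
      simpa using this
    have h2 : (J.card : ℝ) ≤ Fintype.card Q := by exact_mod_cast Finset.card_le_univ J
    have : 0 ≤ M * (Fintype.card Q - J.card : ℝ) := mul_nonneg hM (by linarith)
    push_cast; linarith

/-- extraction of a match from domination -/
lemma match2 {Q : Type} [Fintype Q] (u t : Q → ℝ) (E : ℝ) (hE : 1 ≤ E) (hu : ∀ q, 0 ≤ u q)
    (ht0 : ∀ q, 0 < t q) (ht : ∀ q, t q ≤ u q + 1)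
    (h : 1 + ∑ q, u q ^ (Fintype.card Q + 1) ≤ E * ∏ q, t q) (q : Q) :
    t q ≤ 2 ^ (Fintype.card Q + 1) * E ∧ 1 ≤ 2 ^ (Fintype.card Q + 1) * E * t q := by
  classical
  set N := Fintype.card Q + 1 with hN
  set X := 1 + ∑ q, u q ^ N with hX
  have hsn : 0 ≤ ∑ q, u q ^ N := Finset.sum_nonneg fun q _ => pow_nonneg (hu q) _
  have hX1 : 1 ≤ X := by linarith
  let t' : Option Q → ℝ := fun o => o.elim 1 t
  obtain ⟨o, -, ho⟩ := Finset.exists_max_image (Finset.univ : Finset (Option Q)) t' Finset.univ_nonempty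
  set m := t' o with hm
  have hm1 : 1 ≤ m := ho none (Finset.mem_univ _)
  have hmt : ∀ q, t q ≤ m := fun q => ho (some q) (Finset.mem_univ _)
  have hmN : m ^ N ≤ 2 ^ N * X := by
    have hgen : ∀ o, t' o ^ N ≤ 2 ^ N * X := by
      intro o
      rcases o with _ | q
      · simp only [t', Option.elim_none, one_pow]
        have : (1 : ℝ) ≤ 2 ^ N := one_le_pow₀ (by norm_num)
        nlinarith
      · simp only [t', Option.elim_some]
        have h1 : u q ^ N ≤ ∑ q, u q ^ N :=
          Finset.single_le_sum (f := fun q => u q ^ N) (fun q _ => pow_nonneg (hu q) _) (Finset.mem_univ q)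
        rcases le_total (u q) 1 with h2 | h2
        · calc t q ^ N ≤ 2 ^ N := by
                gcongr
                · exact (ht0 q).le
                · linarith [ht q]
            _ ≤ 2 ^ N * X := by
                have : (0 : ℝ) < 2 ^ N := by positivity
                nlinarith
        · calc t q ^ N ≤ (2 * u q) ^ N := by
                gcongr
                · exact (ht0 q).le
                · linarith [ht q]
            _ = 2 ^ N * u q ^ N := mul_pow _ _ _
            _ ≤ 2 ^ N * X := by gcongr; linarith
    exact hgen o
  have hm0 : 0 < m := by linarith
  have hmE : m ^ N ≤ 2 ^ N * E * ∏ q, t q := by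
    calc _ ≤ _ := hmN
      _ ≤ 2 ^ N * (E * ∏ q, t q) := by gcongr
      _ = _ := by ring
  have hp1 : ∏ q, t q ≤ m ^ (N - 1) := by
    have := Finset.prod_le_prod (s := Finset.univ) (fun q _ => (ht0 q).le) (fun q _ => hmt q)
    simpa [hN] using this
  have hp2 : ∏ q, t q ≤ t q * m ^ (N - 2) := by
    rw [← Finset.mul_prod_erase _ _ (Finset.mem_univ q)]
    have := Finset.prod_le_prod (s := Finset.univ.erase q) (fun q _ => (ht0 q).le) (fun q _ => hmt q)
    rw [Finset.prod_const, Finset.card_erase_of_mem (Finset.mem_univ q), Finset.card_univ] at this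
    exact mul_le_mul_of_nonneg_left this (ht0 q).le
  have hcard : 0 < Fintype.card Q := Fintype.card_pos_iff.2 ⟨q⟩
  have hKp : (0 : ℝ) < 2 ^ N * E := by positivity
  constructor
  · refine (hmt q).trans ?_
    have h1 : m * m ^ (N - 1) ≤ 2 ^ N * E * m ^ (N - 1) := by
      rw [← pow_succ', Nat.sub_add_cancel (by omega)]
      exact hmE.trans (by gcongr)
    exact le_of_mul_le_mul_right h1 (by positivity)
  · have h1 : m ^ 2 * m ^ (N - 2) ≤ (2 ^ N * E * t q) * m ^ (N - 2) := by
      rw [← pow_add, Nat.add_sub_cancel' (by omega)]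
      refine hmE.trans ?_
      rw [mul_assoc _ (t q)]; gcongr
    have := le_of_mul_le_mul_right h1 (by positivity)
    nlinarith

end Kuw

namespace Kuw

set_option maxHeartbeats 1000000 in
lemma matching (d : ℕ) (Q : Type) [Fintype Q] (M : ℝ) (hM : 0 ≤ M) : ∃ M' > 0, ∀ δ > 0, ∃ δ' > 0, ∃ T0 > 0,
    ∀ T ≥ T0, ∀ S ≥ T0, ∀ A A' : Fin d → Q → ℂ,
    (∀ ψ : Fin d → RI Q, |lg M' T (Cf ψ fun j => bb (A j)) - lg M' S (Cf ψ fun j => bb (A' j))| ≤ δ') →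
    ∀ j, ∃ j', ∀ q, |lg M T (A j q) - lg M S (A' j' q)| ≤ δ := by
  classical
  obtain ⟨C, hC0, hC⟩ := match1 d (RI Q)
  set N := Fintype.card Q + 1 with hN
  set Z : ℝ := (N : ℕ) * M + 1 with hZ
  refine ⟨d * Z + 1, by positivity, fun δ hδ => ?_⟩
  set κ := min (δ / 2) 1 with hκ
  have hκ0 : 0 < κ := by positivity
  have hκ1 : κ ≤ 1 := min_le_right _ _
  have hκδ : κ ≤ δ / 2 := min_le_left _ _
  set B : ℝ := 4 * C + Real.log (N + 1) + 2 * d * 1 + N with hB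
  have hlogN : 0 ≤ Real.log ((N : ℝ) + 1) := Real.log_nonneg (by have : (0 : ℝ) ≤ N := by positivity
                                                                 linarith)
  have hNp : (0 : ℝ) < N := by rw [hN]; positivity
  have hdp : (0 : ℝ) ≤ d := by positivity
  have hB0 : 0 < B := by rw [hB]; linarith
  refine ⟨κ / 16, by positivity, 8 * B / κ, by positivity, ?_⟩
  intro T hT S hS A A' hψ j0
  have hTp : 0 < T := lt_of_lt_of_le (by positivity) hT
  have hSp : 0 < S := lt_of_lt_of_le (by positivity) hS
  have hT' : 8 * B ≤ κ * T := by rw [ge_iff_le, div_le_iff₀ hκ0] at hT; linarith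
  have hS' : 8 * B ≤ κ * S := by rw [ge_iff_le, div_le_iff₀ hκ0] at hS; linarith
  set μ : Q → ℝ := fun q => lg M T (A j0 q) with hμ
  have hμM : ∀ q, μ q ≤ M := fun q => lg_le M hTp _
  -- the two sums
  set XT : Fin d → ℝ := fun j => 1 + ∑ q, (Real.exp (T * μ q) * ‖A j q‖) ^ N with hXT
  set YT : Fin d → ℝ := fun j => ∏ q, (Real.exp (T * μ q) * (‖A j q‖ + Real.exp (-(M * T)))) with hYT
  set XS : Fin d → ℝ := fun j => 1 + ∑ q, (Real.exp (S * μ q) * ‖A' j q‖) ^ N with hXS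
  set YS : Fin d → ℝ := fun j => ∏ q, (Real.exp (S * μ q) * (‖A' j q‖ + Real.exp (-(M * S)))) with hYS
  have hXT1 : ∀ j, 1 ≤ XT j := fun j => by
    have : 0 ≤ ∑ q, (Real.exp (T * μ q) * ‖A j q‖) ^ N := by positivity
    simp only [hXT]; linarith
  have hXS1 : ∀ j, 1 ≤ XS j := fun j => by
    have : 0 ≤ ∑ q, (Real.exp (S * μ q) * ‖A' j q‖) ^ N := by positivity
    simp only [hXS]; linarith
  have hYT0 : ∀ j, 0 ≤ YT j := fun j => by positivity
  have hYS0 : ∀ j, 0 ≤ YS j := fun j => by positivity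
  have I1 := hC Z (d * Z + 1) (by linarith) (wt M κ μ) (wt_le M κ hM hκ1 μ hμM) (Sum.inl none)
    (by simp [wt]) T S (κ / 16) hTp hSp (fun j => bb (A j)) (fun j => bb (A' j)) (by simp [bb]) (by simp [bb])
    (fun ψ => by linarith [(abs_le.1 (hψ ψ)).1])
  have I2 := hC Z (d * Z + 1) (by linarith) (wt M 0 μ) (wt_le M 0 hM zero_le_one μ hμM) (Sum.inl none)
    (by simp [wt]) S T (κ / 16) hSp hTp (fun j => bb (A' j)) (fun j => bb (A j)) (by simp [bb]) (by simp [bb])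
    (fun ψ => by linarith [(abs_le.1 (hψ ψ)).2])
  simp only [wt_sum, mul_zero, Real.exp_zero, one_mul] at I1 I2
  change ∑ j, Real.log (XT j + Real.exp (T * κ) * YT j) / T ≤
    ∑ j, Real.log (XS j + Real.exp (S * κ) * YS j) / S + _ + _ + _ at I1
  change ∑ j, Real.log (XS j + YS j) / S ≤ ∑ j, Real.log (XT j + YT j) / T + _ + _ + _ at I2
  -- T side
  have hD : ∀ j, 0 ≤ Real.log (XT j + Real.exp (T * κ) * YT j) / T - Real.log (XT j + YT j) / T := by
    intro j
    have h1 : 1 ≤ Real.exp (T * κ) := Real.one_le_exp (by positivity)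
    rw [← sub_div]
    refine div_nonneg (sub_nonneg.2 (Real.log_le_log (by linarith [hXT1 j, hYT0 j]) ?_)) hTp.le
    nlinarith [hYT0 j]
  have hone : ∀ q, Real.exp (T * μ q) * (‖A j0 q‖ + Real.exp (-(M * T))) = 1 := fun q => lg_exp' M hTp _
  have hD0 : κ - Real.log (N + 1) / T ≤
      Real.log (XT j0 + Real.exp (T * κ) * YT j0) / T - Real.log (XT j0 + YT j0) / T := by
    have hy : YT j0 = 1 := by simp only [hYT, hone, Finset.prod_const_one]
    have hx : XT j0 ≤ N := by
      have : ∑ q, (Real.exp (T * μ q) * ‖A j0 q‖) ^ N ≤ ∑ q : Q, (1 : ℝ) := by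
        refine Finset.sum_le_sum fun q _ => pow_le_one₀ (by positivity) ?_
        rw [← hone q]; gcongr; linarith [Real.exp_pos (-(M * T))]
      simp only [hXT, hN]; push_cast
      simp at this; linarith
    rw [hy, mul_one]
    have h1 : κ ≤ Real.log (XT j0 + Real.exp (T * κ)) / T := by
      rw [le_div_iff₀ hTp, Real.le_log_iff_exp_le (by linarith [hXT1 j0, Real.exp_pos (T * κ)]), mul_comm]
      linarith [hXT1 j0]
    have h2 : Real.log (XT j0 + 1) / T ≤ Real.log (N + 1) / T := by
      refine div_le_div_of_nonneg_right (Real.log_le_log (by linarith [hXT1 j0]) (by linarith)) hTp.le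
    linarith
  have hDs : κ - Real.log (N + 1) / T ≤ ∑ j, Real.log (XT j + Real.exp (T * κ) * YT j) / T -
      ∑ j, Real.log (XT j + YT j) / T := by
    rw [← Finset.sum_sub_distrib]
    exact hD0.trans (Finset.single_le_sum
      (f := fun j => Real.log (XT j + Real.exp (T * κ) * YT j) / T - Real.log (XT j + YT j) / T)
      (fun j _ => hD j) (Finset.mem_univ j0))
  have hCT : C / T ≤ κ / 32 := by
    rw [div_le_iff₀ hTp]; linarith
  have hCS : C / S ≤ κ / 32 := by
    rw [div_le_iff₀ hSp]; linarith
  have hNT : Real.log (N + 1) / T ≤ κ / 8 := by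
    rw [div_le_iff₀ hTp]
    have : (0 : ℝ) ≤ N := by positivity
    have : (0 : ℝ) ≤ d := by positivity
    linarith
  have hsum : κ / 2 ≤ ∑ j, (Real.log (XS j + Real.exp (S * κ) * YS j) / S - Real.log (XS j + YS j) / S) := by
    rw [Finset.sum_sub_distrib]; linarith
  have hd : 0 < d := j0.pos
  obtain ⟨j', hj'⟩ : ∃ j', κ / (2 * d) ≤
      Real.log (XS j' + Real.exp (S * κ) * YS j') / S - Real.log (XS j' + YS j') / S := by
    by_contra hcon
    push Not at hcon
    have : ∑ j, (Real.log (XS j + Real.exp (S * κ) * YS j) / S - Real.log (XS j + YS j) / S) <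
        ∑ j : Fin d, κ / (2 * d) := Finset.sum_lt_sum_of_nonempty ⟨j0, Finset.mem_univ _⟩ fun j _ => hcon j
    simp only [Finset.sum_const, Finset.card_univ, Fintype.card_fin, nsmul_eq_mul] at this
    have : (d : ℝ) * (κ / (2 * d)) = κ / 2 := by field_simp
    linarith
  refine ⟨j', ?_⟩
  -- domination
  have hdom : XS j' ≤ Real.exp (S * κ) * YS j' := by
    by_contra hcon
    push Not at hcon
    rw [← sub_div, le_div_iff₀ hSp] at hj'
    have h1 : Real.log (XS j' + Real.exp (S * κ) * YS j') < Real.log 2 + Real.log (XS j' + YS j') := by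
      rw [← Real.log_mul (by norm_num) (by linarith [hXS1 j', hYS0 j'])]
      refine Real.log_lt_log ?_ (by linarith [hYS0 j'])
      have := hYS0 j'
      have := hXS1 j'
      positivity
    have h2 : Real.log 2 < 1 := by linarith [Real.log_two_lt_d9]
    have h3 : 1 ≤ κ / (2 * d) * S := by
      rw [div_mul_eq_mul_div, le_div_iff₀ (by positivity)]
      have : (0 : ℝ) ≤ N := by positivity
      linarith
    linarith
  intro q
  have hEone : 1 ≤ Real.exp (S * κ) := Real.one_le_exp (by positivity)
  have hm2 := match2 (fun q => Real.exp (S * μ q) * ‖A' j' q‖)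
    (fun q => Real.exp (S * μ q) * (‖A' j' q‖ + Real.exp (-(M * S)))) (Real.exp (S * κ)) hEone
    (fun q => by positivity) (fun q => by positivity) (fun q => by
      have : Real.exp (S * μ q) * Real.exp (-(M * S)) ≤ 1 := by
        rw [← Real.exp_add, Real.exp_le_one_iff]
        nlinarith [hμM q]
      nlinarith) hdom q
  simp only [← lg_exp M hSp, ← hN] at hm2
  rw [← Real.exp_add] at hm2
  have h2N : (2 : ℝ) ^ N ≤ Real.exp N := by
    rw [← Real.exp_one_pow]
    have : (2 : ℝ) ≤ Real.exp 1 := by linarith [Real.exp_one_gt_d9]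
    gcongr
  obtain ⟨m1, m2⟩ := hm2
  have m1' : Real.exp (S * μ q + -(S * lg M S (A' j' q))) ≤ Real.exp (N + S * κ) := by
    rw [Real.exp_add (N : ℝ)]
    exact m1.trans (by gcongr)
  have m2' : Real.exp 0 ≤ Real.exp (N + S * κ + (S * μ q + -(S * lg M S (A' j' q)))) := by
    rw [Real.exp_add (N + S * κ), Real.exp_add (N : ℝ), Real.exp_zero]
    exact m2.trans (by gcongr)
  rw [Real.exp_le_exp] at m1' m2'
  have hNS : (N : ℝ) ≤ S * (δ / 2) := by
    have : κ * S ≤ δ / 2 * S := by gcongr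
    linarith
  change |μ q - _| ≤ δ
  rw [abs_le]
  constructor
  · have : S * (-δ) ≤ S * (μ q - lg M S (A' j' q)) := by nlinarith
    exact le_of_mul_le_mul_left this hSp
  · have : S * (μ q - lg M S (A' j' q)) ≤ S * δ := by nlinarith
    exact le_of_mul_le_mul_left this hSp

end Kuw

namespace Kuw

lemma sym_lemma {𝒮 : Type*} [CommRing 𝒮] (d : ℕ) (Q : Polynomial 𝒮)
    {R : Type} [Fintype R] (B : R → Polynomial 𝒮) :
    ∃ c' : (Fin d → R) → 𝒮, ∀ (ev : 𝒮 →+* ℂ) (ρ : Fin d → ℂ),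
      Q.map ev = ∏ j, (Polynomial.X - Polynomial.C (ρ j)) →
      ∀ ψ, ev (c' ψ) = Cf ψ (fun j r => ((B r).map ev).eval (ρ j)) := by
  classical
  let P : Polynomial (MvPolynomial R 𝒮) :=
    ∑ r, Polynomial.C (MvPolynomial.X r) * (B r).map MvPolynomial.C
  let n := P.natDegree
  let Res : MvPolynomial R 𝒮 := Polynomial.resultant (Q.map MvPolynomial.C) P d n
  refine ⟨fun ψ => MvPolynomial.coeff (cls ψ) Res, fun ev ρ hQ ψ => ?_⟩
  rw [← MvPolynomial.coeff_map]
  have h1 : MvPolynomial.map ev Res = ∏ j, ∑ r, MvPolynomial.C (((B r).map ev).eval (ρ j)) * MvPolynomial.X r := by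
    change (MvPolynomial.map ev) (Polynomial.resultant _ _ _ _) = _
    rw [← Polynomial.resultant_map_map]
    have e1 : (Q.map MvPolynomial.C).map (MvPolynomial.map ev) =
        ∏ j, (Polynomial.X - Polynomial.C (MvPolynomial.C (ρ j) : MvPolynomial R ℂ)) := by
      rw [Polynomial.map_map]
      have : (MvPolynomial.map ev).comp (MvPolynomial.C (σ := R)) = (MvPolynomial.C (σ := R)).comp ev := by
        ext; simp
      rw [this, ← Polynomial.map_map, hQ, Polynomial.map_prod]
      simp
    have e2 : P.map (MvPolynomial.map ev) =
        ∑ r, Polynomial.C (MvPolynomial.X r) * ((B r).map ev).map MvPolynomial.C := by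
      simp only [P, Polynomial.map_sum, Polynomial.map_mul, Polynomial.map_C, MvPolynomial.map_X, Polynomial.map_map]
      have : (MvPolynomial.map ev).comp (MvPolynomial.C (σ := R)) = (MvPolynomial.C (σ := R)).comp ev := by
        ext; simp
      rw [this]
    have hdeg : (∏ j, (Polynomial.X - Polynomial.C (MvPolynomial.C (ρ j) : MvPolynomial R ℂ))).natDegree = d := by
      rw [Polynomial.natDegree_finsetProd_X_sub_C_eq_card]; simp
    have hdegP : (P.map (MvPolynomial.map ev)).natDegree ≤ n := Polynomial.natDegree_map_le
    rw [e1, e2]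
    rw [e2] at hdegP
    have hspl : (∏ j, (Polynomial.X - Polynomial.C (MvPolynomial.C (ρ j) : MvPolynomial R ℂ))).Splits := by
      exact Polynomial.Splits.prod fun j _ => Polynomial.Splits.X_sub_C _
    have := Polynomial.resultant_eq_prod_eval _ _ n hdegP hspl
    rw [hdeg] at this
    rw [this, (Polynomial.monic_prod_of_monic _ _ fun j _ => Polynomial.monic_X_sub_C _).leadingCoeff, one_pow, one_mul]
    have hr : (∏ j, (Polynomial.X - Polynomial.C (MvPolynomial.C (ρ j) : MvPolynomial R ℂ))).roots =
       Finset.univ.val.map fun j => (MvPolynomial.C (ρ j) : MvPolynomial R ℂ) := by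
      rw [← Polynomial.roots_multiset_prod_X_sub_C
        (Finset.univ.val.map fun j => (MvPolynomial.C (ρ j) : MvPolynomial R ℂ)), Multiset.map_map]
      rfl
    rw [hr, Multiset.map_map]
    change ∏ j, _ = _
    refine Finset.prod_congr rfl fun j _ => ?_
    simp only [Function.comp, Polynomial.eval_finsetSum, Polynomial.eval_mul, Polynomial.eval_C]
    refine Finset.sum_congr rfl fun r _ => ?_
    rw [Polynomial.eval_map, Polynomial.eval₂_at_apply, mul_comm]
  rw [h1]; rfl

end Kuw

namespace Kuw
open Polynomial in
lemma coeff_prod_bound {ι : Type*} (J : Finset ι) (b : ι → ℂ) (r : ℝ) (hr : 0 ≤ r) (k : ℕ) :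
    ‖(∏ i ∈ J, (X + C (b i))).coeff k‖ * r ^ k ≤ ∏ i ∈ J, (r + ‖b i‖) := by
  classical
  induction J using Finset.induction_on generalizing k with
  | empty =>
    simp only [Finset.prod_empty, coeff_one]
    split_ifs with h <;> simp [h]
  | insert i J hi ih =>
    rw [Finset.prod_insert hi, Finset.prod_insert hi]
    set q := ∏ i ∈ J, (X + C (b i))
    rcases k with _ | k
    · have := ih 0
      simp only [pow_zero, mul_one] at this ⊢
      rw [add_mul, coeff_add, coeff_X_mul_zero, zero_add, coeff_C_mul, norm_mul]
      have h0 : 0 ≤ ∏ i ∈ J, (r + ‖b i‖) := Finset.prod_nonneg fun _ _ => by positivity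
      nlinarith [norm_nonneg (b i)]
    · rw [add_mul, coeff_add, coeff_X_mul, coeff_C_mul]
      have h1 := ih k
      have h2 := ih (k + 1)
      calc ‖q.coeff k + b i * q.coeff (k + 1)‖ * r ^ (k + 1)
          ≤ (‖q.coeff k‖ + ‖b i‖ * ‖q.coeff (k + 1)‖) * r ^ (k + 1) := by
            gcongr; rw [← norm_mul]; exact norm_add_le _ _
        _ = r * (‖q.coeff k‖ * r ^ k) + ‖b i‖ * (‖q.coeff (k + 1)‖ * r ^ (k + 1)) := by ring
        _ ≤ r * ∏ i ∈ J, (r + ‖b i‖) + ‖b i‖ * ∏ i ∈ J, (r + ‖b i‖) := by gcongr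
        _ = _ := by ring

open Polynomial in
lemma taylor_form {d : ℕ} (ρ : Fin d → ℂ) (J : Finset (Fin d)) (sc a : ℂ) :
    taylor a (C sc * ∏ i ∈ J, (X - C (ρ i))) = C sc * ∏ i ∈ J, (X + C (a - ρ i)) := by
  have h : taylor a (∏ i ∈ J, (X - C (ρ i))) = ∏ i ∈ J, taylor a (X - C (ρ i)) :=
    map_prod (taylorAlgHom a) (fun i => X - C (ρ i)) J
  rw [taylor_mul, taylor_C, h]
  congr 1
  refine Finset.prod_congr rfl fun i _ => ?_
  simp [map_sub]
  ring

open Polynomial in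
lemma taylor_bound {d : ℕ} (ρ : Fin d → ℂ) (J : Finset (Fin d)) (sc a : ℂ) (r : ℝ) (hr : 0 ≤ r) (k : ℕ) :
    ‖(taylor a (C sc * ∏ i ∈ J, (X - C (ρ i)))).coeff k‖ * r ^ k ≤ ‖sc‖ * ∏ i ∈ J, (r + ‖a - ρ i‖) := by
  rw [taylor_form, coeff_C_mul, norm_mul, mul_assoc]
  exact mul_le_mul_of_nonneg_left (coeff_prod_bound J _ r hr k) (norm_nonneg _)

open Polynomial in
/-- good pairs -/
lemma good_pair {d : ℕ} (ρ : Fin d → ℂ) (J : Finset (Fin d)) (sc a z : ℂ) (K : ℝ) (hK : 1 ≤ K)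
    (hsc : ‖sc‖ ≤ 1) (ha : ∀ i, ‖a - ρ i‖ ≤ 1) (hz : ‖z - a‖ ≤ 1)
    (hgood : ∀ i, ‖z - a‖ + ‖a - ρ i‖ ≤ K * ‖z - ρ i‖) (ε : ℝ) (hε : 0 < ε) (hε1 : ε ≤ 1)
    (p : ℂ[X]) (hp : p = C sc * ∏ i ∈ J, (X - C (ρ i))) :
    ‖p.eval z‖ + ε ≤ ∑ k : Fin (d + 1), (‖(taylor a p).coeff k‖ + ε) * (‖z - a‖ + ε) ^ (k : ℕ) ∧
    ∑ k : Fin (d + 1), (‖(taylor a p).coeff k‖ + ε) * (‖z - a‖ + ε) ^ (k : ℕ) ≤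
      (d + 1) * (2 ^ d * K ^ d + 2 ^ d * 2 ^ d + 2 ^ d) * (‖p.eval z‖ + ε) := by
  have hJd : J.card ≤ d := by simpa using Finset.card_le_univ J
  constructor
  · have h1 : p.eval z = ∑ k : Fin (d + 1), (taylor a p).coeff k * (z - a) ^ (k : ℕ) := by
      rw [Fin.sum_univ_eq_sum_range (fun k => (taylor a p).coeff k * (z - a) ^ k),
        ← eval_eq_sum_range' (n := d + 1), taylor_eval, sub_add_cancel]
      rw [natDegree_taylor, hp]
      refine Nat.lt_succ_of_le ((natDegree_C_mul_le _ _).trans ?_)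
      rw [natDegree_finsetProd_X_sub_C_eq_card]; exact hJd
    rw [h1, Fin.sum_univ_succ, Fin.sum_univ_succ]
    simp only [Fin.val_zero, pow_zero, mul_one]
    have h2 : ‖∑ i : Fin d, (taylor a p).coeff (i.succ : ℕ) * (z - a) ^ (i.succ : ℕ)‖ ≤
        ∑ i : Fin d, (‖(taylor a p).coeff (i.succ : ℕ)‖ + ε) * (‖z - a‖ + ε) ^ (i.succ : ℕ) := by
      refine (norm_sum_le _ _).trans (Finset.sum_le_sum fun k _ => ?_)
      rw [norm_mul, norm_pow]
      gcongr <;> linarith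
    have := norm_add_le ((taylor a p).coeff 0) (∑ i : Fin d, (taylor a p).coeff (i.succ : ℕ) * (z - a) ^ (i.succ : ℕ))
    linarith
  · have hev : ‖p.eval z‖ = ‖sc‖ * ∏ i ∈ J, ‖z - ρ i‖ := by
      rw [hp, eval_mul, eval_C, eval_prod, norm_mul, norm_prod]; simp
    have hA : ∀ k : ℕ, ‖(taylor a p).coeff k‖ * ‖z - a‖ ^ k ≤ K ^ d * ‖p.eval z‖ := by
      intro k
      have := taylor_bound ρ J sc a ‖z - a‖ (norm_nonneg _) k
      rw [← hp] at this
      refine this.trans ?_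
      rw [hev]
      have h2 : ∏ i ∈ J, (‖z - a‖ + ‖a - ρ i‖) ≤ ∏ i ∈ J, (K * ‖z - ρ i‖) :=
        Finset.prod_le_prod (fun _ _ => by positivity) fun i _ => hgood i
      rw [Finset.prod_mul_distrib, Finset.prod_const] at h2
      have h3 : K ^ J.card ≤ K ^ d := pow_le_pow_right₀ hK hJd
      calc _ ≤ ‖sc‖ * (K ^ J.card * ∏ i ∈ J, ‖z - ρ i‖) := by gcongr
        _ ≤ ‖sc‖ * (K ^ d * ∏ i ∈ J, ‖z - ρ i‖) := by gcongr
        _ = _ := by ring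
    have hA1 : ∀ k : ℕ, ‖(taylor a p).coeff k‖ ≤ 2 ^ d := by
      intro k
      have := taylor_bound ρ J sc a 1 zero_le_one k
      rw [← hp, one_pow, mul_one] at this
      refine this.trans ?_
      have h2 : ∏ i ∈ J, (1 + ‖a - ρ i‖) ≤ ∏ i ∈ J, (2 : ℝ) :=
        Finset.prod_le_prod (fun _ _ => by positivity) fun i _ => by linarith [ha i]
      rw [Finset.prod_const] at h2
      have h3 : (2 : ℝ) ^ J.card ≤ 2 ^ d := pow_le_pow_right₀ (by norm_num) hJd
      calc _ ≤ 1 * ∏ i ∈ J, (1 + ‖a - ρ i‖) := by gcongr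
        _ ≤ _ := by linarith
    set r := ‖z - a‖ with hr
    have hr0 : 0 ≤ r := norm_nonneg _
    have hterm : ∀ k : Fin (d + 1), (‖(taylor a p).coeff k‖ + ε) * (r + ε) ^ (k : ℕ) ≤
        (2 ^ d * K ^ d + 2 ^ d * 2 ^ d + 2 ^ d) * (‖p.eval z‖ + ε) := by
      intro k
      have hk : (k : ℕ) ≤ d := Nat.lt_succ_iff.1 k.2
      have h2k : (2 : ℝ) ^ (k : ℕ) ≤ 2 ^ d := pow_le_pow_right₀ (by norm_num) hk
      have e1 : (r + ε) ^ (k : ℕ) ≤ 2 ^ d * (r ^ (k : ℕ) + ε) := by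
        rcases Nat.eq_zero_or_pos (k : ℕ) with h0 | h0
        · rw [h0]; simp only [pow_zero]
          have : (1 : ℝ) ≤ 2 ^ d := one_le_pow₀ (by norm_num)
          nlinarith
        · have hεk : ε ^ (k : ℕ) ≤ ε := by
            have := pow_le_pow_of_le_one hε.le hε1 (show 1 ≤ (k : ℕ) from h0)
            simpa using this
          rcases le_total r ε with h | h
          · calc (r + ε) ^ (k : ℕ) ≤ (2 * ε) ^ (k : ℕ) := by gcongr; linarith
              _ = 2 ^ (k : ℕ) * ε ^ (k : ℕ) := mul_pow _ _ _
              _ ≤ 2 ^ d * (r ^ (k : ℕ) + ε) := by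
                have : 0 ≤ r ^ (k : ℕ) := by positivity
                gcongr; linarith
          · calc (r + ε) ^ (k : ℕ) ≤ (2 * r) ^ (k : ℕ) := by gcongr; linarith
              _ = 2 ^ (k : ℕ) * r ^ (k : ℕ) := mul_pow _ _ _
              _ ≤ 2 ^ d * (r ^ (k : ℕ) + ε) := by gcongr; linarith
      have e2 : (r + ε) ^ (k : ℕ) ≤ 2 ^ d := by
        calc (r + ε) ^ (k : ℕ) ≤ 2 ^ (k : ℕ) := by gcongr; linarith
          _ ≤ _ := h2k
      have e3 : ‖(taylor a p).coeff k‖ * (r + ε) ^ (k : ℕ) ≤ 2 ^ d * (K ^ d * ‖p.eval z‖ + 2 ^ d * ε) := by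
        calc _ ≤ ‖(taylor a p).coeff k‖ * (2 ^ d * (r ^ (k : ℕ) + ε)) := by gcongr
          _ = 2 ^ d * (‖(taylor a p).coeff k‖ * r ^ (k : ℕ) + ‖(taylor a p).coeff k‖ * ε) := by ring
          _ ≤ _ := mul_le_mul_of_nonneg_left
            (add_le_add (hA k) (mul_le_mul_of_nonneg_right (hA1 k) hε.le)) (by positivity)
      have e4 : ε * (r + ε) ^ (k : ℕ) ≤ ε * 2 ^ d := by gcongr
      have hK0 : 0 ≤ K := by linarith
      have p1 : 0 ≤ (2 ^ d * 2 ^ d + 2 ^ d : ℝ) * ‖p.eval z‖ := by positivity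
      have p2 : 0 ≤ 2 ^ d * K ^ d * ε := by positivity
      nlinarith
    have := Finset.sum_le_card_nsmul Finset.univ _ _ (fun k _ => hterm k)
    simpa [mul_assoc] using this


open Polynomial in
/-- data of a good pair -/
def GP {d : ℕ} (K Cc : ℝ) (ρ : Fin d → ℂ) (p : ℂ[X]) (a z cv : ℂ) : Prop :=
  (∃ (J : Finset (Fin d)) (sc : ℂ), ‖sc‖ ≤ 1 ∧ p = C sc * ∏ i ∈ J, (X - C (ρ i))) ∧
  (∀ i, ‖a - ρ i‖ ≤ 1) ∧ ‖z - a‖ ≤ 1 ∧ (∀ i, ‖z - a‖ + ‖a - ρ i‖ ≤ K * ‖z - ρ i‖) ∧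
  ‖cv‖ ≤ Cc * ‖p.eval z‖ ∧ ‖p.eval z‖ ≤ Cc * ‖cv‖

open Polynomial in
lemma lg_compare (d : ℕ) (K Cc : ℝ) (hK : 1 ≤ K) (hCc : 1 ≤ Cc) : ∃ C', 0 ≤ C' ∧
    ∀ M δ T S : ℝ, 0 ≤ M → 0 < T → 0 < S → ∀ (ρ ρ' : Fin d → ℂ) (p p' : ℂ[X]) (a z cv a' z' cv' : ℂ),
    GP K Cc ρ p a z cv → GP K Cc ρ' p' a' z' cv' →
    (∀ k : Fin (d + 1), |lg M T ((taylor a p).coeff k) - lg M S ((taylor a' p').coeff k)| ≤ δ) →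
    |lg M T (z - a) - lg M S (z' - a')| ≤ δ →
    lg M S cv' ≤ lg M T cv + (d + 1) * δ + C' / T + C' / S := by
  set D : ℝ := (d + 1) * (2 ^ d * K ^ d + 2 ^ d * 2 ^ d + 2 ^ d) with hD
  have hK0 : 0 ≤ K := by linarith
  have hD1 : 1 ≤ D := by
    have h1 : (1 : ℝ) ≤ 2 ^ d := one_le_pow₀ (by norm_num)
    have h2 : 0 ≤ (2 : ℝ) ^ d * K ^ d := by positivity
    have h3 : (0 : ℝ) ≤ d := by positivity
    rw [hD]
    have h4 : 1 ≤ (2 : ℝ) ^ d * K ^ d + 2 ^ d * 2 ^ d + 2 ^ d := by nlinarith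
    nlinarith
  have hl1 : 0 ≤ Real.log Cc := Real.log_nonneg hCc
  have hl2 : 0 ≤ Real.log (d + 1) := Real.log_nonneg (by have : (0 : ℝ) ≤ d := by positivity
                                                         linarith)
  have hl3 : 0 ≤ Real.log (D * Cc) := Real.log_nonneg (by nlinarith)
  refine ⟨Real.log Cc + Real.log (d + 1) + Real.log (D * Cc), by positivity, ?_⟩
  intro M δ T S hM hT hS ρ ρ' p p' a z cv a' z' cv' h h' hk hz
  obtain ⟨⟨J, sc, hsc, hp⟩, h2, h3, h4, h5, -⟩ := h
  obtain ⟨⟨J', sc', hsc', hp'⟩, h2', h3', h4', -, h6'⟩ := h'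
  have hδ : 0 ≤ δ := (abs_nonneg _).trans hz
  have hεT : Real.exp (-(M * T)) ≤ 1 := Real.exp_le_one_iff.2 (by nlinarith)
  have hεS : Real.exp (-(M * S)) ≤ 1 := Real.exp_le_one_iff.2 (by nlinarith)
  have g1 := (good_pair ρ J sc a z K hK hsc h2 h3 h4 _ (Real.exp_pos _) hεT p hp).1
  have g2 := (good_pair ρ' J' sc' a' z' K hK hsc' h2' h3' h4' _ (Real.exp_pos _) hεS p' hp').2
  have conv : ∀ (M T : ℝ), 0 < T → ∀ (p : ℂ[X]) (a z : ℂ),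
      ∑ k : Fin (d + 1), (‖(taylor a p).coeff k‖ + Real.exp (-(M * T))) * (‖z - a‖ + Real.exp (-(M * T))) ^ (k : ℕ) =
      ∑ k : Fin (d + 1), Real.exp (T * (-lg M T ((taylor a p).coeff k) + (k : ℕ) * (- lg M T (z - a)))) := by
    intro M T hT p a z
    refine Finset.sum_congr rfl fun k _ => ?_
    rw [← lg_exp M hT, ← lg_exp M hT, ← Real.exp_nat_mul, ← Real.exp_add]
    congr 1; ring
  rw [conv M T hT] at g1
  rw [conv M S hS, ← hD] at g2
  have L := lse (δ := (d + 1) * δ) hT hS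
    (fun k : Fin (d + 1) => (-lg M T ((taylor a p).coeff k) + (k : ℕ) * (- lg M T (z - a))))
    (fun k : Fin (d + 1) => (-lg M S ((taylor a' p').coeff k) + (k : ℕ) * (- lg M S (z' - a')))) (by
      intro k
      have e1 := (abs_le.1 (hk k)).1
      have e2 := (abs_le.1 hz).1
      have e3 : ((k : ℕ) : ℝ) ≤ d := by exact_mod_cast Nat.lt_succ_iff.1 k.2
      have e4 : ((k : ℕ) : ℝ) * (lg M S (z' - a') - lg M T (z - a)) ≤ (k : ℕ) * δ := by
        refine mul_le_mul_of_nonneg_left (by linarith) (by positivity)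
      nlinarith)
  have hdd : Real.log (Fintype.card (Fin (d + 1)) : ℝ) = Real.log (d + 1) := by simp
  rw [hdd] at L
  set sgT := ∑ k : Fin (d + 1), Real.exp (T * (-lg M T ((taylor a p).coeff k) + (k : ℕ) * (- lg M T (z - a))))
  set sgS := ∑ k : Fin (d + 1), Real.exp (S * (-lg M S ((taylor a' p').coeff k) + (k : ℕ) * (- lg M S (z' - a'))))
  have hsgT : 0 < sgT := Finset.sum_pos (fun _ _ => Real.exp_pos _) Finset.univ_nonempty
  have hsgS : 0 < sgS := Finset.sum_pos (fun _ _ => Real.exp_pos _) Finset.univ_nonempty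
  have i1 : -lg M T cv ≤ Real.log Cc / T + Real.log sgT / T := by
    rw [← add_div, ← Real.log_mul (by linarith) hsgT.ne', le_div_iff₀ hT, Real.le_log_iff_exp_le (by positivity)]
    have : -lg M T cv * T = -(T * lg M T cv) := by ring
    rw [this, lg_exp M hT]
    nlinarith [Real.exp_pos (-(M * T))]
  have i2 : Real.log sgS / S ≤ Real.log (D * Cc) / S + -lg M S cv' := by
    have e : Real.log (Real.exp (-(S * lg M S cv'))) = - (S * lg M S cv') := Real.log_exp _
    have h7 : sgS ≤ (D * Cc) * Real.exp (-(S * lg M S cv')) := by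
      rw [lg_exp M hS]
      refine g2.trans ?_
      rw [mul_assoc D Cc]
      refine mul_le_mul_of_nonneg_left ?_ (zero_le_one.trans hD1)
      nlinarith [Real.exp_pos (-(M * S))]
    have h8 := Real.log_le_log hsgS h7
    rw [Real.log_mul (mul_pos (by linarith) (by linarith)).ne' (Real.exp_pos _).ne', e] at h8
    rw [div_le_iff₀ hS, add_mul, div_mul_cancel₀ _ hS.ne']
    linarith
  have j1 : (Real.log Cc + Real.log (d + 1) + Real.log (D * Cc)) / T ≥ Real.log Cc / T + Real.log (d + 1) / T := by
    rw [← add_div]; exact div_le_div_of_nonneg_right (by linarith) hT.le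
  have j2 : (Real.log Cc + Real.log (d + 1) + Real.log (D * Cc)) / S ≥ Real.log (D * Cc) / S :=
    div_le_div_of_nonneg_right (by linarith) hS.le
  linarith

end Kuw

namespace Kuw

/-- asymptotic uniform continuity -/
def AUC {X ι : Type*} (s : Set X) (U : ι → ℝ → X → ℝ) (F : ℝ → X → ℝ) : Prop :=
  ∀ η > 0, ∃ δ > 0, ∃ T0 > 0, ∀ T ≥ T0, ∀ S ≥ T0, ∀ x ∈ s, ∀ y ∈ s,
    (∀ i, |U i T x - U i S y| ≤ δ) → F T x ≤ F S y + η

lemma annulus_vol {d : ℕ} (hd : 0 < d) (a : ℂ) (ρ : Fin d → ℂ) (R : ℝ) (hR : 0 < R) :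
    ENNReal.ofReal (R ^ 2) ≤ volume {w : ℂ | w ∈ Metric.closedBall a R ∧ ∀ i, R / (2 * d) ≤ ‖w - ρ i‖} := by
  set G := {w : ℂ | w ∈ Metric.closedBall a R ∧ ∀ i, R / (2 * d) ≤ ‖w - ρ i‖} with hG
  have hsub : Metric.closedBall a R ⊆ G ∪ ⋃ i, Metric.ball (ρ i) (R / (2 * d)) := by
    intro w hw
    by_cases h : ∀ i, R / (2 * d) ≤ ‖w - ρ i‖
    · exact Or.inl ⟨hw, h⟩
    · push Not at h
      obtain ⟨i, hi⟩ := h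
      exact Or.inr (Set.mem_iUnion.2 ⟨i, by rwa [mem_ball_iff_norm]⟩)
  have h1 := (measure_mono (μ := volume) hsub).trans (measure_union_le _ _)
  have h2 : volume (⋃ i, Metric.ball (ρ i) (R / (2 * d))) ≤ ENNReal.ofReal (Real.pi * R ^ 2 / 4) := by
    refine (measure_iUnion_le _).trans ?_
    rw [tsum_fintype]
    simp only [Complex.volume_ball]
    rw [Finset.sum_const, Finset.card_univ, Fintype.card_fin, nsmul_eq_mul,
      ← ENNReal.ofReal_pow (by positivity)]
    rw [← ENNReal.ofReal_coe_nnreal, ← ENNReal.ofReal_natCast, ← ENNReal.ofReal_mul (by positivity),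
      ← ENNReal.ofReal_mul (by positivity)]
    refine ENNReal.ofReal_le_ofReal ?_
    rw [NNReal.coe_real_pi]
    have hd1 : (1 : ℝ) ≤ d := by exact_mod_cast hd
    have : (d : ℝ) * ((R / (2 * d)) ^ 2 * Real.pi) = Real.pi * R ^ 2 / 4 / d := by
      field_simp; ring
    rw [this]
    exact div_le_self (by positivity) hd1
  have h3 : volume (Metric.closedBall a R) = ENNReal.ofReal (Real.pi * R ^ 2) := by
    rw [Complex.volume_closedBall, ← ENNReal.ofReal_pow hR.le, ← ENNReal.ofReal_coe_nnreal,
      ← ENNReal.ofReal_mul (by positivity), NNReal.coe_real_pi, mul_comm]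
  rw [h3] at h1
  have h4 : ENNReal.ofReal (Real.pi * R ^ 2) ≤ volume G + ENNReal.ofReal (Real.pi * R ^ 2 / 4) :=
    h1.trans (by gcongr)
  have h5 : ENNReal.ofReal (Real.pi * R ^ 2) - ENNReal.ofReal (Real.pi * R ^ 2 / 4) ≤ volume G :=
    tsub_le_iff_right.2 h4
  refine le_trans ?_ h5
  rw [← ENNReal.ofReal_sub _ (by positivity)]
  refine ENNReal.ofReal_le_ofReal ?_
  nlinarith [Real.pi_gt_three, sq_nonneg R]

lemma log_int (θ : ℝ) (hθ : 0 < θ) (hθ2 : θ < 2) : ∃ C > 0, ∀ ε : ℝ, 0 < ε → ∀ ρ : ℂ, ∀ s ⊆ Metric.ball ρ 1,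
    ∫ z in s, ((‖z - ρ‖ + ε) ^ 2)⁻¹ ≤ C * ε ^ (-θ) := by
  have hI : IntegrableOn (fun u : ℂ => ‖u‖ ^ (-(2 - θ))) (Metric.ball 0 1) := by
    refine integrableOn_ball_of_norm_le_rpow (C := 1) (α := 2 - θ) (by simp) (by simp; linarith) ?_ ?_
    · refine Filter.Eventually.of_forall fun x => ?_
      rw [Real.norm_eq_abs, abs_of_nonneg (by positivity), one_mul]
    · exact (measurable_norm.pow_const _).aestronglyMeasurable
  refine ⟨(∫ u in Metric.ball (0 : ℂ) 1, ‖u‖ ^ (-(2 - θ))) + 1, ?_, ?_⟩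
  · have : 0 ≤ ∫ u in Metric.ball (0 : ℂ) 1, ‖u‖ ^ (-(2 - θ)) :=
      integral_nonneg fun _ => by positivity
    linarith
  intro ε hε ρ s hs
  have hcont : Continuous fun z : ℂ => ((‖z - ρ‖ + ε) ^ 2)⁻¹ := by
    refine Continuous.inv₀ (by fun_prop) fun z => ?_
    positivity
  have hintg : IntegrableOn (fun z : ℂ => ((‖z - ρ‖ + ε) ^ 2)⁻¹) (Metric.ball ρ 1) :=
    (hcont.continuousOn.integrableOn_compact (isCompact_closedBall ρ 1)).mono_set Metric.ball_subset_closedBall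
  have h1 : ∫ z in s, ((‖z - ρ‖ + ε) ^ 2)⁻¹ ≤ ∫ z in Metric.ball ρ 1, ((‖z - ρ‖ + ε) ^ 2)⁻¹ :=
    setIntegral_mono_set hintg (Filter.Eventually.of_forall fun z => by positivity) (hs.eventuallyLE)
  have h2 : ∫ z in Metric.ball ρ 1, ((‖z - ρ‖ + ε) ^ 2)⁻¹ = ∫ u in Metric.ball (0 : ℂ) 1, ((‖u‖ + ε) ^ 2)⁻¹ := by
    rw [← integral_indicator Metric.isOpen_ball.measurableSet, ← integral_indicator Metric.isOpen_ball.measurableSet,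
      ← integral_sub_right_eq_self (fun z => Set.indicator (Metric.ball 0 1) (fun u : ℂ => ((‖u‖ + ε) ^ 2)⁻¹) z) ρ]
    congr 1; ext z
    simp only [Set.indicator, Metric.mem_ball, dist_eq_norm, sub_zero]
  have h3 : ∫ u in Metric.ball (0 : ℂ) 1, ((‖u‖ + ε) ^ 2)⁻¹ ≤
      ∫ u in Metric.ball (0 : ℂ) 1, ε ^ (-θ) * ‖u‖ ^ (-(2 - θ)) := by
    refine integral_mono_ae ?_ (hI.const_mul _) ?_
    · refine ((Continuous.inv₀ (by fun_prop) fun z => ?_ : Continuous fun z : ℂ => ((‖z‖ + ε) ^ 2)⁻¹).continuousOn.integrableOn_compact (isCompact_closedBall 0 1)).mono_set Metric.ball_subset_closedBall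
      positivity
    · refine ae_restrict_of_ae ?_
      have h0 : ∀ᵐ u : ℂ, u ≠ 0 := by simp [ae_iff, measure_singleton]
      filter_upwards [h0] with u hu
      have hu' : 0 < ‖u‖ := norm_pos_iff.2 hu
      have hb : 0 < ‖u‖ + ε := by positivity
      have e1 : ((‖u‖ + ε) ^ 2)⁻¹ = (‖u‖ + ε) ^ (-θ) * (‖u‖ + ε) ^ (-(2 - θ)) := by
        rw [← Real.rpow_add hb, ← Real.rpow_natCast, ← Real.rpow_neg hb.le]
        congr 1; push_cast; ring
      rw [e1]
      refine mul_le_mul ?_ ?_ (by positivity) (by positivity)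
      · exact Real.rpow_le_rpow_of_nonpos hε (by linarith) (by linarith)
      · exact Real.rpow_le_rpow_of_nonpos hu' (by linarith) (by linarith)
  rw [integral_const_mul] at h3
  have : 0 < ε ^ (-θ) := by positivity
  nlinarith

end Kuw

namespace Kuw

def Gd {d : ℕ} (ρ : Fin d → ℂ) (a : ℂ) (R : ℝ) : Set ℂ :=
  {w : ℂ | w ∈ Metric.closedBall a R ∧ ∀ i, R / (2 * d) ≤ ‖w - ρ i‖}

lemma Gd_meas {d : ℕ} (ρ : Fin d → ℂ) (a : ℂ) (R : ℝ) : MeasurableSet (Gd ρ a R) := by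
  have : Gd ρ a R = Metric.closedBall a R ∩ ⋂ i, {w : ℂ | R / (2 * d) ≤ ‖w - ρ i‖} := by
    ext w; simp [Gd]
  rw [this]
  refine Metric.isClosed_closedBall.measurableSet.inter (MeasurableSet.iInter fun i => ?_)
  exact (isClosed_le continuous_const (by fun_prop)).measurableSet

lemma coreP1 {d : ℕ} (hd : 0 < d) {r M S τ : ℝ} (hr : 0 < r) (hr4 : r ≤ 1 / 4)
    (hS : 0 < S) (hτ : 0 ≤ τ) (hτM : τ ≤ M) (ρ : Fin d → ℂ) (hρ : ∀ i, ‖ρ i‖ ≤ r / 2) (j : Fin d) (w : ℂ)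
    (hw : w ∈ Gd ρ (ρ j) (r / 4 * Real.exp (-(τ * S)))) :
    w ∈ Metric.ball (0 : ℂ) r ∧ ‖w - ρ j‖ ≤ 1 ∧ (∀ i, ‖w - ρ j‖ + ‖ρ j - ρ i‖ ≤ (4 * d + 1) * ‖w - ρ i‖) ∧
    |lg M S (w - ρ j) - τ| ≤ (1 + |Real.log (r / (8 * d))|) / S := by
  obtain ⟨h1, h2⟩ := hw
  rw [mem_closedBall_iff_norm] at h1
  set e := Real.exp (-(τ * S)) with he
  have he0 : 0 < e := Real.exp_pos _
  have he1 : e ≤ 1 := Real.exp_le_one_iff.2 (by nlinarith)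
  have hd1 : (1 : ℝ) ≤ d := by exact_mod_cast hd
  refine ⟨?_, ?_, ?_, ?_⟩
  · rw [mem_ball_zero_iff]
    have := norm_add_le (w - ρ j) (ρ j)
    rw [sub_add_cancel] at this
    have := hρ j
    nlinarith
  · nlinarith
  · intro i
    have h3 : ‖ρ j - ρ i‖ ≤ ‖w - ρ j‖ + ‖w - ρ i‖ := by
      have := norm_add_le (ρ j - w) (w - ρ i)
      rwa [sub_add_sub_cancel, norm_sub_rev (ρ j) w] at this
    have h4 := h2 i
    rw [div_le_iff₀ (by positivity)] at h4
    nlinarith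
  · have h4 := h2 j
    have hM : Real.exp (-(M * S)) ≤ e := Real.exp_le_exp.2 (by nlinarith)
    have hpos : 0 < ‖w - ρ j‖ + Real.exp (-(M * S)) := by positivity
    have hlow : r / (8 * d) * e ≤ ‖w - ρ j‖ + Real.exp (-(M * S)) := by
      have : r / (8 * d) * e = r / 4 * e / (2 * d) := by field_simp; ring
      rw [this]; have := Real.exp_pos (-(M * S)); linarith
    have hup : ‖w - ρ j‖ + Real.exp (-(M * S)) ≤ 2 * e := by nlinarith
    have l1 := Real.log_le_log (by positivity) hlow
    have l2 := Real.log_le_log hpos hup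
    rw [Real.log_mul (by positivity) he0.ne', he, Real.log_exp] at l1 l2
    have l3 : Real.log 2 ≤ 1 := by have := Real.log_two_lt_d9; linarith
    have l4 := neg_abs_le (Real.log (r / (8 * d)))
    have l5 := abs_nonneg (Real.log (r / (8 * d)))
    have e1 : lg M S (w - ρ j) - τ = (-Real.log (‖w - ρ j‖ + Real.exp (-(M * S))) - τ * S) / S := by
      unfold lg; field_simp
    rw [e1, abs_div, abs_of_pos hS]
    refine div_le_div_of_nonneg_right (abs_le.2 ⟨?_, ?_⟩) hS.le <;> linarith

lemma expint {s : Set ℂ} (hs : MeasurableSet s) (hv : volume s ≠ ⊤) {G : ℂ → ℝ} (hG : Measurable G) {B T : ℝ} 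
    (hB : ∀ z ∈ s, |G z| ≤ B) : IntegrableOn (fun z => Real.exp (T * G z)) s := by
  refine Measure.integrableOn_of_bounded (M := Real.exp (|T| * B)) hv (by fun_prop) ?_
  filter_upwards [ae_restrict_mem hs] with z hz
  rw [Real.norm_eq_abs, abs_of_pos (Real.exp_pos _)]
  refine Real.exp_le_exp.2 ((le_abs_self _).trans ?_)
  rw [abs_mul]
  exact mul_le_mul_of_nonneg_left (hB z hz) (abs_nonneg _)

lemma coreP2 {d : ℕ} (hd : 0 < d) {r S τ v B : ℝ} (hr : 0 < r)
    (hS : 0 < S) (ρ : Fin d → ℂ) (j : Fin d) (G : ℂ → ℝ) (hG : Measurable G)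
    (hB : ∀ z ∈ Metric.ball (0 : ℂ) r, |G z| ≤ B)
    (hsub : Gd ρ (ρ j) (r / 4 * Real.exp (-(τ * S))) ⊆ Metric.ball (0 : ℂ) r)
    (hv : ∀ w ∈ Gd ρ (ρ j) (r / 4 * Real.exp (-(τ * S))), v ≤ G w) :
    v ≤ (1 / S) * Real.log (∫ z in Metric.ball (0 : ℂ) r, Real.exp (S * G z)) + 2 * τ + 2 * |Real.log (r / 4)| / S := by
  set R := r / 4 * Real.exp (-(τ * S)) with hR
  have hR0 : 0 < R := by positivity
  set D := Gd ρ (ρ j) R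
  have hI : IntegrableOn (fun z => Real.exp (S * G z)) (Metric.ball (0 : ℂ) r) :=
    expint Metric.isOpen_ball.measurableSet measure_ball_lt_top.ne hG hB
  have hDfin : volume D ≠ ⊤ := ((measure_mono hsub).trans_lt measure_ball_lt_top).ne
  have hvol : R ^ 2 ≤ volume.real D := by
    have := annulus_vol hd (ρ j) ρ R hR0
    exact (ENNReal.ofReal_le_iff_le_toReal hDfin).1 this
  have h1 : R ^ 2 * Real.exp (S * v) ≤ ∫ z in Metric.ball (0 : ℂ) r, Real.exp (S * G z) := by
    calc R ^ 2 * Real.exp (S * v) ≤ volume.real D * Real.exp (S * v) := by gcongr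
      _ = ∫ z in D, Real.exp (S * v) := by simp [integral_const]
      _ ≤ ∫ z in D, Real.exp (S * G z) := by
        refine setIntegral_mono_on ?_ (hI.mono_set hsub) (Gd_meas _ _ _) ?_
        · exact integrableOn_const hDfin
        · intro z hz; exact Real.exp_le_exp.2 (mul_le_mul_of_nonneg_left (hv z hz) hS.le)
      _ ≤ _ := setIntegral_mono_set hI (Filter.Eventually.of_forall fun z => (Real.exp_pos _).le) hsub.eventuallyLE
  have h2 := Real.log_le_log (by positivity) h1
  rw [Real.log_mul (by positivity) (by positivity), Real.log_exp, Real.log_pow, hR,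
    Real.log_mul (by positivity) (by positivity), Real.log_exp] at h2
  set L := Real.log (∫ z in Metric.ball (0 : ℂ) r, Real.exp (S * G z))
  have h3 := neg_abs_le (Real.log (r / 4))
  push_cast at h2
  have : v * S ≤ L + 2 * τ * S + 2 * |Real.log (r / 4)| := by nlinarith
  rw [← le_div_iff₀ hS] at this
  refine this.trans (le_of_eq ?_)
  field_simp

end Kuw

namespace Kuw

open Polynomial in
lemma coreP {X Λ ι : Type*} (s : Set X) (d : ℕ) (hd : 0 < d) {r M Cc : ℝ} (hr : 0 < r) (hr4 : r ≤ 1 / 4)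
    (hM : 0 < M) (hCc : 1 ≤ Cc) (ρ : X → Fin d → ℂ) (hρ : ∀ e ∈ s, ∀ i, ‖ρ e i‖ ≤ r / 2)
    (p : X → Λ → ℂ[X]) (hp : ∀ e ∈ s, ∀ l, ∃ (J : Finset (Fin d)) (sc : ℂ), ‖sc‖ ≤ 1 ∧
      p e l = C sc * ∏ i ∈ J, (Polynomial.X - Polynomial.C (ρ e i)))
    (U' : ι → ℝ → X → ℝ)
    (hmatch : ∀ δ > 0, ∃ δ' > 0, ∃ T0 > 0, ∀ T ≥ T0, ∀ S ≥ T0, ∀ x ∈ s, ∀ y ∈ s,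
      (∀ i, |U' i T x - U' i S y| ≤ δ') → ∀ j, ∃ j', ∀ l, ∀ k : Fin (d + 1),
        |lg M T ((taylor (ρ x j) (p x l)).coeff k) - lg M S ((taylor (ρ y j') (p y l)).coeff k)| ≤ δ)
    (c : Λ → X × ℂ → ℂ)
    (hc : ∀ e ∈ s, ∀ z ∈ Metric.ball (0 : ℂ) r, ∀ l,
      ‖c l (e, z)‖ ≤ Cc * ‖(p e l).eval z‖ ∧ ‖(p e l).eval z‖ ≤ Cc * ‖c l (e, z)‖)
    (F : ℝ → X × ℂ → ℝ) (hFm : ∀ T, ∀ e ∈ s, Measurable fun z => F T (e, z)) (B TB : ℝ)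
    (hB : ∀ T ≥ TB, ∀ e ∈ s, ∀ z ∈ Metric.ball (0 : ℂ) r, |F T (e, z)| ≤ B)
    (hF : AUC (s ×ˢ Metric.ball (0 : ℂ) r) (fun l T q => lg M T (c l q)) F) :
    ∀ η > 0, ∃ δ > 0, ∃ T0 > 0, ∀ T ≥ T0, ∀ S ≥ T0, ∀ x ∈ s, ∀ y ∈ s,
      (∀ i, |U' i T x - U' i S y| ≤ δ) → ∀ z ∈ Metric.ball (0 : ℂ) r, ∃ j,
      F T (x, z) ≤ (1 / S) * Real.log (∫ z in Metric.ball (0 : ℂ) r, Real.exp (S * F S (y, z))) + η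
        + 2 * lg M T (z - ρ x j) := by
  intro η hη
  have hd1 : (1 : ℝ) ≤ d := by exact_mod_cast hd
  obtain ⟨δF, hδF, T1, hT1, hF⟩ := hF (η / 2) (by positivity)
  obtain ⟨C', hC', hcmp⟩ := lg_compare d (4 * d + 1) Cc (by linarith) hCc
  set δ := δF / (2 * (d + 1)) with hδ
  have hδ0 : 0 < δ := by positivity
  obtain ⟨δ', hδ', T2, hT2, hm⟩ := hmatch δ hδ0
  set C2 := 1 + |Real.log (r / (8 * d))| with hC2
  have hC20 : 0 < C2 := by positivity
  set C3 := 2 * |Real.log (r / 4)| with hC3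
  have hC30 : 0 ≤ C3 := by positivity
  refine ⟨δ', hδ', T1 + T2 + 1 / M + |TB| + C2 / δ + 4 * C' / δF + 2 * C3 / η, by positivity, ?_⟩
  intro T hT S hS x hx y hy hxy z hz
  have hbig : ∀ T ≥ T1 + T2 + 1 / M + |TB| + C2 / δ + 4 * C' / δF + 2 * C3 / η,
      T1 ≤ T ∧ T2 ≤ T ∧ 1 / M ≤ T ∧ TB ≤ T ∧ C2 / δ ≤ T ∧ 4 * C' / δF ≤ T ∧ 2 * C3 / η ≤ T := by
    intro T hT
    have a1 : 0 < 1 / M := by positivity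
    have a2 := le_abs_self TB
    have a3 := abs_nonneg TB
    have a4 : 0 ≤ C2 / δ := by positivity
    have a5 : 0 ≤ 4 * C' / δF := by positivity
    have a6 : 0 ≤ 2 * C3 / η := by positivity
    refine ⟨?_, ?_, ?_, ?_, ?_, ?_, ?_⟩ <;> linarith
  obtain ⟨t1, t2, t3, t4, t5, t6, t7⟩ := hbig T hT
  obtain ⟨s1, s2, s3, s4, s5, s6, s7⟩ := hbig S hS
  have hT0 : 0 < T := by linarith
  have hS0 : 0 < S := by linarith
  have : Nonempty (Fin d) := ⟨⟨0, hd⟩⟩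
  obtain ⟨j, hj⟩ := Finite.exists_min fun i => ‖z - ρ x i‖
  refine ⟨j, ?_⟩
  set τ := lg M T (z - ρ x j) with hτ
  rw [mem_ball_zero_iff] at hz
  have hzj : ‖z - ρ x j‖ ≤ 3 / 8 := by
    have h1 := norm_sub_le z (ρ x j)
    have h2 := hρ x hx j
    linarith
  have hτM : τ ≤ M := lg_le M hT0 _
  have hτ0 : 0 ≤ τ := by
    have h1 : 1 ≤ M * T := by
      rw [div_le_iff₀ hM] at t3; linarith
    have h2 : Real.exp (-(M * T)) ≤ Real.exp (-1) := Real.exp_le_exp.2 (by linarith)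
    have h3 : Real.exp (-1) ≤ 1 / 2 := by
      have := Real.exp_neg_one_lt_d9; linarith
    have h4 : Real.log (‖z - ρ x j‖ + Real.exp (-(M * T))) ≤ 0 :=
      Real.log_nonpos (by positivity) (by linarith)
    rw [hτ]; unfold lg
    exact div_nonneg (by linarith) hT0.le
  obtain ⟨j', hj'⟩ := hm T t2 S s2 x hx y hy hxy j
  have hP1 := coreP1 hd hr hr4 hS0 hτ0 hτM (ρ y) (hρ y hy) j'
  have hxz : (x, z) ∈ s ×ˢ Metric.ball (0 : ℂ) r := ⟨hx, by simpa using hz⟩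
  have hroot : ∀ e ∈ s, ∀ i i', ‖ρ e i - ρ e i'‖ ≤ 1 := by
    intro e he i i'
    have h1 := norm_sub_le (ρ e i) (ρ e i')
    have h2 := hρ e he i
    have h3 := hρ e he i'
    linarith
  have key : ∀ w ∈ Gd (ρ y) (ρ y j') (r / 4 * Real.exp (-(τ * S))), F T (x, z) - η / 2 ≤ F S (y, w) := by
    intro w hw
    obtain ⟨w1, w2, w3, w4⟩ := hP1 w hw
    rw [sub_le_iff_le_add]
    refine hF T t1 S s1 (x, z) hxz (y, w) ⟨hy, w1⟩ fun l => ?_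
    have g1 : GP (4 * d + 1) Cc (ρ x) (p x l) (ρ x j) z (c l (x, z)) := by
      refine ⟨hp x hx l, hroot x hx j, by linarith, fun i => ?_, hc x hx z hxz.2 l⟩
      have h1 := hj i
      have h3 : ‖ρ x j - ρ x i‖ ≤ ‖z - ρ x j‖ + ‖z - ρ x i‖ := by
        have := norm_add_le (ρ x j - z) (z - ρ x i)
        rwa [sub_add_sub_cancel, norm_sub_rev (ρ x j) z] at this
      have := norm_nonneg (z - ρ x i)
      nlinarith
    have g2 : GP (4 * d + 1) Cc (ρ y) (p y l) (ρ y j') w (c l (y, w)) :=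
      ⟨hp y hy l, hroot y hy j', w2, w3, hc y hy w w1 l⟩
    have hCS : C2 / S ≤ δ := by
      rw [div_le_iff₀ hS0]; rw [div_le_iff₀ hδ0] at s5; linarith
    have hzz : |lg M T (z - ρ x j) - lg M S (w - ρ y j')| ≤ δ := by
      rw [abs_sub_comm]; exact w4.trans hCS
    have r1 := hcmp M δ T S hM.le hT0 hS0 (ρ x) (ρ y) (p x l) (p y l) (ρ x j) z (c l (x, z)) (ρ y j') w
      (c l (y, w)) g1 g2 (hj' l) hzz
    have r2 := hcmp M δ S T hM.le hS0 hT0 (ρ y) (ρ x) (p y l) (p x l) (ρ y j') w (c l (y, w)) (ρ x j) z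
      (c l (x, z)) g2 g1 (fun k => by rw [abs_sub_comm]; exact hj' l k) (by rw [abs_sub_comm]; exact hzz)
    have q1 : C' / T ≤ δF / 4 := by
      rw [div_le_iff₀ hT0]; rw [div_le_iff₀ hδF] at t6; linarith
    have q2 : C' / S ≤ δF / 4 := by
      rw [div_le_iff₀ hS0]; rw [div_le_iff₀ hδF] at s6; linarith
    have q3 : ((d : ℝ) + 1) * δ = δF / 2 := by rw [hδ]; field_simp
    rw [q3] at r1 r2
    rw [abs_le]; constructor <;> linarith
  have fin := coreP2 hd hr hS0 (ρ y) j' (fun z => F S (y, z)) (hFm S y hy) (hB S s4 y hy)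
    (fun w hw => (hP1 w hw).1) key
  have q4 : C3 / S ≤ η / 2 := by
    rw [div_le_iff₀ hS0]; rw [div_le_iff₀ hη] at s7; linarith
  linarith

open Polynomial in
lemma core {X Λ ι : Type*} (s : Set X) (d : ℕ) (hd : 0 < d) {r M Cc : ℝ} (hr : 0 < r) (hr4 : r ≤ 1 / 4)
    (hM : 0 < M) (hCc : 1 ≤ Cc) (ρ : X → Fin d → ℂ) (hρ : ∀ e ∈ s, ∀ i, ‖ρ e i‖ ≤ r / 2)
    (p : X → Λ → ℂ[X]) (hp : ∀ e ∈ s, ∀ l, ∃ (J : Finset (Fin d)) (sc : ℂ), ‖sc‖ ≤ 1 ∧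
      p e l = C sc * ∏ i ∈ J, (Polynomial.X - Polynomial.C (ρ e i)))
    (U' : ι → ℝ → X → ℝ)
    (hmatch : ∀ δ > 0, ∃ δ' > 0, ∃ T0 > 0, ∀ T ≥ T0, ∀ S ≥ T0, ∀ x ∈ s, ∀ y ∈ s,
      (∀ i, |U' i T x - U' i S y| ≤ δ') → ∀ j, ∃ j', ∀ l, ∀ k : Fin (d + 1),
        |lg M T ((taylor (ρ x j) (p x l)).coeff k) - lg M S ((taylor (ρ y j') (p y l)).coeff k)| ≤ δ)
    (c : Λ → X × ℂ → ℂ)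
    (hc : ∀ e ∈ s, ∀ z ∈ Metric.ball (0 : ℂ) r, ∀ l,
      ‖c l (e, z)‖ ≤ Cc * ‖(p e l).eval z‖ ∧ ‖(p e l).eval z‖ ≤ Cc * ‖c l (e, z)‖)
    (F : ℝ → X × ℂ → ℝ) (hFm : ∀ T, ∀ e ∈ s, Measurable fun z => F T (e, z)) (B TB : ℝ)
    (hB : ∀ T ≥ TB, ∀ e ∈ s, ∀ z ∈ Metric.ball (0 : ℂ) r, |F T (e, z)| ≤ B)
    (hF : AUC (s ×ˢ Metric.ball (0 : ℂ) r) (fun l T q => lg M T (c l q)) F) :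
    AUC s U' (fun T e => (1 / T) * Real.log (∫ z in Metric.ball (0 : ℂ) r, Real.exp (T * F T (e, z)))) := by
  intro η hη
  have hP := coreP s d hd hr hr4 hM hCc ρ hρ p hp U' hmatch c hc F hFm B TB hB hF (η / 3) (by positivity)
  obtain ⟨δ, hδ, T1, hT1, hP⟩ := hP
  set θ := min (η / (3 * M)) 1 with hθ
  have hθ0 : 0 < θ := lt_min (by positivity) one_pos
  have hθ1 : θ ≤ 1 := min_le_right _ _
  have hθM : θ * M ≤ η / 3 := by
    have : θ ≤ η / (3 * M) := min_le_left _ _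
    rw [le_div_iff₀ (by positivity)] at this
    linarith
  obtain ⟨C, hC, hlog⟩ := log_int θ hθ0 (by linarith)
  set C4 := |Real.log (d * C)|
  refine ⟨δ, hδ, T1 + |TB| + 3 * C4 / η, by positivity, ?_⟩
  intro T hT S hS x hx y hy hxy
  have a1 := le_abs_self TB
  have a2 := abs_nonneg TB
  have a3 : 0 ≤ 3 * C4 / η := by positivity
  have hT0 : 0 < T := by linarith
  have hP := hP T (by linarith) S (by linarith) x hx y hy hxy
  set L := (1 / S) * Real.log (∫ z in Metric.ball (0 : ℂ) r, Real.exp (S * F S (y, z)))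
  have hI : IntegrableOn (fun z => Real.exp (T * F T (x, z))) (Metric.ball (0 : ℂ) r) :=
    expint Metric.isOpen_ball.measurableSet measure_ball_lt_top.ne (hFm T x hx) (hB T (by linarith) x hx)
  have hpos : 0 < ∫ z in Metric.ball (0 : ℂ) r, Real.exp (T * F T (x, z)) := by
    have : NeZero (volume.restrict (Metric.ball (0 : ℂ) r)) :=
      ⟨by rw [Ne, Measure.restrict_eq_zero]; exact (Metric.measure_ball_pos volume 0 hr).ne'⟩
    exact integral_exp_pos hI
  set ε := Real.exp (-(M * T)) with hε
  have hε0 : 0 < ε := Real.exp_pos _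
  have hIj : ∀ j, IntegrableOn (fun z => ((‖z - ρ x j‖ + ε) ^ 2)⁻¹) (Metric.ball (0 : ℂ) r) := by
    intro j
    refine ((Continuous.inv₀ (by fun_prop) fun z => ?_ : Continuous fun z : ℂ => ((‖z - ρ x j‖ + ε) ^ 2)⁻¹).continuousOn.integrableOn_compact (isCompact_closedBall 0 r)).mono_set Metric.ball_subset_closedBall
    positivity
  have hle : ∫ z in Metric.ball (0 : ℂ) r, Real.exp (T * F T (x, z)) ≤
      Real.exp (T * (L + η / 3)) * (d * (C * ε ^ (-θ))) := by
    calc ∫ z in Metric.ball (0 : ℂ) r, Real.exp (T * F T (x, z))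
        ≤ ∫ z in Metric.ball (0 : ℂ) r, Real.exp (T * (L + η / 3)) * ∑ j, ((‖z - ρ x j‖ + ε) ^ 2)⁻¹ := by
          refine setIntegral_mono_on hI ?_ Metric.isOpen_ball.measurableSet ?_
          · exact (integrable_finsetSum _ fun j _ => hIj j).const_mul _
          · intro z hz
            obtain ⟨j, hj⟩ := hP z hz
            have e1 : Real.exp (T * (2 * lg M T (z - ρ x j))) = ((‖z - ρ x j‖ + ε) ^ 2)⁻¹ := by
              rw [hε, ← lg_exp M hT0 (z - ρ x j), ← Real.exp_nat_mul, ← Real.exp_neg]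
              congr 1; push_cast; ring
            calc Real.exp (T * F T (x, z)) ≤ Real.exp (T * (L + η / 3) + T * (2 * lg M T (z - ρ x j))) := by
                  refine Real.exp_le_exp.2 ?_
                  rw [← mul_add]
                  exact mul_le_mul_of_nonneg_left hj hT0.le
              _ = Real.exp (T * (L + η / 3)) * ((‖z - ρ x j‖ + ε) ^ 2)⁻¹ := by rw [Real.exp_add, e1]
              _ ≤ _ := by
                refine mul_le_mul_of_nonneg_left ?_ (Real.exp_pos _).le
                exact Finset.single_le_sum (f := fun j => ((‖z - ρ x j‖ + ε) ^ 2)⁻¹)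
                  (fun i _ => by positivity) (Finset.mem_univ j)
      _ = Real.exp (T * (L + η / 3)) * ∑ j, ∫ z in Metric.ball (0 : ℂ) r, ((‖z - ρ x j‖ + ε) ^ 2)⁻¹ := by
          rw [integral_const_mul, integral_finsetSum _ fun j _ => hIj j]
      _ ≤ Real.exp (T * (L + η / 3)) * ∑ j : Fin d, C * ε ^ (-θ) := by
          refine mul_le_mul_of_nonneg_left (Finset.sum_le_sum fun j _ => ?_) (Real.exp_pos _).le
          refine hlog ε hε0 (ρ x j) _ fun z hz => ?_
          rw [mem_ball_zero_iff] at hz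
          rw [mem_ball_iff_norm]
          have h1 := norm_sub_le z (ρ x j)
          have h2 := hρ x hx j
          linarith
      _ = _ := by simp
  have hd0 : (0 : ℝ) < d := by exact_mod_cast hd
  have h2 := Real.log_le_log hpos hle
  rw [← mul_assoc (d : ℝ), Real.log_mul (by positivity) (by positivity), Real.log_exp,
    Real.log_mul (by positivity) (by positivity), Real.log_rpow hε0, hε, Real.log_exp] at h2
  have h3 : Real.log (d * C) ≤ C4 := le_abs_self _
  have h4 : C4 ≤ T * (η / 3) := by
    have : 3 * C4 / η ≤ T := by linarith
    rw [div_le_iff₀ hη] at this; linarith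
  have h5 : θ * (M * T) ≤ T * (η / 3) := by nlinarith
  change (1 / T) * _ ≤ L + η
  rw [one_div, inv_mul_le_iff₀ hT0]
  linarith

end Kuw

namespace Kuw
open Topology

lemma tube {V Y : Type*} [TopologicalSpace V] [TopologicalSpace Y] (y0 : V) {K : Set Y} (hK : IsCompact K)
    {O : Set (V × Y)} (hO : IsOpen O) (h : ∀ ζ ∈ K, (y0, ζ) ∈ O) : ∃ N, IsOpen N ∧ y0 ∈ N ∧ ∀ y ∈ N, ∀ ζ ∈ K, (y, ζ) ∈ O := by
  obtain ⟨u, v, hu, hv, h1, h2, h3⟩ := generalized_tube_lemma (isCompact_singleton (x := y0)) hK hO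
    (by rintro ⟨a, b⟩ ⟨ha, hb⟩; cases ha; exact h b hb)
  exact ⟨u, hu, h1 rfl, fun y hy ζ hζ => h3 ⟨hy, h2 hζ⟩⟩

lemma isOpen_c1 {V : Type*} [NormedAddCommGroup V] [NormedSpace ℂ V] (Φ : V → ℂ) :
    IsOpen {q | ContDiffAt ℂ 1 Φ q} := by
  rw [isOpen_iff_mem_nhds]
  intro q hq
  exact ContDiffAt.eventually hq (by simp)

lemma cont_fderiv {V : Type*} [NormedAddCommGroup V] [NormedSpace ℂ V] {Φ : V → ℂ} {q : V}
    (h : ContDiffAt ℂ 1 Φ q) : ContinuousAt (fderiv ℂ Φ) q := by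
  have := h.fderiv_right (m := 0) (by simp)
  exact this.continuousAt

lemma PI {V : Type*} [NormedAddCommGroup V] [NormedSpace ℂ V] (Φ : V × ℂ → ℂ) (y0 : V) (r : ℝ) (hr : 0 < r)
    (hΦ : ∀ ζ ∈ Metric.sphere (0 : ℂ) r, ContDiffAt ℂ 1 Φ (y0, ζ)) :
    ContDiffAt ℂ 1 (fun y => ∮ ζ in C(0, r), Φ (y, ζ)) y0 ∧
    ∀ v, fderiv ℂ (fun y => ∮ ζ in C(0, r), Φ (y, ζ)) y0 v = ∮ ζ in C(0, r), fderiv ℂ Φ (y0, ζ) (v, 0) := by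
  have hcp := isCompact_sphere (0 : ℂ) r
  have hbd : ∃ K : ℝ, ∀ ζ ∈ Metric.sphere (0 : ℂ) r, ‖fderiv ℂ Φ (y0, ζ)‖ ≤ K := by
    refine hcp.exists_bound_of_continuousOn (f := fun ζ => fderiv ℂ Φ (y0, ζ)) ?_
    intro ζ hζ
    refine ContinuousAt.continuousWithinAt ?_
    exact (cont_fderiv (hΦ ζ hζ)).comp (f := fun ζ => (y0, ζ)) (by fun_prop)
  obtain ⟨K, hK⟩ := hbd
  set O := {q : V × ℂ | ContDiffAt ℂ 1 Φ q ∧ ‖fderiv ℂ Φ q‖ < K + 1}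
  have hO : IsOpen O := by
    rw [isOpen_iff_mem_nhds]
    rintro q ⟨h1, h2⟩
    have a := (isOpen_c1 Φ).mem_nhds h1
    have b := (cont_fderiv h1).norm.eventually (gt_mem_nhds h2)
    filter_upwards [a, b] with x hx hx2 using ⟨hx, hx2⟩
  obtain ⟨N, hN, hy0, hNO⟩ := tube y0 hcp hO fun ζ hζ => ⟨hΦ ζ hζ, (hK ζ hζ).trans_lt (by linarith)⟩
  have hcm : ∀ θ, circleMap 0 r θ ∈ Metric.sphere (0 : ℂ) r := fun θ => circleMap_mem_sphere 0 hr.le θ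
  set F : V → ℝ → ℂ := fun y θ => deriv (circleMap 0 r) θ • Φ (y, circleMap 0 r θ)
  set F' : V → ℝ → V →L[ℂ] ℂ := fun y θ => deriv (circleMap 0 r) θ •
    (fderiv ℂ Φ (y, circleMap 0 r θ)).comp (ContinuousLinearMap.inl ℂ V ℂ)
  have hdc : Continuous (deriv (circleMap 0 r)) := by
    have : deriv (circleMap 0 r) = fun θ => circleMap 0 r θ * Complex.I := by
      ext θ; rw [deriv_circleMap]
    rw [this]; exact (continuous_circleMap 0 r).mul continuous_const
  have hFc : ∀ y ∈ N, Continuous (F y) := by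
    intro y hy
    refine hdc.smul ?_
    rw [continuous_iff_continuousAt]
    intro θ
    exact (hNO y hy _ (hcm θ)).1.continuousAt.comp (f := fun θ => (y, circleMap 0 r θ))
      (by have := continuous_circleMap 0 r; fun_prop)
  have hF'c : ∀ y ∈ N, Continuous (F' y) := by
    intro y hy
    refine hdc.smul ?_
    rw [continuous_iff_continuousAt]
    intro θ
    have := (cont_fderiv (hNO y hy _ (hcm θ)).1).comp (f := fun θ => (y, circleMap 0 r θ)) (x := θ)
      (by have := continuous_circleMap 0 r; fun_prop)
    exact this.clm_comp continuousAt_const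
  have hdn : ∀ θ, ‖deriv (circleMap 0 r) θ‖ = r := by
    intro θ; rw [deriv_circleMap]; simp [abs_of_pos hr]
  have hb : ∀ y ∈ N, ∀ θ, ‖F' y θ‖ ≤ r * ((K + 1) * 1) := by
    intro y hy θ
    simp only [F']
    rw [norm_smul, hdn]
    refine mul_le_mul_of_nonneg_left ?_ hr.le
    refine (ContinuousLinearMap.opNorm_comp_le _ _).trans ?_
    have hk := (hNO y hy _ (hcm θ)).2
    exact mul_le_mul hk.le (ContinuousLinearMap.norm_inl_le_one _ _ _) (norm_nonneg _) ((norm_nonneg _).trans hk.le)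
  have hD : ∀ y ∈ N, HasFDerivAt (fun y => ∮ ζ in C(0, r), Φ (y, ζ)) (∫ θ in (0)..2 * Real.pi, F' y θ) y := by
    intro y hy
    have := intervalIntegral.hasFDerivAt_integral_of_dominated_of_fderiv_le (F := F) (F' := F') (x₀ := y) (s := N)
      (μ := volume) (a := 0) (b := 2 * Real.pi) (bound := fun _ => r * ((K + 1) * 1)) (𝕜 := ℂ) (hN.mem_nhds hy)
      (by filter_upwards [hN.mem_nhds hy] with x hx using (hFc x hx).aestronglyMeasurable)
      ((hFc y hy).intervalIntegrable _ _) (hF'c y hy).aestronglyMeasurable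
      (Filter.Eventually.of_forall fun t _ x hx => hb x hx t) (by simp)
      (Filter.Eventually.of_forall fun t _ x hx => by
        have h1 := ((hNO x hx _ (hcm t)).1.differentiableAt (by simp)).hasFDerivAt
        have h2 : HasFDerivAt (fun x : V => (x, circleMap 0 r t)) (ContinuousLinearMap.inl ℂ V ℂ) x :=
          hasFDerivAt_prodMk_left _ _
        exact (h1.comp x h2).const_smul (deriv (circleMap 0 r) t))
    exact this
  refine ⟨contDiffAt_one_iff.2 ⟨fun y => ∫ θ in (0)..2 * Real.pi, F' y θ, N, hN.mem_nhds hy0, ?_, hD⟩, ?_⟩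
  · intro y hy
    refine ContinuousAt.continuousWithinAt ?_
    refine intervalIntegral.continuousAt_of_dominated_interval (bound := fun _ => r * ((K + 1) * 1)) 
      (by filter_upwards [hN.mem_nhds hy] with x hx using (hF'c x hx).aestronglyMeasurable)
      (by filter_upwards [hN.mem_nhds hy] with x hx using Filter.Eventually.of_forall fun t _ => hb x hx t)
      (by simp) (Filter.Eventually.of_forall fun t _ => ?_)
    have := (cont_fderiv (hNO y hy _ (hcm t)).1).comp (f := fun y => (y, circleMap 0 r t)) (x := y) (by fun_prop)
    exact (this.clm_comp continuousAt_const).const_smul (deriv (circleMap 0 r) t)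
  · intro v
    rw [(hD y0 hy0).fderiv, ContinuousLinearMap.intervalIntegral_apply ((hF'c y0 hy0).intervalIntegrable _ _)]
    simp [circleIntegral, F']

end Kuw

namespace Kuw
open Topology

def pol (d : ℕ) (p : Fin d → ℂ) (z : ℂ) : ℂ := z ^ d + ∑ i, p i * z ^ (i : ℕ)

lemma pol_diff (d : ℕ) : ContDiff ℂ 1 (fun q : (Fin d → ℂ) × ℂ => pol d q.1 q.2) := by
  unfold pol; fun_prop

lemma pol_zero (d : ℕ) (z : ℂ) : pol d 0 z = z ^ d := by simp [pol]

lemma wInj {d : ℕ} (u0 : ℂ → ℂ) {r : ℝ} (hr : 0 < r) (hu : ∀ ζ ∈ Metric.closedBall (0 : ℂ) r, DifferentiableAt ℂ u0 ζ)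
    (hu00 : u0 0 ≠ 0) (q : Fin d → ℂ)
    (h : ∀ i : Fin d, ∮ ζ in C(0, r), u0 ζ * ζ ^ (i : ℕ) * (∑ k, q k * ζ ^ (k : ℕ)) / ζ ^ d = 0) : q = 0 := by
  have key : ∀ n : ℕ, ∀ hn : n < d, q ⟨n, hn⟩ = 0 := by
    intro n
    induction n using Nat.strong_induction_on with
    | _ n ih =>
      intro hn
      set q1 : ℂ → ℂ := fun ζ => ∑ k : Fin d, if n ≤ (k : ℕ) then q k * ζ ^ ((k : ℕ) - n) else 0 with hq1
      have h1 := h ⟨d - 1 - n, by omega⟩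
      have h2 : ∀ ζ ∈ Metric.sphere (0 : ℂ) r, u0 ζ * ζ ^ (d - 1 - n) * (∑ k, q k * ζ ^ (k : ℕ)) / ζ ^ d =
          (ζ - 0)⁻¹ • (u0 ζ * q1 ζ) := by
        intro ζ hζ
        have hζ0 : ζ ≠ 0 := by
          rintro rfl; simp at hζ; linarith
        have h3 : ∑ k, q k * ζ ^ (k : ℕ) = ζ ^ n * q1 ζ := by
          rw [hq1, Finset.mul_sum]
          refine Finset.sum_congr rfl fun k _ => ?_
          split_ifs with hk
          · have : ζ ^ (k : ℕ) = ζ ^ n * ζ ^ ((k : ℕ) - n) := by rw [← pow_add]; congr 1; omega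
            rw [this]; ring
          · rw [ih k (by omega) k.2]; simp
        rw [h3]
        have h4 : ζ ^ d = ζ ^ (d - 1 - n) * ζ ^ n * ζ := by
          rw [← pow_add, ← pow_succ]; congr 1; omega
        rw [h4, smul_eq_mul, sub_zero]
        field_simp
      rw [circleIntegral.integral_congr hr.le h2] at h1
      have hd : DifferentiableOn ℂ (fun ζ => u0 ζ * q1 ζ) (Metric.closedBall 0 r) := by
        intro ζ hζ
        refine (hu ζ hζ).differentiableWithinAt.mul ?_
        have : Differentiable ℂ q1 := by
          rw [hq1]
          refine Differentiable.fun_sum fun k _ => ?_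
          split_ifs <;> fun_prop
        exact this.differentiableAt.differentiableWithinAt
      have h5 := DifferentiableOn.circleIntegral_sub_inv_smul (f := fun ζ => u0 ζ * q1 ζ) hd
        (w := 0) (by simpa using hr)
      rw [h5] at h1
      have h6 : q1 0 = q ⟨n, hn⟩ := by
        rw [hq1]
        simp only
        rw [Finset.sum_eq_single ⟨n, hn⟩]
        · simp
        · intro k _ hk
          split_ifs with h7
          · have : (k : ℕ) ≠ n := fun h => hk (Fin.ext h)
            rw [zero_pow (by omega), mul_zero]
          · rfl
        · simp
      rw [h6] at h1
      have : (2 * Real.pi * Complex.I : ℂ) ≠ 0 := Complex.two_pi_I_ne_zero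
      simpa [hu00, this] using h1
  ext i; exact key i i.2

lemma quot_pol (d : ℕ) (p : Fin d → ℂ) (z : ℂ) : ∃ b : Fin d → ℂ, ∀ ζ, pol d p ζ - pol d p z = (ζ - z) * ∑ i, b i * ζ ^ (i : ℕ) := by
  set P : Polynomial ℂ := Polynomial.X ^ d + ∑ i, Polynomial.C (p i) * Polynomial.X ^ (i : ℕ) with hP
  have he : ∀ ζ, P.eval ζ = pol d p ζ := by
    intro ζ; simp [hP, pol, Polynomial.eval_finsetSum]
  have hdeg : P.natDegree ≤ d := by
    rw [hP]
    refine Polynomial.natDegree_add_le_of_degree_le (by simp) ?_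
    refine Polynomial.natDegree_sum_le_of_forall_le _ _ fun i _ => ?_
    refine (Polynomial.natDegree_C_mul_X_pow_le _ _).trans i.2.le
  have hdvd : Polynomial.X - Polynomial.C z ∣ P - Polynomial.C (P.eval z) := Polynomial.X_sub_C_dvd_sub_C_eval
  obtain ⟨Q, hQ⟩ := hdvd
  have hQd : Q ≠ 0 → Q.natDegree < d := by
    intro hQ0
    have h1 : (P - Polynomial.C (P.eval z)).natDegree ≤ d := by
      rw [Polynomial.natDegree_sub_C]; exact hdeg
    rw [hQ, Polynomial.natDegree_mul (Polynomial.X_sub_C_ne_zero z) hQ0, Polynomial.natDegree_X_sub_C] at h1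
    omega
  refine ⟨fun i => Q.coeff i, fun ζ => ?_⟩
  have h2 := congrArg (Polynomial.eval ζ) hQ
  simp only [Polynomial.eval_sub, Polynomial.eval_C, Polynomial.eval_mul, Polynomial.eval_X, he] at h2
  rw [h2]
  congr 1
  by_cases hQ0 : Q = 0
  · simp [hQ0]
  · rw [Polynomial.eval_eq_sum_range' (hQd hQ0), Fin.sum_univ_eq_sum_range (fun i => Q.coeff i * ζ ^ i)]

end Kuw

namespace Kuw
open Topology

lemma weier {V : Type*} [NormedAddCommGroup V] [NormedSpace ℂ V] [CompleteSpace V] (d : ℕ) (G : V × ℂ → ℂ)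
    (hG : ContDiffAt ℂ 1 G 0) (u0 : ℂ → ℂ) (hu0 : AnalyticAt ℂ u0 0) (hu00 : u0 0 ≠ 0)
    (hGu : ∀ᶠ z in 𝓝 (0 : ℂ), G (0, z) = z ^ d * u0 z) :
    ∃ p : V → Fin d → ℂ, ContDiffAt ℂ 1 p 0 ∧ p 0 = 0 ∧ ∃ C : ℝ, 1 ≤ C ∧ ∀ᶠ q in 𝓝 (0 : V × ℂ),
      ‖G q‖ ≤ C * ‖pol d (p q.1) q.2‖ ∧ ‖pol d (p q.1) q.2‖ ≤ C * ‖G q‖ := by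
  -- radius
  have hrad : ∃ r > 0, ∀ ζ ∈ Metric.closedBall (0 : ℂ) r, ContDiffAt ℂ 1 G (0, ζ) ∧ G (0, ζ) = ζ ^ d * u0 ζ ∧
      DifferentiableAt ℂ u0 ζ := by
    have a : ∀ᶠ ζ in 𝓝 (0 : ℂ), ContDiffAt ℂ 1 G (0, ζ) := by
      have h1 : ∀ᶠ q in 𝓝 ((0 : V), (0 : ℂ)), ContDiffAt ℂ 1 G q := hG.eventually (by simp)
      have h2 : Continuous fun ζ : ℂ => ((0 : V), ζ) := by fun_prop
      exact h2.continuousAt.eventually h1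
    have b : ∀ᶠ ζ in 𝓝 (0 : ℂ), DifferentiableAt ℂ u0 ζ := by
      filter_upwards [hu0.eventually_analyticAt] with ζ h using h.differentiableAt
    have := (a.and (hGu.and b))
    rw [Metric.eventually_nhds_iff] at this
    obtain ⟨ε, hε, h⟩ := this
    refine ⟨ε / 2, by positivity, fun ζ hζ => h ?_⟩
    rw [Metric.mem_closedBall] at hζ; linarith
  obtain ⟨r, hr, hrr⟩ := hrad
  have hs : ∀ ζ ∈ Metric.sphere (0 : ℂ) r, ζ ∈ Metric.closedBall (0 : ℂ) r ∧ ζ ≠ 0 := by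
    intro ζ hζ
    refine ⟨Metric.sphere_subset_closedBall hζ, ?_⟩
    rintro rfl; simp at hζ; linarith
  set Ψ : Fin d → (V × (Fin d → ℂ)) × ℂ → ℂ := fun i q => G (q.1.1, q.2) * q.2 ^ (i : ℕ) / pol d q.1.2 q.2 with hΨ
  have hΨc : ∀ i, ∀ ζ ∈ Metric.sphere (0 : ℂ) r, ContDiffAt ℂ 1 (Ψ i) (0, ζ) := by
    intro i ζ hζ
    obtain ⟨h1, h2⟩ := hs ζ hζ
    refine ContDiffAt.div (ContDiffAt.mul ?_ (by fun_prop)) ?_ ?_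
    · exact (hrr ζ h1).1.comp ((0 : V × (Fin d → ℂ)), ζ) (f := fun q : (V × (Fin d → ℂ)) × ℂ => (q.1.1, q.2)) (by fun_prop)
    · exact (pol_diff d).contDiffAt.comp _ (f := fun q : (V × (Fin d → ℂ)) × ℂ => (q.1.2, q.2)) (by fun_prop)
    · simp only [Prod.snd_zero, pol_zero]; exact pow_ne_zero _ h2
  set Φ : V × (Fin d → ℂ) → (Fin d → ℂ) := fun y i => ∮ ζ in C(0, r), Ψ i (y, ζ) with hΦ
  have hΦc : ContDiffAt ℂ 1 Φ 0 := contDiffAt_pi.2 fun i => (PI (Ψ i) 0 r hr (hΨc i)).1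
  have hu0d : ∀ ζ ∈ Metric.closedBall (0 : ℂ) r, DifferentiableAt ℂ u0 ζ := fun ζ hζ => (hrr ζ hζ).2.2
  have hΦ0 : Φ 0 = 0 := by
    ext i
    simp only [hΦ, Pi.zero_apply]
    have : ∀ ζ ∈ Metric.sphere (0 : ℂ) r, Ψ i (0, ζ) = u0 ζ * ζ ^ (i : ℕ) := by
      intro ζ hζ
      obtain ⟨h1, h2⟩ := hs ζ hζ
      simp only [hΨ, Prod.fst_zero, Prod.snd_zero, pol_zero, (hrr ζ h1).2.1]
      field_simp
    rw [circleIntegral.integral_congr hr.le this]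
    refine DiffContOnCl.circleIntegral_eq_zero hr.le ?_
    refine DifferentiableOn.diffContOnCl ?_
    rw [closure_ball _ hr.ne']
    intro ζ hζ
    exact ((hu0d ζ hζ).mul (by fun_prop)).differentiableWithinAt
  have hinj : ∀ q : Fin d → ℂ, (fderiv ℂ Φ 0 ∘L .inr ℂ V (Fin d → ℂ)) q = 0 → q = 0 := by
    intro q hq
    refine wInj u0 hr hu0d hu00 q fun i => ?_
    have h1 : (fderiv ℂ Φ 0 (0, q)) i = 0 := by
      have : fderiv ℂ Φ 0 (0, q) = 0 := hq
      rw [this]; rfl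
    have h2 : fderiv ℂ Φ 0 (0, q) i = fderiv ℂ (fun y => Φ y i) 0 (0, q) := by
      rw [fderiv_apply (hΦc.differentiableAt (by simp))]; rfl
    rw [h2] at h1
    have h3 := (PI (Ψ i) 0 r hr (hΨc i)).2 (0, q)
    change fderiv ℂ (fun y => Φ y i) 0 (0, q) = _ at h3
    rw [h3] at h1
    have h4 : ∀ ζ ∈ Metric.sphere (0 : ℂ) r, fderiv ℂ (Ψ i) (0, ζ) ((0, q), 0) =
        (-1 : ℂ) * (u0 ζ * ζ ^ (i : ℕ) * (∑ k, q k * ζ ^ (k : ℕ)) / ζ ^ d) := by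
      intro ζ hζ
      obtain ⟨b1, b2⟩ := hs ζ hζ
      have c1 := ((hΨc i ζ hζ).differentiableAt (by simp)).hasFDerivAt
      have c2 : HasDerivAt (fun t : ℂ => (((0 : V), t • q), ζ)) ((0, q), 0) 0 := by
        refine HasDerivAt.prodMk (HasDerivAt.prodMk (hasDerivAt_const _ _) ?_) (hasDerivAt_const _ _)
        simpa using (hasDerivAt_id (0 : ℂ)).smul_const q
      have c3 : HasDerivAt (fun t : ℂ => Ψ i (((0 : V), t • q), ζ)) (fderiv ℂ (Ψ i) (0, ζ) ((0, q), 0)) 0 := by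
        refine HasFDerivAt.comp_hasDerivAt (0 : ℂ) (f := fun t : ℂ => (((0 : V), t • q), ζ)) (l := Ψ i) ?_ c2
        convert c1 using 2
        simp
      have c4 : (fun t : ℂ => Ψ i (((0 : V), t • q), ζ)) =
          fun t => (ζ ^ d * u0 ζ * ζ ^ (i : ℕ)) / (ζ ^ d + t * ∑ k, q k * ζ ^ (k : ℕ)) := by
        ext t
        simp only [hΨ, (hrr ζ b1).2.1, pol, Pi.smul_apply, smul_eq_mul, Finset.mul_sum, mul_assoc]
      rw [c4] at c3
      have c5 : HasDerivAt (fun t : ℂ => ζ ^ d + t * ∑ k, q k * ζ ^ (k : ℕ)) (∑ k, q k * ζ ^ (k : ℕ)) 0 := by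
        simpa using ((hasDerivAt_id (0 : ℂ)).mul_const (∑ k, q k * ζ ^ (k : ℕ))).const_add (ζ ^ d)
      have c6 := (hasDerivAt_const (0 : ℂ) (ζ ^ d * u0 ζ * ζ ^ (i : ℕ))).fun_div c5 (by simpa using pow_ne_zero d b2)
      rw [c3.unique c6]
      have : ζ ^ d ≠ 0 := pow_ne_zero d b2
      simp only [zero_mul, add_zero, zero_sub]
      field_simp
    rw [circleIntegral.integral_congr hr.le h4, circleIntegral.integral_const_mul] at h1
    simpa using h1
  have hinv : (fderiv ℂ Φ 0 ∘L .inr ℂ V (Fin d → ℂ)).IsInvertible := by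
    set D := (fderiv ℂ Φ 0 ∘L .inr ℂ V (Fin d → ℂ))
    have hi : Function.Injective (D : (Fin d → ℂ) →ₗ[ℂ] (Fin d → ℂ)) := by
      rw [← LinearMap.ker_eq_bot, LinearMap.ker_eq_bot']
      exact hinj
    refine ⟨(LinearEquiv.ofInjectiveEndo _ hi).toContinuousLinearEquiv, ?_⟩
    ext; rfl
  have hpn : (1 : WithTop ℕ∞) ≠ 0 := by simp
  set p := hΦc.implicitFunction hpn hinv with hp
  have hp0 : p 0 = 0 := hΦc.implicitFunction_apply_self hpn hinv
  have hpc : ContDiffAt ℂ 1 p 0 := hΦc.contDiffAt_implicitFunction hpn hinv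
  have hpe : ∀ᶠ x in 𝓝 (0 : V), Φ (x, p x) = 0 := by
    have := hΦc.eventually_apply_implicitFunction hpn hinv
    rw [hΦ0] at this
    exact this
  refine ⟨p, hpc, hp0, ?_⟩
  -- the unit
  set u : V × ℂ → ℂ := fun y => ∮ ζ in C(0, r), G (y.1, ζ) / (pol d (p y.1) ζ * (ζ - y.2)) with hu
  have huc : ContinuousAt u 0 := by
    have := PI (fun q : (V × ℂ) × ℂ => G (q.1.1, q.2) / (pol d (p q.1.1) q.2 * (q.2 - q.1.2))) 0 r hr ?_
    · exact this.1.continuousAt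
    intro ζ hζ
    obtain ⟨h1, h2⟩ := hs ζ hζ
    refine ContDiffAt.div ?_ (ContDiffAt.mul ?_ (by fun_prop)) ?_
    · exact (hrr ζ h1).1.comp ((0 : V × ℂ), ζ) (f := fun q : (V × ℂ) × ℂ => (q.1.1, q.2)) (by fun_prop)
    · refine (pol_diff d).contDiffAt.comp _ (f := fun q : (V × ℂ) × ℂ => (p q.1.1, q.2)) ?_
      refine ContDiffAt.prodMk ?_ (by fun_prop)
      exact ContDiffAt.comp ((0 : V × ℂ), ζ) (g := p) (f := fun q : (V × ℂ) × ℂ => q.1.1) hpc (by fun_prop)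
    · simp only [Prod.fst_zero, Prod.snd_zero, hp0, pol_zero, sub_zero]
      exact mul_ne_zero (pow_ne_zero _ h2) h2
  have hu1 : u 0 = (2 * Real.pi * Complex.I) * u0 0 := by
    have : ∀ ζ ∈ Metric.sphere (0 : ℂ) r, G ((0 : V), ζ) / (pol d (p 0) ζ * (ζ - 0)) = (ζ - 0)⁻¹ • u0 ζ := by
      intro ζ hζ
      obtain ⟨h1, h2⟩ := hs ζ hζ
      have : ζ ^ d ≠ 0 := pow_ne_zero d h2
      rw [hp0, pol_zero, (hrr ζ h1).2.1, sub_zero, smul_eq_mul]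
      field_simp
    simp only [hu]
    change (∮ ζ in C(0, r), G ((0 : V), ζ) / (pol d (p 0) ζ * (ζ - 0))) = _
    rw [circleIntegral.integral_congr hr.le this, DifferentiableOn.circleIntegral_sub_inv_smul (f := u0)
      (fun ζ hζ => (hu0d ζ hζ).differentiableWithinAt) (by simpa using hr), smul_eq_mul]
  have hu2 : u 0 ≠ 0 := by rw [hu1]; exact mul_ne_zero Complex.two_pi_I_ne_zero hu00
  -- factorization
  have hN1 : ∀ᶠ v in 𝓝 (0 : V), ∀ ζ ∈ Metric.closedBall (0 : ℂ) r, ContDiffAt ℂ 1 G (v, ζ) := by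
    obtain ⟨N, hN, h0, h⟩ := tube (0 : V) (isCompact_closedBall (0 : ℂ) r) (isOpen_c1 G) fun ζ hζ => (hrr ζ hζ).1
    filter_upwards [hN.mem_nhds h0] with v hv using h v hv
  have hN2 : ∀ᶠ v in 𝓝 (0 : V), ∀ ζ ∈ Metric.sphere (0 : ℂ) r, pol d (p v) ζ ≠ 0 := by
    have hO : IsOpen {q : (Fin d → ℂ) × ℂ | pol d q.1 q.2 ≠ 0} :=
      isOpen_ne_fun (pol_diff d).continuous continuous_const
    obtain ⟨N, hN, h0, h⟩ := tube (p 0) (isCompact_sphere (0 : ℂ) r) hO fun ζ hζ => by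
      simp only [Set.mem_ofPred_eq, hp0, pol_zero]; exact pow_ne_zero _ (hs ζ hζ).2
    filter_upwards [hpc.continuousAt.eventually (hN.mem_nhds h0)] with v hv using h (p v) hv
  have hfac : ∀ᶠ q in 𝓝 (0 : V × ℂ), (2 * Real.pi * Complex.I) * G q = pol d (p q.1) q.2 * u q := by
    have e1 : ∀ᶠ q in 𝓝 (0 : V × ℂ), ‖q.2‖ < r := by
      have h1 : Filter.Tendsto (fun q : V × ℂ => ‖q.2‖) (𝓝 0) (𝓝 0) :=
        Continuous.tendsto' (by fun_prop) _ _ (by simp)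
      exact h1.eventually (gt_mem_nhds hr)
    have e2 : Filter.Tendsto (fun q : V × ℂ => q.1) (𝓝 0) (𝓝 0) := continuous_fst.tendsto' _ _ rfl
    filter_upwards [e1, e2.eventually hN1, e2.eventually hN2, e2.eventually hpe] with q q1 q2 q3 q4
    obtain ⟨v, z⟩ := q
    simp only at q1 q2 q3 q4
    have hζz : ∀ ζ ∈ Metric.sphere (0 : ℂ) r, ζ - z ≠ 0 := by
      intro ζ hζ h
      rw [sub_eq_zero] at h; subst h; simp at hζ; linarith
    have hGd : DifferentiableOn ℂ (fun ζ => G (v, ζ)) (Metric.closedBall 0 r) := by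
      intro ζ hζ
      refine DifferentiableAt.differentiableWithinAt ?_
      exact ((q2 ζ hζ).differentiableAt (by simp)).comp ζ (f := fun ζ => (v, ζ)) (by fun_prop)
    have hGc : ContinuousOn (fun ζ => G (v, ζ)) (Metric.sphere 0 r) :=
      hGd.continuousOn.mono Metric.sphere_subset_closedBall
    have hpcn : ContinuousOn (fun ζ => pol d (p v) ζ) (Metric.sphere 0 r) := by
      have : Continuous fun ζ => pol d (p v) ζ := (pol_diff d).continuous.comp (f := fun ζ => (p v, ζ)) (by fun_prop)
      exact this.continuousOn
    have hcau := DifferentiableOn.circleIntegral_sub_inv_smul (f := fun ζ => G (v, ζ)) hGd (w := z) (by simpa using q1)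
    obtain ⟨b, hb⟩ := quot_pol d (p v) z
    have hsplit : ∀ ζ ∈ Metric.sphere (0 : ℂ) r, (ζ - z)⁻¹ • G (v, ζ) =
        pol d (p v) z * (G (v, ζ) / (pol d (p v) ζ * (ζ - z))) + ∑ i, b i * Ψ i ((v, p v), ζ) := by
      intro ζ hζ
      have n1 := q3 ζ hζ
      have n2 := hζz ζ hζ
      have e3 : ∑ i, b i * Ψ i ((v, p v), ζ) = G (v, ζ) / pol d (p v) ζ * ∑ i, b i * ζ ^ (i : ℕ) := by
        rw [Finset.mul_sum]
        refine Finset.sum_congr rfl fun i _ => ?_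
        simp only [hΨ]; ring
      have e4 : ∑ i, b i * ζ ^ (i : ℕ) = (pol d (p v) ζ - pol d (p v) z) / (ζ - z) := by
        rw [hb]; field_simp
      rw [e3, e4, smul_eq_mul]
      field_simp
      ring
    have hci1 : CircleIntegrable (fun ζ => G (v, ζ) / (pol d (p v) ζ * (ζ - z))) 0 r := by
      refine ContinuousOn.circleIntegrable hr.le ?_
      refine hGc.div (hpcn.mul (by fun_prop)) fun ζ hζ => mul_ne_zero (q3 ζ hζ) (hζz ζ hζ)
    have hci2 : ∀ i, CircleIntegrable (fun ζ => Ψ i ((v, p v), ζ)) 0 r := by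
      intro i
      refine ContinuousOn.circleIntegrable hr.le ?_
      refine (hGc.mul (by fun_prop)).div hpcn fun ζ hζ => q3 ζ hζ
    have hci3 : CircleIntegrable (fun ζ => pol d (p v) z * (G (v, ζ) / (pol d (p v) ζ * (ζ - z)))) 0 r :=
      IntervalIntegrable.const_mul hci1 _
    have hci4 : ∀ i, CircleIntegrable (fun ζ => b i * Ψ i ((v, p v), ζ)) 0 r :=
      fun i => IntervalIntegrable.const_mul (hci2 i) _
    rw [circleIntegral.integral_congr hr.le hsplit] at hcau
    rw [circleIntegral.integral_add hci3 ?_, circleIntegral.integral_const_mul] at hcau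
    · have hz : (∮ ζ in C(0, r), ∑ i, b i * Ψ i ((v, p v), ζ)) = 0 := by
        rw [circleIntegral.integral_fun_sum fun i _ => hci4 i]
        refine Finset.sum_eq_zero fun i _ => ?_
        rw [circleIntegral.integral_const_mul]
        have : Φ (v, p v) i = 0 := by rw [q4]; rfl
        change b i * Φ (v, p v) i = 0
        rw [this, mul_zero]
      rw [hz, add_zero, smul_eq_mul] at hcau
      exact hcau.symm
    · exact CircleIntegrable.fun_sum _ fun i _ => hci4 i
  -- conclusion
  have hul : ∀ᶠ q in 𝓝 (0 : V × ℂ), ‖u 0‖ / 2 < ‖u q‖ :=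
    huc.norm.eventually (lt_mem_nhds (by have := norm_pos_iff.2 hu2; linarith))
  have huu : ∀ᶠ q in 𝓝 (0 : V × ℂ), ‖u q‖ < ‖u 0‖ + 1 :=
    huc.norm.eventually (gt_mem_nhds (by linarith))
  have hnu := norm_pos_iff.2 hu2
  have hpi : ‖(2 * Real.pi * Complex.I : ℂ)‖ = 2 * Real.pi := by
    simp [abs_of_pos Real.pi_pos]
  have hpi3 := Real.pi_gt_three
  have hpp : 0 ≤ 2 * Real.pi * 2 / ‖u 0‖ := by positivity
  refine ⟨1 + (‖u 0‖ + 1) + 2 * Real.pi * 2 / ‖u 0‖, by linarith, ?_⟩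
  filter_upwards [hul, huu, hfac] with q h1 h2 h3
  have h4 := congrArg norm h3
  rw [norm_mul, norm_mul (pol d (p q.1) q.2), hpi] at h4
  set P := ‖pol d (p q.1) q.2‖
  have hP : 0 ≤ P := norm_nonneg _
  have hGn : 0 ≤ ‖G q‖ := norm_nonneg _
  constructor
  · have : ‖G q‖ ≤ (‖u 0‖ + 1) * P := by nlinarith
    nlinarith
  · have : P ≤ 2 * Real.pi * 2 / ‖u 0‖ * ‖G q‖ := by
      rw [div_mul_eq_mul_div, le_div_iff₀ hnu]; nlinarith
    nlinarith

end Kuw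

namespace Kuw
open Topology

lemma line_identity {E : Type*} [NormedAddCommGroup E] [NormedSpace ℂ E] (f : E → ℂ) (s : Set E) (hs : IsOpen s)
    (hconv : Convex ℝ s) (hf : ∀ x ∈ s, DifferentiableAt ℂ f x) (a : E) (ha : a ∈ s) (h0 : ∀ᶠ x in 𝓝 a, f x = 0) :
    ∀ x ∈ s, f x = 0 := by
  intro x hx
  set φ : ℂ → E := fun t => a + t • (x - a) with hφ
  have hφc : Continuous φ := by fun_prop
  set D := φ ⁻¹' s
  have hD : IsOpen D := hs.preimage hφc
  have hDc : Convex ℝ D := by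
    intro t ht t' ht' α β hα hβ hab
    have := hconv ht ht' hα hβ hab
    change φ _ ∈ s
    convert this using 1
    simp only [hφ, smul_add, add_smul, smul_assoc]
    have : a = α • a + β • a := by rw [← add_smul, hab, one_smul]
    nth_rewrite 1 [this]
    abel
  have han : AnalyticOnNhd ℂ (fun t => f (φ t)) D := by
    refine DifferentiableOn.analyticOnNhd (fun t ht => ?_) hD
    exact ((hf _ ht).comp t (f := φ) (by fun_prop)).differentiableWithinAt
  have h0D : (0 : ℂ) ∈ D := by simpa [D, hφ] using ha
  have h1D : (1 : ℂ) ∈ D := by simpa [D, hφ] using hx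
  have hz : (fun t => f (φ t)) =ᶠ[𝓝 0] 0 := by
    have : Filter.Tendsto φ (𝓝 0) (𝓝 a) := hφc.tendsto' _ _ (by simp [hφ])
    exact this.eventually h0
  have := han.eqOn_zero_of_preconnected_of_eventuallyEq_zero hDc.isPreconnected h0D hz h1D
  simpa [hφ] using this

lemma dense_ne {E Λ : Type*} [NormedAddCommGroup E] [NormedSpace ℂ E] (f : Λ → E → ℂ) (ρ : ℝ) (hρ : 0 < ρ)
    (hf : ∀ l, ∀ x ∈ Metric.ball (0 : E) ρ, DifferentiableAt ℂ (f l) x) (h0 : ∀ l, ¬ ∀ᶠ x in 𝓝 0, f l x = 0)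
    (s : Finset Λ) (U : Set E) (hU : IsOpen U) (hUb : U ⊆ Metric.ball 0 ρ) (hne : U.Nonempty) :
    ∃ U' ⊆ U, IsOpen U' ∧ U'.Nonempty ∧ ∀ l ∈ s, ∀ x ∈ U', f l x ≠ 0 := by
  classical
  induction s using Finset.induction_on with
  | empty => exact ⟨U, subset_rfl, hU, hne, by simp⟩
  | insert l s hl ih =>
    obtain ⟨U', h1, h2, h3, h4⟩ := ih
    have : ∃ x ∈ U', f l x ≠ 0 := by
      by_contra hcon
      push Not at hcon
      obtain ⟨a, ha⟩ := h3
      refine h0 l ?_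
      have := line_identity (f l) (Metric.ball 0 ρ) Metric.isOpen_ball (convex_ball 0 ρ) (hf l) a (hUb (h1 ha))
        (by filter_upwards [h2.mem_nhds ha] with x hx using hcon x hx)
      filter_upwards [Metric.ball_mem_nhds (0 : E) hρ] with x hx using this x hx
    obtain ⟨x, hx, hfx⟩ := this
    have hcont : ContinuousOn (f l) U' := fun y hy => (hf l y (hUb (h1 hy))).continuousAt.continuousWithinAt
    refine ⟨U' ∩ f l ⁻¹' {0}ᶜ, fun y hy => h1 hy.1, hcont.isOpen_inter_preimage h2 isOpen_compl_singleton,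
      ⟨x, hx, hfx⟩, ?_⟩
    intro l' hl' y hy
    rcases Finset.mem_insert.1 hl' with rfl | h
    · exact hy.2
    · exact h4 l' h y hy.1

lemma div_step {E : Type*} [NormedAddCommGroup E] [NormedSpace ℂ E] (c : E × ℂ → ℂ) (hc : ContDiffAt ℂ 1 c 0)
    (h0 : ∀ᶠ x in 𝓝 (0 : E), c (x, 0) = 0) :
    ∃ c1 : E × ℂ → ℂ, ContDiffAt ℂ 1 c1 0 ∧ ∀ᶠ q in 𝓝 (0 : E × ℂ), c q = q.2 * c1 q := by
  have hrad : ∃ r > 0, ∀ ζ ∈ Metric.closedBall (0 : ℂ) r, ContDiffAt ℂ 1 c (0, ζ) := by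
    have a : ∀ᶠ ζ in 𝓝 (0 : ℂ), ContDiffAt ℂ 1 c (0, ζ) := by
      have h1 : ∀ᶠ q in 𝓝 ((0 : E), (0 : ℂ)), ContDiffAt ℂ 1 c q := hc.eventually (by simp)
      have h2 : Continuous fun ζ : ℂ => ((0 : E), ζ) := by fun_prop
      exact h2.continuousAt.eventually h1
    rw [Metric.eventually_nhds_iff] at a
    obtain ⟨ε, hε, h⟩ := a
    refine ⟨ε / 2, by positivity, fun ζ hζ => h ?_⟩
    rw [Metric.mem_closedBall] at hζ; linarith
  obtain ⟨r, hr, hrr⟩ := hrad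
  have hs : ∀ ζ ∈ Metric.sphere (0 : ℂ) r, ζ ∈ Metric.closedBall (0 : ℂ) r ∧ ζ ≠ 0 := by
    intro ζ hζ
    refine ⟨Metric.sphere_subset_closedBall hζ, ?_⟩
    rintro rfl; simp at hζ; linarith
  have h2pi : (2 * Real.pi * Complex.I : ℂ) ≠ 0 := Complex.two_pi_I_ne_zero
  refine ⟨fun y => (2 * Real.pi * Complex.I : ℂ)⁻¹ * ∮ ζ in C(0, r), c (y.1, ζ) / (ζ * (ζ - y.2)), ?_, ?_⟩
  · refine contDiffAt_const.mul ?_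
    refine (PI (fun q : (E × ℂ) × ℂ => c (q.1.1, q.2) / (q.2 * (q.2 - q.1.2))) 0 r hr ?_).1
    intro ζ hζ
    obtain ⟨h1, h2⟩ := hs ζ hζ
    refine ContDiffAt.div ?_ (by fun_prop) ?_
    · exact (hrr ζ h1).comp ((0 : E × ℂ), ζ) (f := fun q : (E × ℂ) × ℂ => (q.1.1, q.2)) (by fun_prop)
    · simpa using h2
  · have hN1 : ∀ᶠ v in 𝓝 (0 : E), ∀ ζ ∈ Metric.closedBall (0 : ℂ) r, ContDiffAt ℂ 1 c (v, ζ) := by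
      obtain ⟨N, hN, h0, h⟩ := tube (0 : E) (isCompact_closedBall (0 : ℂ) r) (isOpen_c1 c) fun ζ hζ => (hrr ζ hζ)
      filter_upwards [hN.mem_nhds h0] with v hv using h v hv
    have e1 : ∀ᶠ q in 𝓝 (0 : E × ℂ), ‖q.2‖ < r := by
      have h1 : Filter.Tendsto (fun q : E × ℂ => ‖q.2‖) (𝓝 0) (𝓝 0) :=
        Continuous.tendsto' (by fun_prop) _ _ (by simp)
      exact h1.eventually (gt_mem_nhds hr)
    have e2 : Filter.Tendsto (fun q : E × ℂ => q.1) (𝓝 0) (𝓝 0) := continuous_fst.tendsto' _ _ rfl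
    filter_upwards [e1, e2.eventually hN1, e2.eventually h0] with q q1 q2 q3
    obtain ⟨v, z⟩ := q
    simp only at q1 q2 q3 ⊢
    have hζz : ∀ ζ ∈ Metric.sphere (0 : ℂ) r, ζ - z ≠ 0 := by
      intro ζ hζ h
      rw [sub_eq_zero] at h; subst h; simp at hζ; linarith
    have hGd : DifferentiableOn ℂ (fun ζ => c (v, ζ)) (Metric.closedBall 0 r) := by
      intro ζ hζ
      refine DifferentiableAt.differentiableWithinAt ?_
      exact ((q2 ζ hζ).differentiableAt (by simp)).comp ζ (f := fun ζ => (v, ζ)) (by fun_prop)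
    have hGc : ContinuousOn (fun ζ => c (v, ζ)) (Metric.sphere 0 r) :=
      hGd.continuousOn.mono Metric.sphere_subset_closedBall
    have hcau := DifferentiableOn.circleIntegral_sub_inv_smul (f := fun ζ => c (v, ζ)) hGd (w := z) (by simpa using q1)
    have hcau0 := DifferentiableOn.circleIntegral_sub_inv_smul (f := fun ζ => c (v, ζ)) hGd (w := 0) (by simpa using hr)
    have hsplit : ∀ ζ ∈ Metric.sphere (0 : ℂ) r, (ζ - z)⁻¹ • c (v, ζ) =
        z * (c (v, ζ) / (ζ * (ζ - z))) + (ζ - 0)⁻¹ • c (v, ζ) := by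
      intro ζ hζ
      have n1 := (hs ζ hζ).2
      have n2 := hζz ζ hζ
      simp only [smul_eq_mul, sub_zero]
      field_simp
      ring
    have hci1 : CircleIntegrable (fun ζ => z * (c (v, ζ) / (ζ * (ζ - z)))) 0 r := by
      refine ContinuousOn.circleIntegrable hr.le ?_
      refine continuousOn_const.mul (hGc.div (by fun_prop) fun ζ hζ => mul_ne_zero (hs ζ hζ).2 (hζz ζ hζ))
    have hci2 : CircleIntegrable (fun ζ => (ζ - 0)⁻¹ • c (v, ζ)) 0 r := by
      refine ContinuousOn.circleIntegrable hr.le ?_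
      have q0 : ContinuousOn (fun ζ : ℂ => ζ - 0) (Metric.sphere 0 r) := by fun_prop
      refine ContinuousOn.smul (ContinuousOn.inv₀ q0 fun ζ hζ => ?_) hGc
      simpa using (hs ζ hζ).2
    rw [circleIntegral.integral_congr hr.le hsplit, circleIntegral.integral_add hci1 hci2, hcau0,
      circleIntegral.integral_const_mul, q3, smul_zero, add_zero, smul_eq_mul] at hcau
    field_simp
    linear_combination -hcau

lemma divw {E : Type*} [NormedAddCommGroup E] [NormedSpace ℂ E] (p : E × ℂ) (m : ℕ) : ∀ (c : E × ℂ → ℂ) (_ : ContDiffAt ℂ 1 c 0)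
    (_ : ¬ (fun s : ℂ => c (s • p)) =O[𝓝 0] (fun s => s ^ m)),
    ∃ (k : ℕ) (c1 : E × ℂ → ℂ), ContDiffAt ℂ 1 c1 0 ∧ (∀ᶠ q in 𝓝 (0 : E × ℂ), c q = q.2 ^ k * c1 q) ∧
      ¬ ∀ᶠ x in 𝓝 (0 : E), c1 (x, 0) = 0 := by
  induction m with
  | zero =>
    intro c hc h
    exfalso; apply h
    simp only [pow_zero]
    have : ContinuousAt (fun s : ℂ => c (s • p)) 0 := by
      refine ContinuousAt.comp (g := c) (f := fun s : ℂ => s • p) ?_ (by fun_prop)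
      simpa using hc.continuousAt
    exact this.isBigO_one ℂ
  | succ m ih =>
    intro c hc h
    by_cases h0 : ∀ᶠ x in 𝓝 (0 : E), c (x, 0) = 0
    · obtain ⟨c1, hc1, h1⟩ := div_step c hc h0
      have key : ¬ (fun s : ℂ => c1 (s • p)) =O[𝓝 0] (fun s => s ^ m) := by
        intro hO
        apply h
        have t : Filter.Tendsto (fun s : ℂ => s • p) (𝓝 0) (𝓝 0) := Continuous.tendsto' (by fun_prop) _ _ (by simp)
        have e : (fun s : ℂ => c (s • p)) =ᶠ[𝓝 0] fun s => (s * p.2) * c1 (s • p) := by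
          filter_upwards [t.eventually h1] with s hs
          rw [hs]; rfl
        refine e.trans_isBigO ?_
        have : (fun s : ℂ => s ^ (m + 1)) = fun s => s * s ^ m := by ext s; ring
        rw [this]
        refine Asymptotics.IsBigO.mul ?_ hO
        simp_rw [mul_comm _ p.2]
        exact Asymptotics.isBigO_const_mul_self _ _ _
      obtain ⟨k, c2, hc2, h2, h3⟩ := ih c1 hc1 key
      refine ⟨k + 1, c2, hc2, ?_, h3⟩
      filter_upwards [h1, h2] with q q1 q2
      rw [q1, q2]; ring
    · exact ⟨0, c, hc, by simp, h0⟩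

lemma order_exists {E : Type*} [NormedAddCommGroup E] [NormedSpace ℂ E] (c : E → ℂ) (hc : ContDiffAt ℂ 1 c 0)
    (h0 : ¬ ∀ᶠ x in 𝓝 (0 : E), c x = 0) : ∃ (p : E) (m : ℕ), ¬ (fun s : ℂ => c (s • p)) =O[𝓝 0] (fun s => s ^ m) := by
  have h1 : ∀ᶠ x in 𝓝 (0 : E), ContDiffAt ℂ 1 c x := hc.eventually (by simp)
  rw [Metric.eventually_nhds_iff_ball] at h1
  obtain ⟨ρ, hρ, h1⟩ := h1
  have : ∃ p ∈ Metric.ball (0 : E) ρ, c p ≠ 0 := by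
    by_contra hcon
    push Not at hcon
    exact h0 (by filter_upwards [Metric.ball_mem_nhds (0 : E) hρ] with x hx using hcon x hx)
  obtain ⟨p, hp, hcp⟩ := this
  have hd : ∀ s ∈ (fun s : ℂ => s • p) ⁻¹' Metric.ball (0 : E) ρ, DifferentiableAt ℂ (fun s : ℂ => c (s • p)) s := by
    intro s hs
    exact ((h1 _ hs).differentiableAt (by simp)).comp s (f := fun s : ℂ => s • p) (by fun_prop)
  have hD : IsOpen ((fun s : ℂ => s • p) ⁻¹' Metric.ball (0 : E) ρ) := Metric.isOpen_ball.preimage (by fun_prop)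
  have h0D : (0 : ℂ) ∈ (fun s : ℂ => s • p) ⁻¹' Metric.ball (0 : E) ρ := by simpa using hρ
  have han : AnalyticAt ℂ (fun s : ℂ => c (s • p)) 0 :=
    DifferentiableOn.analyticAt (fun s hs => (hd s hs).differentiableWithinAt) (hD.mem_nhds h0D)
  have hne : ¬ ∀ᶠ s in 𝓝 (0 : ℂ), c (s • p) = 0 := by
    intro hz
    have := line_identity (fun s : ℂ => c (s • p)) _ hD ?_ hd 0 h0D hz 1 (by simpa using hp)
    · simp [hcp] at this
    · exact (convex_ball (0 : E) ρ).linear_preimage ((LinearMap.toSpanSingleton ℂ E p).restrictScalars ℝ)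
  obtain ⟨m, g, hg, hg0, hgm⟩ := han.exists_eventuallyEq_pow_smul_nonzero_iff.2 hne
  refine ⟨p, m + 1, fun hO => ?_⟩
  have hgm2 : (fun s : ℂ => c (s • p)) =ᶠ[𝓝 0] fun z => (z - 0) ^ m • g z := hgm
  have h2 := (hgm2.symm.trans_isBigO hO)
  have hgO : (fun s : ℂ => s ^ m) =O[𝓝 0] (fun z => (z - 0) ^ m • g z) := by
    have hginv : (fun z => (g z)⁻¹) =O[𝓝 0] (fun _ => (1 : ℂ)) := (hg.continuousAt.inv₀ hg0).isBigO_one ℂ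
    have e : (fun s : ℂ => s ^ m) =ᶠ[𝓝 0] fun s => (g s)⁻¹ * ((s - 0) ^ m • g s) := by
      filter_upwards [hg.continuousAt.eventually_ne hg0] with s hs
      simp; field_simp
    refine e.trans_isBigO ?_
    have := hginv.mul (Asymptotics.isBigO_refl (fun z => (z - 0) ^ m • g z) (𝓝 (0 : ℂ)))
    simpa using this
  have h3 := hgO.trans h2
  have h4 : (fun s : ℂ => s ^ (m + 1)) =o[𝓝 0] fun s => s ^ m := Asymptotics.isLittleO_pow_pow (by omega)
  have h5 : (fun s : ℂ => s ^ m) =o[𝓝 0] fun s : ℂ => s ^ m := h3.trans_isLittleO h4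
  have h6 : ∃ᶠ s in 𝓝 (0 : ℂ), s ≠ 0 := by
    have : (𝓝[≠] (0 : ℂ)).NeBot := inferInstance
    have h7 : ∀ᶠ s in 𝓝[≠] (0 : ℂ), s ≠ 0 := eventually_mem_nhdsWithin
    exact h7.frequently.filter_mono nhdsWithin_le_nhds
  exact Asymptotics.isLittleO_irrefl (h6.mono fun s hs => pow_ne_zero m hs) h5

lemma pre {E : Type*} [NormedAddCommGroup E] [NormedSpace ℂ E] (c : E × ℂ → ℂ) (hc : ContDiffAt ℂ 1 c 0) :
    ∃ (σ : ℂ → ℂ) (c1 : E × ℂ → ℂ), ContDiff ℂ 1 σ ∧ (∀ w, ‖w‖ ≤ 1 → ‖σ w‖ ≤ 1) ∧ ContDiffAt ℂ 1 c1 0 ∧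
      (∀ᶠ q in 𝓝 (0 : E × ℂ), c q = σ q.2 * c1 q) ∧ (¬ ∀ᶠ x in 𝓝 (0 : E), c1 (x, 0) = 0) ∧
      ((¬ ∀ᶠ x in 𝓝 (0 : E), c (x, 0) = 0) → ∀ w, σ w = 1) := by
  have t : Filter.Tendsto (fun x : E => (x, (0 : ℂ))) (𝓝 0) (𝓝 0) := Continuous.tendsto' (by fun_prop) _ _ (by simp)
  by_cases h0 : ∀ᶠ q in 𝓝 (0 : E × ℂ), c q = 0
  · refine ⟨fun _ => 0, fun _ => 1, by fun_prop, by simp, by fun_prop, by simpa using h0, by simp [(inferInstance : (𝓝 (0:E)).NeBot).ne], ?_⟩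
    intro h; exact absurd (t.eventually h0) h
  · obtain ⟨p, m, hpm⟩ := order_exists c hc h0
    obtain ⟨k, c1, h1, h2, h3⟩ := divw p m c hc hpm
    refine ⟨fun w => w ^ k, c1, by fun_prop, ?_, h1, h2, h3, ?_⟩
    · intro w hw; rw [norm_pow]; exact pow_le_one₀ (norm_nonneg _) hw
    · intro h w
      have : k = 0 := by
        by_contra hk
        apply h
        filter_upwards [t.eventually h2] with x hx
        rw [hx, zero_pow hk, zero_mul]
      simp [this]

end Kuw

namespace Kuw
open Topology

lemma SP (n : ℕ) {Λ : Type} [Fintype Λ] (c : Λ → (Fin (n+1) → ℂ) × ℂ → ℂ) (hc : ∀ l, ContDiffAt ℂ 1 (c l) 0) :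
    ∃ (L : (ℂ × (Fin n → ℂ)) ≃L[ℂ] (Fin (n+1) → ℂ)) (D : Λ → ℕ) (sc : Λ → (Fin n → ℂ) × ℂ → ℂ)
      (p : ∀ l, (Fin n → ℂ) × ℂ → Fin (D l) → ℂ) (C : ℝ), 1 ≤ C ∧
      (∀ l, ContDiffAt ℂ 1 (sc l) 0) ∧ (∀ l, ContDiffAt ℂ 1 (p l) 0) ∧ (∀ l, p l 0 = 0) ∧
      (∀ l, ∀ᶠ v in 𝓝 (0 : (Fin n → ℂ) × ℂ), ‖sc l v‖ ≤ 1) ∧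
      (∀ l, (¬ ∀ᶠ x in 𝓝 (0 : Fin (n+1) → ℂ), c l (x, 0) = 0) → ∀ v, sc l v = 1) ∧
      ∀ l, ∀ᶠ q in 𝓝 (0 : ((Fin n → ℂ) × ℂ) × ℂ),
        ‖c l (L (q.2, q.1.1), q.1.2)‖ ≤ C * ‖sc l q.1 * pol (D l) (p l q.1) q.2‖ ∧
        ‖sc l q.1 * pol (D l) (p l q.1) q.2‖ ≤ C * ‖c l (L (q.2, q.1.1), q.1.2)‖ := by
  classical
  choose σ c1 hσ hσ1 hc1 hcc hc10 hone using fun l => pre (c l) (hc l)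
  have t : Filter.Tendsto (fun x : Fin (n+1) → ℂ => (x, (0 : ℂ))) (𝓝 0) (𝓝 0) :=
    Continuous.tendsto' (by fun_prop) _ _ (by simp)
  have hdiff : ∀ᶠ x in 𝓝 (0 : Fin (n+1) → ℂ), ∀ l, ContDiffAt ℂ 1 (c1 l) (x, 0) := by
    rw [Filter.eventually_all]
    intro l
    exact t.eventually ((hc1 l).eventually (by simp))
  rw [Metric.eventually_nhds_iff_ball] at hdiff
  obtain ⟨ρ, hρ, hdiff⟩ := hdiff
  have hd2 : ∀ l, ∀ x ∈ Metric.ball (0 : Fin (n+1) → ℂ) ρ, DifferentiableAt ℂ (fun x => c1 l (x, 0)) x := by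
    intro l x hx
    exact ((hdiff x hx l).differentiableAt (by simp)).comp x (f := fun x => (x, (0:ℂ))) (by fun_prop)
  have hne : (Metric.ball (0 : Fin (n+1) → ℂ) ρ ∩ {0}ᶜ).Nonempty := by
    have : (𝓝[≠] (0 : Fin (n+1) → ℂ)).NeBot := inferInstance
    have h1 : ∀ᶠ x in 𝓝[≠] (0 : Fin (n+1) → ℂ), x ∈ Metric.ball (0 : Fin (n+1) → ℂ) ρ ∩ {0}ᶜ := by
      filter_upwards [nhdsWithin_le_nhds (Metric.ball_mem_nhds (0 : Fin (n+1) → ℂ) hρ), self_mem_nhdsWithin] with x h1 h2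
      exact ⟨h1, h2⟩
    exact h1.exists
  obtain ⟨U', hU1, hU2, ⟨e, he⟩, hU4⟩ := dense_ne (fun l x => c1 l (x, 0)) ρ hρ hd2 hc10 Finset.univ _
    (Metric.isOpen_ball.inter isOpen_compl_singleton) Set.inter_subset_left hne
  have he0 : e ≠ 0 := (hU1 he).2
  have heb : e ∈ Metric.ball (0 : Fin (n+1) → ℂ) ρ := (hU1 he).1
  let L0 : (ℂ × (Fin n → ℂ)) ≃L[ℂ] (Fin (n+1) → ℂ) := ContinuousLinearEquiv.ofFinrankEq (by
    simp [Module.finrank_prod, add_comm])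
  obtain ⟨A, hA⟩ := SeparatingDual.exists_continuousLinearEquiv_apply_eq (R := ℂ) (V := Fin (n+1) → ℂ) (x := L0 (1, 0)) (y := e)
    (by simp) he0
  let L := L0.trans A
  have hL : ∀ z : ℂ, L (z, 0) = z • e := by
    intro z
    have : ((z, 0) : ℂ × (Fin n → ℂ)) = z • ((1, 0) : ℂ × (Fin n → ℂ)) := by simp
    rw [this, map_smul]
    simp [L, hA]
  have hLt : Filter.Tendsto (fun q : ((Fin n → ℂ) × ℂ) × ℂ => (L (q.2, q.1.1), q.1.2)) (𝓝 0) (𝓝 0) :=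
    Continuous.tendsto' (by fun_prop) _ _ (by
      change (L (0, 0), (0:ℂ)) = 0
      have : ((0, 0) : ℂ × (Fin n → ℂ)) = 0 := rfl
      rw [this, map_zero]; rfl)
  have key : ∀ l, ∃ (d : ℕ) (p : (Fin n → ℂ) × ℂ → Fin d → ℂ), ContDiffAt ℂ 1 p 0 ∧ p 0 = 0 ∧ ∃ C : ℝ, 1 ≤ C ∧
      ∀ᶠ q in 𝓝 (0 : ((Fin n → ℂ) × ℂ) × ℂ), ‖c1 l (L (q.2, q.1.1), q.1.2)‖ ≤ C * ‖pol d (p q.1) q.2‖ ∧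
       ‖pol d (p q.1) q.2‖ ≤ C * ‖c1 l (L (q.2, q.1.1), q.1.2)‖ := by
    intro l
    have hd : ∀ s ∈ (fun s : ℂ => s • e) ⁻¹' Metric.ball (0 : Fin (n+1) → ℂ) ρ,
        DifferentiableAt ℂ (fun s : ℂ => c1 l (s • e, 0)) s := by
      intro s hs
      exact (hd2 l _ hs).comp s (f := fun s : ℂ => s • e) (by fun_prop)
    have hD : IsOpen ((fun s : ℂ => s • e) ⁻¹' Metric.ball (0 : Fin (n+1) → ℂ) ρ) := Metric.isOpen_ball.preimage (by fun_prop)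
    have h0D : (0 : ℂ) ∈ (fun s : ℂ => s • e) ⁻¹' Metric.ball (0 : Fin (n+1) → ℂ) ρ := by simpa using hρ
    have han : AnalyticAt ℂ (fun s : ℂ => c1 l (s • e, 0)) 0 :=
      DifferentiableOn.analyticAt (fun s hs => (hd s hs).differentiableWithinAt) (hD.mem_nhds h0D)
    have hne : ¬ ∀ᶠ s in 𝓝 (0 : ℂ), c1 l (s • e, 0) = 0 := by
      intro hz
      have := line_identity (fun s : ℂ => c1 l (s • e, 0)) _ hD
        ((convex_ball (0 : Fin (n+1) → ℂ) ρ).linear_preimage ((LinearMap.toSpanSingleton ℂ (Fin (n+1) → ℂ) e).restrictScalars ℝ))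
        hd 0 h0D hz 1 (by simpa using heb)
      rw [one_smul] at this
      exact hU4 l (Finset.mem_univ _) e he this
    obtain ⟨d, u0, hu0, hu00, hgm⟩ := han.exists_eventuallyEq_pow_smul_nonzero_iff.2 hne
    have hG : ContDiffAt ℂ 1 (fun q : ((Fin n → ℂ) × ℂ) × ℂ => c1 l (L (q.2, q.1.1), q.1.2)) 0 := by
      have h1 : ContDiffAt ℂ 1 (fun q : ((Fin n → ℂ) × ℂ) × ℂ => (L (q.2, q.1.1), q.1.2)) 0 := by
        refine ContDiff.contDiffAt ?_
        exact (L.contDiff.comp (by fun_prop)).prodMk (by fun_prop)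
      refine ContDiffAt.comp (g := c1 l) 0 ?_ h1
      have : ((L ((0 : ((Fin n → ℂ) × ℂ) × ℂ).2, (0 : ((Fin n → ℂ) × ℂ) × ℂ).1.1), (0 : ((Fin n → ℂ) × ℂ) × ℂ).1.2)) = 0 := by
        change (L (0, 0), (0:ℂ)) = 0
        have : ((0, 0) : ℂ × (Fin n → ℂ)) = 0 := rfl
        rw [this, map_zero]; rfl
      rw [this]
      exact hc1 l
    obtain ⟨p, hp1, hp2, C, hC, hpC⟩ := weier d (fun q : ((Fin n → ℂ) × ℂ) × ℂ => c1 l (L (q.2, q.1.1), q.1.2)) hG u0 hu0 hu00 (by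
      filter_upwards [hgm] with z hz
      have : L (z, (0 : (Fin n → ℂ) × ℂ).1) = z • e := hL z
      simp only [this]
      rw [show (0 : (Fin n → ℂ) × ℂ).2 = 0 from rfl, hz]; simp)
    exact ⟨d, p, hp1, hp2, C, hC, hpC⟩
  choose D p hp hp0 C hC hpC using key
  refine ⟨L, D, fun l v => σ l v.2, p, 1 + ∑ l, C l, ?_, ?_, hp, hp0, ?_, fun l hl v => hone l hl _, ?_⟩
  · have : 0 ≤ ∑ l, C l := Finset.sum_nonneg fun l _ => by linarith [hC l]
    linarith
  · intro l
    exact ((hσ l).comp (by fun_prop : ContDiff ℂ 1 fun v : (Fin n → ℂ) × ℂ => v.2)).contDiffAt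
  · intro l
    have t2 : Filter.Tendsto (fun v : (Fin n → ℂ) × ℂ => v.2) (𝓝 0) (𝓝 0) :=
      Continuous.tendsto' (by fun_prop) _ _ (by simp)
    filter_upwards [t2.eventually (Metric.closedBall_mem_nhds (0:ℂ) one_pos)] with v hv
    exact hσ1 l _ (by simpa using hv)
  · intro l
    have hCl : C l ≤ 1 + ∑ l, C l := by
      have : C l ≤ ∑ l, C l := Finset.single_le_sum (f := C) (fun l _ => by linarith [hC l]) (Finset.mem_univ l)
      linarith
    filter_upwards [hpC l, hLt.eventually (hcc l)] with q ⟨q1, q2⟩ q3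
    rw [q3]
    simp only [norm_mul]
    constructor
    · calc _ ≤ ‖σ l q.1.2‖ * (C l * ‖pol (D l) (p l q.1) q.2‖) := by gcongr
        _ = C l * (‖σ l q.1.2‖ * ‖pol (D l) (p l q.1) q.2‖) := by ring
        _ ≤ _ := by gcongr
    · calc _ ≤ ‖σ l q.1.2‖ * (C l * ‖c1 l (L (q.2, q.1.1), q.1.2)‖) := by gcongr
        _ = C l * (‖σ l q.1.2‖ * ‖c1 l (L (q.2, q.1.1), q.1.2)‖) := by ring
        _ ≤ _ := by gcongr

end Kuw

namespace Kuw
open Topology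

lemma dvd_prod_X_sub {ι : Type*} (ρ : ι → ℂ) (s : Finset ι) : ∀ (P : Polynomial ℂ), P.Monic →
    P ∣ ∏ j ∈ s, (Polynomial.X - Polynomial.C (ρ j)) → ∃ J ⊆ s, P = ∏ j ∈ J, (Polynomial.X - Polynomial.C (ρ j)) := by
  classical
  induction s using Finset.induction_on with
  | empty =>
    intro P hP h
    simp only [Finset.prod_empty] at h
    exact ⟨∅, subset_rfl, by simpa using hP.isUnit_iff.1 (isUnit_of_dvd_one h)⟩
  | insert j s hj ih =>
    intro P hP h
    rw [Finset.prod_insert hj] at h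
    by_cases hd : (Polynomial.X - Polynomial.C (ρ j)) ∣ P
    · obtain ⟨P', rfl⟩ := hd
      have hm := Polynomial.monic_X_sub_C (ρ j)
      have h' := (mul_dvd_mul_iff_left hm.ne_zero).1 h
      obtain ⟨J, hJ, e⟩ := ih P' (hm.of_mul_monic_left hP) h'
      refine ⟨insert j J, Finset.insert_subset_insert _ hJ, ?_⟩
      rw [Finset.prod_insert (fun hh => hj (hJ hh)), e]
    · have hc : IsCoprime (Polynomial.X - Polynomial.C (ρ j)) P :=
        ((Polynomial.irreducible_X_sub_C (ρ j)).coprime_iff_not_dvd).2 hd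
      obtain ⟨J, hJ, e⟩ := ih P hP (hc.symm.dvd_of_dvd_mul_left h)
      exact ⟨J, hJ.trans (Finset.subset_insert _ _), e⟩

lemma monic_roots (d : ℕ) (P : Polynomial ℂ) (hP : P.Monic) (hd : P.natDegree = d) :
    ∃ ρ : Fin d → ℂ, P = ∏ j, (Polynomial.X - Polynomial.C (ρ j)) := by
  induction d generalizing P with
  | zero => exact ⟨Fin.elim0, by simpa using hP.natDegree_eq_zero.1 hd⟩
  | succ d ih =>
    obtain ⟨a, ha⟩ := IsAlgClosed.exists_root P (by
      intro h; have h2 := Polynomial.natDegree_eq_of_degree_eq_some (n := 0) (by simpa using h); omega)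
    obtain ⟨P', rfl⟩ := Polynomial.dvd_iff_isRoot.2 ha
    have hm := Polynomial.monic_X_sub_C a
    have hP' := hm.of_mul_monic_left hP
    rw [hm.natDegree_mul hP', Polynomial.natDegree_X_sub_C] at hd
    obtain ⟨ρ, hρ⟩ := ih P' hP' (by omega)
    refine ⟨Fin.cons a ρ, ?_⟩
    rw [Fin.prod_univ_succ, hρ]; simp

/-- the polynomial behind `pol` -/
noncomputable def polP {A : Type*} [CommRing A] (d : ℕ) (p : Fin d → A) : Polynomial A :=
  Polynomial.X ^ d + ∑ i, Polynomial.C (p i) * Polynomial.X ^ (i : ℕ)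

lemma polP_eval (d : ℕ) (p : Fin d → ℂ) (z : ℂ) : (polP d p).eval z = pol d p z := by
  simp [polP, pol, Polynomial.eval_finsetSum]

lemma polP_map {A B : Type*} [CommRing A] [CommRing B] (φ : A →+* B) (d : ℕ) (p : Fin d → A) :
    (polP d p).map φ = polP d fun i => φ (p i) := by
  simp [polP, Polynomial.map_sum]

lemma polP_deg (d : ℕ) (p : Fin d → ℂ) : (∑ i, Polynomial.C (p i) * Polynomial.X ^ (i : ℕ)).degree < (d : WithBot ℕ) := by
  refine (Polynomial.degree_sum_le _ _).trans_lt ?_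
  refine (Finset.sup_lt_iff (WithBot.bot_lt_coe d)).2 ?_
  intro i _
  refine (Polynomial.degree_C_mul_X_pow_le _ _).trans_lt ?_
  first | exact Nat.cast_lt.2 i.2 | exact WithBot.coe_lt_coe.2 i.2

lemma polP_monic (d : ℕ) (p : Fin d → ℂ) : (polP d p).Monic := Polynomial.monic_X_pow_add (polP_deg d p)

lemma polP_natDegree (d : ℕ) (p : Fin d → ℂ) : (polP d p).natDegree = d :=
  Polynomial.natDegree_eq_of_degree_eq_some (by
    rw [polP, Polynomial.degree_add_eq_left_of_degree_lt] <;> rw [Polynomial.degree_X_pow]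
    exact polP_deg d p)

lemma root_small (d : ℕ) (r : ℝ) (hr : 0 < r) (hr1 : r ≤ 1) :
    ∃ ε > 0, ∀ p : Fin d → ℂ, (∀ i, ‖p i‖ ≤ ε) → ∀ z, pol d p z = 0 → ‖z‖ ≤ r := by
  refine ⟨r ^ d / (d + 1), by positivity, fun p hp z hz => ?_⟩
  by_contra hcon
  push Not at hcon
  have h1 : ‖z‖ ^ d ≤ ∑ i : Fin d, r ^ d / (d + 1) * ‖z‖ ^ (i : ℕ) := by
    have : z ^ d = - ∑ i, p i * z ^ (i : ℕ) := by rw [pol] at hz; linear_combination hz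
    rw [← norm_pow, this, norm_neg]
    refine (norm_sum_le _ _).trans (Finset.sum_le_sum fun i _ => ?_)
    rw [norm_mul, norm_pow]
    exact mul_le_mul_of_nonneg_right (hp i) (by positivity)
  have h2 : ∀ i : Fin d, r ^ d * ‖z‖ ^ (i : ℕ) ≤ ‖z‖ ^ d := by
    intro i
    have e1 : r ^ d ≤ r ^ (d - (i : ℕ)) := pow_le_pow_of_le_one hr.le hr1 (by omega)
    have e2 : r ^ (d - (i : ℕ)) ≤ ‖z‖ ^ (d - (i : ℕ)) := pow_le_pow_left₀ hr.le hcon.le _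
    calc r ^ d * ‖z‖ ^ (i : ℕ) ≤ ‖z‖ ^ (d - (i : ℕ)) * ‖z‖ ^ (i : ℕ) := by
          exact mul_le_mul_of_nonneg_right (e1.trans e2) (by positivity)
      _ = _ := by rw [← pow_add]; congr 1; omega
  have h3 : ∑ i : Fin d, r ^ d / (d + 1) * ‖z‖ ^ (i : ℕ) ≤ ∑ i : Fin d, ‖z‖ ^ d / (d + 1) := by
    refine Finset.sum_le_sum fun i _ => ?_
    have := h2 i
    rw [div_mul_eq_mul_div]
    exact div_le_div_of_nonneg_right this (by positivity)
  rw [Finset.sum_const, Finset.card_univ, Fintype.card_fin, nsmul_eq_mul] at h3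
  have hz0 : 0 < ‖z‖ ^ d := pow_pos (hr.trans hcon) d
  have h4 : (d : ℝ) * (‖z‖ ^ d / (d + 1)) < ‖z‖ ^ d := by
    rw [mul_div_assoc', div_lt_iff₀ (by positivity)]
    nlinarith
  linarith

lemma bb_map {Q : Type} [Fintype Q] {A B : Type*} [CommRing A] [CommRing B] (φ : A →+* B) (a : Q → A) (r : RI Q) :
    φ (bb a r) = bb (fun q => φ (a q)) r := by
  rcases r with (_ | q) | J <;> simp [bb]

/-- ring of germs -/
def germs (V : Type*) [NormedAddCommGroup V] [NormedSpace ℂ V] : Subring (V → ℂ) where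
  carrier := {f | ContDiffAt ℂ 1 f 0}
  mul_mem' := fun {a b} (ha : ContDiffAt ℂ 1 a 0) (hb : ContDiffAt ℂ 1 b 0) => (ha.mul hb : ContDiffAt ℂ 1 (a * b) 0)
  one_mem' := (contDiffAt_const : ContDiffAt ℂ 1 (fun _ : V => (1 : ℂ)) 0)
  add_mem' := fun {a b} (ha : ContDiffAt ℂ 1 a 0) (hb : ContDiffAt ℂ 1 b 0) => (ha.add hb : ContDiffAt ℂ 1 (a + b) 0)
  zero_mem' := (contDiffAt_const : ContDiffAt ℂ 1 (fun _ : V => (0 : ℂ)) 0)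
  neg_mem' := fun {a} (ha : ContDiffAt ℂ 1 a 0) => (ha.neg : ContDiffAt ℂ 1 (-a) 0)

lemma alg {V : Type*} [NormedAddCommGroup V] [NormedSpace ℂ V] {Λ : Type} [Fintype Λ] (D : Λ → ℕ) (sc : Λ → V → ℂ)
    (p : ∀ l, V → Fin (D l) → ℂ) (hsc : ∀ l, ContDiffAt ℂ 1 (sc l) 0) (hp : ∀ l, ContDiffAt ℂ 1 (p l) 0) :
    ∃ (d : ℕ) (_ : 0 < d) (ρ : V → Fin d → ℂ) (Ψ : Type) (_ : Fintype Ψ) (c' : Ψ → V → ℂ), (∀ ψ, ContDiffAt ℂ 1 (c' ψ) 0) ∧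
      (∀ v j, ρ v j = 0 ∨ ∃ l, pol (D l) (p l v) (ρ v j) = 0) ∧
      (∀ v l, ∃ J : Finset (Fin d), polP (D l) (p l v) = ∏ i ∈ J, (Polynomial.X - Polynomial.C (ρ v i))) ∧
      ∀ M : ℝ, 0 ≤ M → ∃ M' > 0, ∀ δ > 0, ∃ δ' > 0, ∃ T0 > 0, ∀ T ≥ T0, ∀ S ≥ T0, ∀ x y : V,
        (∀ ψ, |lg M' T (c' ψ x) - lg M' S (c' ψ y)| ≤ δ') → ∀ j, ∃ j', ∀ l, ∀ k : Fin (d + 1),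
          |lg M T ((Polynomial.taylor (ρ x j) (Polynomial.C (sc l x) * polP (D l) (p l x))).coeff k) -
           lg M S ((Polynomial.taylor (ρ y j') (Polynomial.C (sc l y) * polP (D l) (p l y))).coeff k)| ≤ δ := by
  classical
  set d := 1 + ∑ l, D l with hd
  have hp' : ∀ l i, ContDiffAt ℂ 1 (fun v => p l v i) 0 := fun l i => contDiffAt_pi.1 (hp l) i
  let sg : Λ → germs V := fun l => ⟨sc l, hsc l⟩
  let pg : ∀ l, Fin (D l) → germs V := fun l i => ⟨fun v => p l v i, hp' l i⟩
  let ev : V → germs V →+* ℂ := fun v => (Pi.evalRingHom (fun _ => ℂ) v).comp (germs V).subtype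
  have evs : ∀ v l, ev v (sg l) = sc l v := fun v l => rfl
  have evp : ∀ v l, (polP (D l) (pg l)).map (ev v) = polP (D l) (p l v) := fun v l => by rw [polP_map]; rfl
  let Qg : Polynomial (germs V) := Polynomial.X * ∏ l, polP (D l) (pg l)
  have evQ : ∀ v, Qg.map (ev v) = Polynomial.X * ∏ l, polP (D l) (p l v) := by
    intro v; simp only [Qg, Polynomial.map_mul, Polynomial.map_X, Polynomial.map_prod, evp]
  have hroots : ∀ v, ∃ ρ : Fin d → ℂ, Qg.map (ev v) = ∏ j, (Polynomial.X - Polynomial.C (ρ j)) := by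
    intro v
    have hm := Polynomial.monic_prod_of_monic Finset.univ _ fun l (_ : l ∈ Finset.univ) => polP_monic (D l) (p l v)
    refine monic_roots d _ ?_ ?_
    · rw [evQ]; exact Polynomial.monic_X.mul hm
    · rw [evQ, Polynomial.monic_X.natDegree_mul hm, Polynomial.natDegree_X,
        Polynomial.natDegree_prod_of_monic _ _ fun l _ => polP_monic (D l) (p l v)]
      simp only [polP_natDegree, hd]
  choose ρ hρ using hroots
  let a : Λ × Fin (d+1) → Polynomial (germs V) := fun q =>
    Polynomial.C (sg q.1) * Polynomial.hasseDeriv q.2 (polP (D q.1) (pg q.1))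
  obtain ⟨c', hc'⟩ := sym_lemma d Qg (bb a)
  have hA : ∀ v, ∀ ψ, ev v (c' ψ) = Cf ψ (fun j => bb fun q : Λ × Fin (d+1) =>
      (Polynomial.taylor (ρ v j) (Polynomial.C (sc q.1 v) * polP (D q.1) (p q.1 v))).coeff q.2) := by
    intro v ψ
    rw [hc' (ev v) (ρ v) (hρ v) ψ]
    congr 1
    funext j r
    have := bb_map ((Polynomial.evalRingHom (ρ v j)).comp (Polynomial.mapRingHom (ev v))) a r
    simp only [RingHom.comp_apply, Polynomial.coe_mapRingHom, Polynomial.coe_evalRingHom] at this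
    rw [this]
    congr 1
    funext q
    rw [Polynomial.taylor_coeff]
    have e : Polynomial.hasseDeriv q.2 (Polynomial.C (sc q.1 v) * polP (D q.1) (p q.1 v)) =
      Polynomial.C (sc q.1 v) * Polynomial.hasseDeriv q.2 (polP (D q.1) (p q.1 v)) := by
      rw [← Polynomial.smul_eq_C_mul, map_smul, Polynomial.smul_eq_C_mul]
    rw [e, ← evp v q.1, ← evs v q.1]
    simp only [a, Polynomial.map_mul, Polynomial.map_C]
    congr 2
    ext k
    simp [Polynomial.hasseDeriv_coeff]
  refine ⟨d, by omega, ρ, (Fin d → RI (Λ × Fin (d+1))), inferInstance, fun ψ v => ev v (c' ψ), ?_, ?_, ?_, ?_⟩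
  · intro ψ; exact (c' ψ).2
  · intro v j
    have h1 : (Polynomial.X * ∏ l, polP (D l) (p l v)).eval (ρ v j) = 0 := by
      rw [← evQ, hρ, Polynomial.eval_prod]
      exact Finset.prod_eq_zero (Finset.mem_univ j) (by simp)
    rw [Polynomial.eval_mul, Polynomial.eval_X, Polynomial.eval_prod] at h1
    rcases mul_eq_zero.1 h1 with h | h
    · exact Or.inl h
    · obtain ⟨l, _, hl⟩ := Finset.prod_eq_zero_iff.1 h
      exact Or.inr ⟨l, by rwa [polP_eval] at hl⟩
  · intro v l
    obtain ⟨J, _, hJ⟩ := dvd_prod_X_sub (ρ v) Finset.univ (polP (D l) (p l v)) (polP_monic _ _) (by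
      rw [← hρ, evQ]
      exact Dvd.dvd.mul_left (Finset.dvd_prod_of_mem (fun l => polP (D l) (p l v)) (Finset.mem_univ l)) _)
    exact ⟨J, hJ⟩
  · intro M hM
    obtain ⟨M', hM', hm⟩ := matching d (Λ × Fin (d+1)) M hM
    refine ⟨M', hM', fun δ hδ => ?_⟩
    obtain ⟨δ', hδ', T0, hT0, h⟩ := hm δ hδ
    refine ⟨δ', hδ', T0, hT0, fun T hT S hS x y hxy j => ?_⟩
    obtain ⟨j', hj'⟩ := h T hT S hS (fun j q => (Polynomial.taylor (ρ x j) (Polynomial.C (sc q.1 x) * polP (D q.1) (p q.1 x))).coeff q.2)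
      (fun j q => (Polynomial.taylor (ρ y j) (Polynomial.C (sc q.1 y) * polP (D q.1) (p q.1 y))).coeff q.2) (fun ψ => by
      have := hxy ψ
      simp only at this
      rw [hA x ψ, hA y ψ] at this
      exact this) j
    exact ⟨j', fun l k => hj' (l, k)⟩

end Kuw

namespace Kuw
open Topology

/-- regularity principle -/
def RP (n : ℕ) : Prop := ∀ (Λ : Type) [Fintype Λ] (c : Λ → (Fin n → ℂ) × ℂ → ℂ), (∀ l, ContDiffAt ℂ 1 (c l) 0) →
  ∀ N ∈ 𝓝 (0 : (Fin n → ℂ) × ℂ), ∃ W ∈ 𝓝 (0 : Fin n → ℂ), ∃ ε > 0, MeasurableSet W ∧ volume W < ⊤ ∧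
    W ×ˢ Metric.ball (0 : ℂ) ε ⊆ N ∧ ∀ M > 0, ∃ M0 > 0, ∀ F : ℝ → (Fin n → ℂ) × ℂ → ℝ, (∀ T, Measurable (F T)) →
      (∃ B TB : ℝ, ∀ T ≥ TB, ∀ q ∈ W ×ˢ Metric.ball (0 : ℂ) ε, |F T q| ≤ B) →
      AUC (W ×ˢ Metric.ball (0 : ℂ) ε) (fun l T q => lg M T (c l q)) F →
      AUC (Metric.ball (0 : ℂ) ε) (fun (_ : Unit) T w => lg M0 T w)
        (fun T w => (1 / T) * Real.log (∫ x in W, Real.exp (T * F T (x, w))))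

lemma lg_zero (M T : ℝ) (hT : 0 < T) : lg M T 0 = M := by
  unfold lg; simp; field_simp

lemma lg_one (M T : ℝ) (hM : 0 ≤ M) (hT : 0 < T) : |lg M T 1| ≤ 1 / T := by
  unfold lg
  rw [abs_div, abs_neg, abs_of_pos hT]
  refine div_le_div_of_nonneg_right ?_ hT.le
  have h1 : 0 < Real.exp (-(M * T)) := Real.exp_pos _
  have h2 : Real.exp (-(M * T)) ≤ 1 := Real.exp_le_one_iff.2 (by nlinarith)
  rw [norm_one, abs_of_nonneg (Real.log_nonneg (by linarith))]
  have := Real.log_le_sub_one_of_pos (show 0 < 1 + Real.exp (-(M * T)) by linarith)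
  linarith

lemma base1 (φ : ℂ → ℂ) (hφ : AnalyticAt ℂ φ 0) : ∃ ε > 0, ∀ M > 0, ∀ η > 0, ∃ δ > 0, ∃ T0 > 0, ∀ T ≥ T0, ∀ S ≥ T0,
    ∀ w ∈ Metric.ball (0:ℂ) ε, ∀ w' ∈ Metric.ball (0:ℂ) ε, |lg M T w - lg M S w'| ≤ δ →
      |lg M T (φ w) - lg M S (φ w')| ≤ η := by
  by_cases h0 : ∀ᶠ z in 𝓝 (0:ℂ), φ z = 0
  · rw [Metric.eventually_nhds_iff_ball] at h0
    obtain ⟨ε, hε, h⟩ := h0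
    refine ⟨ε, hε, fun M hM η hη => ⟨1, one_pos, 1, one_pos, fun T hT S hS w hw w' hw' _ => ?_⟩⟩
    rw [h w hw, h w' hw', lg_zero M T (by linarith), lg_zero M S (by linarith)]
    simpa using hη.le
  · obtain ⟨k, u, hu, hu0, hφu⟩ := hφ.exists_eventuallyEq_pow_smul_nonzero_iff.2 h0
    have hu1 : ∀ᶠ z in 𝓝 (0:ℂ), ‖u z‖ ≤ 2 * ‖u 0‖ ∧ ‖u 0‖ / 2 ≤ ‖u z‖ := by
      have hn : 0 < ‖u 0‖ := norm_pos_iff.2 hu0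
      have hc := hu.continuousAt.norm
      filter_upwards [hc.eventually (gt_mem_nhds (show ‖u 0‖ < 2 * ‖u 0‖ by linarith)),
        hc.eventually (lt_mem_nhds (show ‖u 0‖ / 2 < ‖u 0‖ by linarith))] with z h1 h2
      exact ⟨h1.le, h2.le⟩
    obtain ⟨ε, hε, h⟩ := Metric.eventually_nhds_iff_ball.1 (hu1.and hφu)
    have hn : 0 < ‖u 0‖ := norm_pos_iff.2 hu0
    set Cc := 1 + 2 * ‖u 0‖ + 2 / ‖u 0‖ with hCc
    have hCc1 : 1 ≤ Cc := by have : 0 < 2 / ‖u 0‖ := by positivity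
                             linarith
    obtain ⟨C', hC'0, hC'⟩ := lg_compare k 1 Cc le_rfl hCc1
    refine ⟨min ε 1, by positivity, fun M hM η hη => ?_⟩
    have hGP : ∀ w ∈ Metric.ball (0:ℂ) (min ε 1), GP (d := k) 1 Cc (fun _ => 0) (Polynomial.X ^ k) 0 w (φ w) := by
      intro w hw
      rw [mem_ball_zero_iff, lt_min_iff] at hw
      obtain ⟨⟨h1, h2⟩, h3⟩ := h w (by simpa using hw.1)
      refine ⟨⟨Finset.univ, 1, by simp, by simp⟩, by simp, by simpa using hw.2.le, by simp, ?_, ?_⟩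
      · rw [h3]; simp only [sub_zero, norm_smul, norm_pow, Polynomial.eval_pow, Polynomial.eval_X]
        rw [mul_comm]
        refine mul_le_mul_of_nonneg_right ?_ (by positivity)
        have : 0 < 2 / ‖u 0‖ := by positivity
        linarith
      · rw [h3]; simp only [sub_zero, norm_smul, norm_pow, Polynomial.eval_pow, Polynomial.eval_X]
        have e : 1 ≤ Cc * ‖u w‖ := by
          calc 1 = (2 / ‖u 0‖) * (‖u 0‖ / 2) := by field_simp
            _ ≤ Cc * ‖u w‖ := mul_le_mul (by linarith) h2 (by positivity) (by linarith)
        nlinarith [pow_nonneg (norm_nonneg w) k]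
    have hp : (0:ℝ) < k + 1 := by positivity
    refine ⟨η / 2 / (k + 1), by positivity, 1 + 4 * C' / η + 2 / (η / 2 / (k+1)), by positivity, ?_⟩
    intro T hT S hS w hw w' hw' hww
    set δ := η / 2 / (k + 1) with hδ
    have hδ0 : 0 < δ := by positivity
    have a1 : 0 ≤ 4 * C' / η := by positivity
    have a2 : 0 < 2 / δ := by positivity
    have hT0 : 0 < T := by linarith
    have hS0 : 0 < S := by linarith
    have b : ∀ R, R ≥ 1 + 4 * C' / η + 2 / δ → C' / R ≤ η / 4 ∧ 1 / R ≤ δ / 2 := by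
      intro R hR
      have hR0 : 0 < R := by linarith
      constructor
      · rw [div_le_iff₀ hR0]
        have : 4 * C' / η ≤ R := by linarith
        rw [div_le_iff₀ hη] at this; linarith
      · rw [div_le_iff₀ hR0]
        have : 2 / δ ≤ R := by linarith
        rw [div_le_iff₀ hδ0] at this; linarith
    have tay : ∀ T S : ℝ, T ≥ 1 + 4 * C' / η + 2 / δ → S ≥ 1 + 4 * C' / η + 2 / δ → ∀ i : Fin (k+1),
      |lg M T ((Polynomial.taylor (0:ℂ) (Polynomial.X ^ k)).coeff i) - lg M S ((Polynomial.taylor (0:ℂ) (Polynomial.X ^ k)).coeff i)| ≤ δ := by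
      intro T S hT hS i
      have hT0 : 0 < T := by linarith
      have hS0 : 0 < S := by linarith
      rw [Polynomial.taylor_zero, Polynomial.coeff_X_pow]
      split_ifs
      · have := lg_one M T hM.le hT0
        have := lg_one M S hM.le hS0
        have := (b T hT).2
        have := (b S hS).2
        refine (abs_sub _ _).trans ?_
        linarith
      · rw [lg_zero M T hT0, lg_zero M S hS0]; simpa using hδ0.le
    have r1 := hC' M δ T S hM.le hT0 hS0 _ _ _ _ _ _ _ _ _ _ (hGP w hw) (hGP w' hw') (tay T S hT hS) (by simpa using hww)
    have r2 := hC' M δ S T hM.le hS0 hT0 _ _ _ _ _ _ _ _ _ _ (hGP w' hw') (hGP w hw) (tay S T hS hT) (by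
      rw [abs_sub_comm]; simpa using hww)
    have e : (k + 1 : ℝ) * δ = η / 2 := by rw [hδ]; field_simp
    have := (b T hT).1
    have := (b S hS).1
    rw [abs_le]; constructor <;> linarith

lemma RP_zero : RP 0 := by
  intro Λ _ c hc N hN
  have t : Filter.Tendsto (fun w : ℂ => ((0 : Fin 0 → ℂ), w)) (𝓝 0) (𝓝 0) := Continuous.tendsto' (by fun_prop) _ _ (by simp)
  have han : ∀ l, AnalyticAt ℂ (fun w => c l (0, w)) 0 := by
    intro l
    have h1 : ∀ᶠ w in 𝓝 (0:ℂ), ContDiffAt ℂ 1 (c l) (0, w) := t.eventually ((hc l).eventually (by simp))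
    rw [Metric.eventually_nhds_iff_ball] at h1
    obtain ⟨r, hr, h1⟩ := h1
    refine DifferentiableOn.analyticAt (s := Metric.ball 0 r) (fun w hw => ?_) (Metric.ball_mem_nhds _ hr)
    exact (((h1 w hw).differentiableAt (by simp)).comp w (f := fun w : ℂ => ((0 : Fin 0 → ℂ), w)) (by fun_prop)).differentiableWithinAt
  choose ε hε hh using fun l => base1 _ (han l)
  have hev : ∀ᶠ w in 𝓝 (0:ℂ), ((0 : Fin 0 → ℂ), w) ∈ N ∧ ∀ l, w ∈ Metric.ball (0:ℂ) (ε l) := by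
    refine (t.eventually hN).and ?_
    rw [Filter.eventually_all]
    intro l; exact Metric.ball_mem_nhds _ (hε l)
  obtain ⟨e, he, hev⟩ := Metric.eventually_nhds_iff_ball.1 hev
  refine ⟨Set.univ, Filter.univ_mem, e, he, MeasurableSet.univ, by simp, ?_, ?_⟩
  · rintro ⟨x, w⟩ ⟨_, hw⟩
    rw [Subsingleton.elim x 0]
    exact (hev w hw).1
  · intro M hM
    refine ⟨M, hM, fun F _ _ hF => ?_⟩
    intro η hη
    obtain ⟨δ, hδ, T0, hT0, hF⟩ := hF η hη
    choose δl hδl Tl hTl hl using fun l => hh l M hM δ hδ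
    have : ∃ δ' > 0, ∀ l, δ' ≤ δl l := by
      by_cases hΛ : Nonempty Λ
      · obtain ⟨l, hl⟩ := Finite.exists_min δl
        exact ⟨δl l, hδl l, hl⟩
      · exact ⟨1, one_pos, fun l => absurd ⟨l⟩ hΛ⟩
    obtain ⟨δ', hδ', hδ'l⟩ := this
    have hTs : ∀ l, Tl l ≤ ∑ l, Tl l := fun l => Finset.single_le_sum (f := Tl) (fun l _ => (hTl l).le) (Finset.mem_univ l)
    have hTs0 : 0 ≤ ∑ l, Tl l := Finset.sum_nonneg fun l _ => (hTl l).le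
    have red : ∀ T : ℝ, 0 < T → ∀ w, (1 / T) * Real.log (∫ x in Set.univ, Real.exp (T * F T ((x : Fin 0 → ℂ), w))) = F T (0, w) := by
      intro T hT w
      have : (fun x : Fin 0 → ℂ => Real.exp (T * F T (x, w))) = fun _ => Real.exp (T * F T (0, w)) := by
        ext x; rw [Subsingleton.elim x 0]
      have hv : (volume : Measure (Fin 0 → ℂ)).real Set.univ = 1 := by
        simp [Measure.real, volume_pi, Measure.pi_of_empty]
      rw [this, setIntegral_univ, integral_const, hv, one_smul, Real.log_exp]
      field_simp
    refine ⟨δ', hδ', T0 + ∑ l, Tl l, by linarith, fun T hT S hS w hw w' hw' hww => ?_⟩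
    simp only
    rw [red T (by linarith), red S (by linarith)]
    refine hF T (by linarith) S (by linarith) (0, w) ⟨trivial, hw⟩ (0, w') ⟨trivial, hw'⟩ fun l => ?_
    exact hl l T (by linarith [hTs l]) S (by linarith [hTs l]) w ((hev w hw).2 l) w' ((hev w' hw').2 l) ((hww ()).trans (hδ'l l))

end Kuw

namespace Kuw
open Topology

lemma haar_scale {n : ℕ} (L : ((Fin n → ℂ) × ℂ) ≃L[ℂ] (Fin (n+1) → ℂ)) :
    ∃ κ : NNReal, 0 < κ ∧ Measure.map L (volume : Measure ((Fin n → ℂ) × ℂ)) = κ • (volume : Measure (Fin (n+1) → ℂ)) := by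
  have hvol : (volume : Measure ((Fin n → ℂ) × ℂ)).IsAddHaarMeasure := by
    have hpi : (volume : Measure (Fin n → ℂ)).IsAddHaarMeasure := by rw [volume_pi]; infer_instance
    rw [Measure.volume_eq_prod]; exact Measure.prod.instIsAddHaarMeasure _ _
  have hpi : (volume : Measure (Fin (n+1) → ℂ)).IsAddHaarMeasure := by rw [volume_pi]; infer_instance
  have : Measure.IsAddHaarMeasure (Measure.map L (volume : Measure ((Fin n → ℂ) × ℂ))) :=
    ContinuousLinearEquiv.isAddHaarMeasure_map L _
  exact ⟨_, Measure.addHaarScalarFactor_pos_of_isAddHaarMeasure _ _, Measure.isAddLeftInvariant_eq_smul _ volume⟩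

lemma haar_int {n : ℕ} (L : ((Fin n → ℂ) × ℂ) ≃L[ℂ] (Fin (n+1) → ℂ)) :
    ∃ κ : ℝ, 0 < κ ∧ ∀ (A : Set ((Fin n → ℂ) × ℂ)) (G : (Fin (n+1) → ℂ) → ℝ),
      ∫ q in A, G (L q) = κ * ∫ x in L '' A, G x := by
  obtain ⟨κ, hκ, h⟩ := haar_scale L
  refine ⟨κ, hκ, fun A G => ?_⟩
  have he : MeasurableEmbedding L := L.toHomeomorph.measurableEmbedding
  have h1 := he.setIntegral_map (μ := volume) G (L '' A)
  rw [Set.preimage_image_eq _ L.injective, h] at h1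
  rw [← h1, Measure.restrict_smul, integral_smul_nnreal_measure]; rfl

lemma auc_shift {X ι : Type*} (s : Set X) (U : ι → ℝ → X → ℝ) (F F' : ℝ → X → ℝ) (a T1 : ℝ) (ha : 0 ≤ a)
    (h : ∀ T ≥ T1, ∀ x ∈ s, |F' T x - F T x| ≤ a / T) (hF : AUC s U F) : AUC s U F' := by
  intro η hη
  obtain ⟨δ, hδ, T0, hT0, hF⟩ := hF (η / 2) (by positivity)
  refine ⟨δ, hδ, T0 + |T1| + 4 * a / η, by positivity, fun T hT S hS x hx y hy hxy => ?_⟩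
  have e1 := le_abs_self T1
  have e0 := abs_nonneg T1
  have e2 : 0 ≤ 4 * a / η := by positivity
  have := hF T (by linarith) S (by linarith) x hx y hy hxy
  have b : ∀ R, R ≥ T0 + |T1| + 4 * a / η → a / R ≤ η / 4 := by
    intro R hR
    have hR0 : 0 < R := by linarith
    rw [div_le_iff₀ hR0]
    have : 4 * a / η ≤ R := by linarith
    rw [div_le_iff₀ hη] at this; linarith
  have h1 := abs_le.1 ((h T (by linarith) x hx).trans (b T hT))
  have h2 := abs_le.1 ((h S (by linarith) y hy).trans (b S hS))
  linarith [h1.1, h1.2, h2.1, h2.2]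

lemma log_int_bd {X : Type*} [MeasurableSpace X] (μ : Measure X) (A : Set X) (hA : MeasurableSet A) (hA0 : 0 < μ.real A)
    (hAt : μ A < ⊤) (f : X → ℝ) (hf : Measurable f) (B T : ℝ) (hT : 0 < T) (hB : ∀ x ∈ A, |f x| ≤ B) :
    IntegrableOn (fun x => Real.exp (T * f x)) A μ ∧ 0 < ∫ x in A, Real.exp (T * f x) ∂μ ∧
    |(1 / T) * Real.log (∫ x in A, Real.exp (T * f x) ∂μ)| ≤ B + |Real.log (μ.real A)| / T := by
  have hintg : IntegrableOn (fun x => Real.exp (T * f x)) A μ := by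
    refine IntegrableOn.of_bound hAt (by fun_prop) (Real.exp (T * B)) ?_
    filter_upwards [ae_restrict_mem hA] with x hx
    rw [Real.norm_eq_abs, Real.abs_exp, Real.exp_le_exp]
    exact mul_le_mul_of_nonneg_left (abs_le.1 (hB x hx)).2 hT.le
  have h1 : Real.exp (-(T * B)) * μ.real A ≤ ∫ x in A, Real.exp (T * f x) ∂μ := by
    have : ∫ x in A, Real.exp (-(T * B)) ∂μ = Real.exp (-(T * B)) * μ.real A := by
      rw [setIntegral_const, smul_eq_mul, mul_comm]
    rw [← this]
    refine setIntegral_mono_on (integrableOn_const hAt.ne) hintg hA fun x hx => ?_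
    rw [Real.exp_le_exp]
    nlinarith [(abs_le.1 (hB x hx)).1]
  have h2 : ∫ x in A, Real.exp (T * f x) ∂μ ≤ Real.exp (T * B) * μ.real A := by
    have : ∫ x in A, Real.exp (T * B) ∂μ = Real.exp (T * B) * μ.real A := by
      rw [setIntegral_const, smul_eq_mul, mul_comm]
    rw [← this]
    refine setIntegral_mono_on hintg (integrableOn_const hAt.ne) hA fun x hx => ?_
    rw [Real.exp_le_exp]
    nlinarith [(abs_le.1 (hB x hx)).2]
  have h0 : 0 < ∫ x in A, Real.exp (T * f x) ∂μ := lt_of_lt_of_le (by positivity) h1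
  refine ⟨hintg, h0, ?_⟩
  have l1 := Real.log_le_log (by positivity) h1
  have l2 := Real.log_le_log h0 h2
  rw [Real.log_mul (Real.exp_pos _).ne' hA0.ne', Real.log_exp] at l1 l2
  have e1 := le_abs_self (Real.log (μ.real A))
  have e2 := neg_abs_le (Real.log (μ.real A))
  have : B + |Real.log (μ.real A)| / T = (1 / T) * (T * B + |Real.log (μ.real A)|) := by field_simp
  rw [this, abs_mul, abs_of_pos (by positivity : 0 < 1 / T)]
  refine mul_le_mul_of_nonneg_left ?_ (by positivity)
  rw [abs_le]; constructor <;> linarith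

lemma RP_succ (n : ℕ) (ih : RP n) : RP (n + 1) := by
  classical
  intro Λ _ c hc N hN
  obtain ⟨L0, D, sc, p, C, hC, hsc, hp, hp0, hsc1, -, hcomp⟩ := SP n c hc
  obtain ⟨d, hd, ρ, Ψ, _, c', hc', hρ, hfac, hmat⟩ := alg D sc p hsc hp
  set L : ((Fin n → ℂ) × ℂ) ≃L[ℂ] (Fin (n+1) → ℂ) := (ContinuousLinearEquiv.prodComm ℂ (Fin n → ℂ) ℂ).trans L0 with hL
  have hLL : ∀ x z, L0 (z, x) = L (x, z) := fun x z => rfl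
  simp only [hLL] at hcomp
  have t : Filter.Tendsto (fun q : ((Fin n → ℂ) × ℂ) × ℂ => (L (q.1.1, q.2), q.1.2)) (𝓝 0) (𝓝 0) :=
    Continuous.tendsto' (by fun_prop) _ _ (by
      change (L (0, 0), (0:ℂ)) = 0
      have : ((0, 0) : (Fin n → ℂ) × ℂ) = 0 := rfl
      rw [this, map_zero]; rfl)
  have hev1 : ∀ᶠ q in 𝓝 (0 : ((Fin n → ℂ) × ℂ) × ℂ), (L (q.1.1, q.2), q.1.2) ∈ N ∧ ∀ l,
      ‖c l (L (q.1.1, q.2), q.1.2)‖ ≤ C * ‖sc l q.1 * pol (D l) (p l q.1) q.2‖ ∧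
        ‖sc l q.1 * pol (D l) (p l q.1) q.2‖ ≤ C * ‖c l (L (q.1.1, q.2), q.1.2)‖ :=
    (t.eventually hN).and (Filter.eventually_all.2 hcomp)
  obtain ⟨r1, hr1, h1⟩ := Metric.eventually_nhds_iff_ball.1 hev1
  set r := min r1 (1 / 4) with hr
  have hr0 : 0 < r := by positivity
  have hrr : r ≤ r1 := min_le_left _ _
  have hr4 : r ≤ 1 / 4 := min_le_right _ _
  choose e he hroot using fun l => root_small (D l) (r / 2) (by positivity) (by linarith)
  have hev2 : ∀ᶠ v in 𝓝 (0 : (Fin n → ℂ) × ℂ), v ∈ Metric.ball (0 : (Fin n → ℂ) × ℂ) r1 ∧ ∀ l, ‖sc l v‖ ≤ 1 ∧ ∀ i, ‖p l v i‖ ≤ e l := by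
    refine Filter.Eventually.and (Metric.ball_mem_nhds _ hr1) (Filter.eventually_all.2 fun l => (hsc1 l).and ?_)
    have : ∀ᶠ v in 𝓝 (0 : (Fin n → ℂ) × ℂ), ‖p l v‖ < e l := by
      refine (hp l).continuousAt.norm.eventually (gt_mem_nhds ?_)
      simp only; rw [hp0 l, norm_zero]; exact he l
    filter_upwards [this] with v hv i
    exact (norm_le_pi_norm _ i).trans hv.le
  obtain ⟨W, hW, ε, hε, hWm, hWt, hWN, hRP⟩ := ih Ψ c' hc' _ hev2
  have hWN' : ∀ x ∈ W, ∀ w ∈ Metric.ball (0:ℂ) ε, (x, w) ∈ Metric.ball (0 : (Fin n → ℂ) × ℂ) r1 ∧ ∀ l, ‖sc l (x, w)‖ ≤ 1 ∧ ∀ i, ‖p l (x, w) i‖ ≤ e l :=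
    fun x hx w hw => hWN ⟨hx, hw⟩
  have hq : ∀ v ∈ W ×ˢ Metric.ball (0:ℂ) ε, ∀ z ∈ Metric.ball (0:ℂ) r, (v, z) ∈ Metric.ball (0 : ((Fin n → ℂ) × ℂ) × ℂ) r1 := by
    intro v hv z hz
    have a1 := (hWN' v.1 hv.1 v.2 hv.2).1
    rw [mem_ball_zero_iff] at a1 hz ⊢
    exact max_lt a1 (hz.trans_le hrr)
  obtain ⟨κ, hκ, hintg⟩ := haar_int L
  have hAn : W ×ˢ Metric.ball (0:ℂ) r ∈ 𝓝 (0 : (Fin n → ℂ) × ℂ) := prod_mem_nhds hW (Metric.ball_mem_nhds _ hr0)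
  have hemb : MeasurableEmbedding L := L.toHomeomorph.measurableEmbedding
  have hAt : volume (W ×ˢ Metric.ball (0:ℂ) r) < ⊤ := by
    rw [Measure.volume_eq_prod, Measure.prod_prod]
    exact ENNReal.mul_lt_top hWt measure_ball_lt_top
  refine ⟨L '' (W ×ˢ Metric.ball (0:ℂ) r), ?_, ε, hε, hemb.measurableSet_image.2 (hWm.prod measurableSet_ball), ?_, ?_, ?_⟩
  · have := L.toHomeomorph.isOpenMap.image_mem_nhds hAn
    simpa using this
  · obtain ⟨κ', hκ', hk⟩ := haar_scale L
    have h2 := congrArg (fun μ => μ (L '' (W ×ˢ Metric.ball (0:ℂ) r))) hk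
    simp only [hemb.map_apply, Set.preimage_image_eq _ L.injective, Measure.smul_apply] at h2
    rw [h2] at hAt
    by_contra hcon
    rw [not_lt, top_le_iff] at hcon
    rw [hcon] at hAt
    rw [ENNReal.smul_top] at hAt
    simp [hκ'.ne'] at hAt
  · rintro ⟨x, w⟩ ⟨⟨⟨x', z⟩, ⟨hx', hz⟩, rfl⟩, hw⟩
    exact (h1 _ (hq (x', w) ⟨hx', hw⟩ z hz)).1
  · intro M hM
    obtain ⟨M', hM', hmat⟩ := hmat M hM.le
    obtain ⟨M0, hM0, hRP⟩ := hRP M' hM'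
    refine ⟨M0, hM0, fun F hFm hFB hF => ?_⟩
    obtain ⟨B, TB, hB⟩ := hFB
    set F1 : ℝ → ((Fin n → ℂ) × ℂ) × ℂ → ℝ := fun T q => F T (L (q.1.1, q.2), q.1.2) with hF1
    have hF1m : ∀ T, Measurable (F1 T) := fun T => (hFm T).comp (by
      have : Continuous fun q : ((Fin n → ℂ) × ℂ) × ℂ => (L (q.1.1, q.2), q.1.2) := by fun_prop
      exact this.measurable)
    have hF1B : ∀ T ≥ TB, ∀ v ∈ W ×ˢ Metric.ball (0:ℂ) ε, ∀ z ∈ Metric.ball (0:ℂ) r, |F1 T (v, z)| ≤ B := by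
      intro T hT v hv z hz
      exact hB T hT _ ⟨⟨(v.1, z), ⟨hv.1, hz⟩, rfl⟩, hv.2⟩
    have hcore := core (ι := Ψ) (W ×ˢ Metric.ball (0:ℂ) ε) d hd hr0 hr4 hM hC ρ (by
        intro v hv i
        rcases hρ v i with h | ⟨l, h⟩
        · rw [h, norm_zero]; positivity
        · exact hroot l _ ((hWN' v.1 hv.1 v.2 hv.2).2 l).2 _ h)
      (fun v l => Polynomial.C (sc l v) * polP (D l) (p l v)) (by
        intro v hv l
        obtain ⟨J, hJ⟩ := hfac v l
        exact ⟨J, sc l v, ((hWN' v.1 hv.1 v.2 hv.2).2 l).1, by rw [hJ]⟩)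
      (fun ψ T v => lg M' T (c' ψ v)) (by
        intro δ hδ
        obtain ⟨δ', hδ', T0, hT0, h⟩ := hmat δ hδ
        exact ⟨δ', hδ', T0, hT0, fun T hT S hS x _ y _ => h T hT S hS x y⟩)
      (fun l q => c l (L (q.1.1, q.2), q.1.2)) (by
        intro v hv z hz l
        have := (h1 _ (hq v hv z hz)).2 l
        simpa only [Polynomial.eval_mul, Polynomial.eval_C, polP_eval] using this)
      F1 (fun T v hv => (hF1m T).comp (by fun_prop)) B TB hF1B (by
        intro η hη
        obtain ⟨δ, hδ, T0, hT0, h⟩ := hF η hη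
        refine ⟨δ, hδ, T0, hT0, fun T hT S hS x hx y hy hxy => ?_⟩
        exact h T hT S hS _ ⟨⟨(x.1.1, x.2), ⟨hx.1.1, hx.2⟩, rfl⟩, hx.1.2⟩ _ ⟨⟨(y.1.1, y.2), ⟨hy.1.1, hy.2⟩, rfl⟩, hy.1.2⟩ hxy)
    have hbr : 0 < (volume : Measure ℂ).real (Metric.ball (0:ℂ) r) :=
      ENNReal.toReal_pos (Metric.measure_ball_pos _ _ hr0).ne' measure_ball_lt_top.ne
    have hbd : ∀ T, T ≥ max TB 1 → ∀ v ∈ W ×ˢ Metric.ball (0:ℂ) ε, _ := fun T (hT : T ≥ max TB 1) v (hv : v ∈ W ×ˢ Metric.ball (0:ℂ) ε) =>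
      log_int_bd volume (Metric.ball (0:ℂ) r) measurableSet_ball hbr measure_ball_lt_top (fun z => F1 T (v, z))
        ((hF1m T).comp (by fun_prop)) B T (by linarith [le_max_right TB 1]) (hF1B T ((le_max_left _ _).trans hT) v hv)
    have hfin := hRP (fun T v => (1 / T) * Real.log (∫ z in Metric.ball (0 : ℂ) r, Real.exp (T * F1 T (v, z)))) (by
        intro T
        have hm : Measurable fun q : ((Fin n → ℂ) × ℂ) × ℂ => Real.exp (T * F1 T q) :=
          Real.measurable_exp.comp ((hF1m T).const_mul T)
        have : StronglyMeasurable fun v => ∫ z in Metric.ball (0 : ℂ) r, Real.exp (T * F1 T (v, z)) :=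
          StronglyMeasurable.integral_prod_right (f := fun v z => Real.exp (T * F1 T (v, z))) hm.stronglyMeasurable
        exact (Real.measurable_log.comp this.measurable).const_mul _)
      ⟨B + |Real.log ((volume : Measure ℂ).real (Metric.ball (0:ℂ) r))|, max TB 1, fun T hT v hv => by
        refine ((hbd T hT v hv).2.2).trans ?_
        have h1T : 1 ≤ T := (le_max_right TB 1).trans hT
        have : |Real.log ((volume : Measure ℂ).real (Metric.ball (0:ℂ) r))| / T ≤ |Real.log ((volume : Measure ℂ).real (Metric.ball (0:ℂ) r))| :=
          div_le_self (abs_nonneg _) h1T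
        linarith⟩ hcore
    refine auc_shift _ _ _ _ |Real.log κ| (max TB 1) (abs_nonneg _) ?_ hfin
    intro T hT w hw
    have hT0 : 0 < T := by linarith [(le_max_right TB 1).trans hT]
    have e1 : ∫ x in W, Real.exp (T * ((1 / T) * Real.log (∫ z in Metric.ball (0 : ℂ) r, Real.exp (T * F1 T ((x, w), z))))) =
        ∫ x in W, ∫ z in Metric.ball (0 : ℂ) r, Real.exp (T * F T (L (x, z), w)) := by
      refine setIntegral_congr_fun hWm fun x hx => ?_
      rw [← mul_assoc, mul_one_div_cancel hT0.ne', one_mul, Real.exp_log (hbd T hT (x, w) ⟨hx, hw⟩).2.1]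
    have hvA : 0 < (volume : Measure ((Fin n → ℂ) × ℂ)).real (W ×ˢ Metric.ball (0:ℂ) r) :=
      ENNReal.toReal_pos (Measure.measure_pos_of_mem_nhds _ hAn).ne' hAt.ne
    have hL2 := log_int_bd volume (W ×ˢ Metric.ball (0:ℂ) r) (hWm.prod measurableSet_ball) hvA hAt
      (fun q => F T (L q, w)) ((hFm T).comp (by
        have : Continuous fun q : (Fin n → ℂ) × ℂ => (L q, w) := by fun_prop
        exact this.measurable)) B T hT0 (fun q hq => hB T ((le_max_left _ _).trans hT) _ ⟨⟨q, hq, rfl⟩, hw⟩)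
    have e2 : ∫ x in W, ∫ z in Metric.ball (0 : ℂ) r, Real.exp (T * F T (L (x, z), w)) =
        ∫ q in W ×ˢ Metric.ball (0:ℂ) r, Real.exp (T * F T (L q, w)) := by
      exact (setIntegral_prod (μ := (volume : Measure (Fin n → ℂ))) (ν := (volume : Measure ℂ))
        (fun q => Real.exp (T * F T (L q, w))) hL2.1).symm
    have e3 := hintg (W ×ˢ Metric.ball (0:ℂ) r) (fun x => Real.exp (T * F T (x, w)))
    rw [e1, e2, e3]
    have hpos : 0 < ∫ x in L '' (W ×ˢ Metric.ball (0:ℂ) r), Real.exp (T * F T (x, w)) := by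
      have := hL2.2.1
      rw [e3] at this
      exact (mul_pos_iff_of_pos_left hκ).1 this
    rw [Real.log_mul hκ.ne' hpos.ne']
    have : ∀ a b : ℝ, 1 / T * b - 1 / T * (a + b) = - (a / T) := by intro a b; ring
    rw [this, abs_neg, abs_div, abs_of_pos hT0]

lemma RP_all (n : ℕ) : RP n := by
  induction n with
  | zero => exact RP_zero
  | succ n ih => exact RP_succ n ih

end Kuw

namespace Kuw
open Topology

lemma LC {X : Type*} [MeasurableSpace X] (μ : Measure X) [IsFiniteMeasure μ] (φ : X → ℝ) (hφ : Measurable φ) (h0 : ∀ x, 0 ≤ φ x)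
    (C α p s0 : ℝ) (hs0 : 0 < s0) (hp : 0 < p) (hpα : p < α)
    (h : ∀ s, 0 < s → s < s0 → μ.real {x | φ x < s} ≤ C * s ^ α) : Integrable (fun x => (φ x) ^ (-p)) μ := by
  have e : (fun x => (φ x) ^ (-p)) = fun x => ((φ x)⁻¹) ^ p := by
    ext x; rw [Real.rpow_neg (h0 x), Real.inv_rpow (h0 x)]
  rw [e]
  refine ⟨(hφ.inv.pow_const p).aestronglyMeasurable, ?_⟩
  have hnn : ∀ x, 0 ≤ (φ x)⁻¹ ^ p := fun x => Real.rpow_nonneg (inv_nonneg.2 (h0 x)) _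
  rw [hasFiniteIntegral_iff_ofReal (Filter.Eventually.of_forall hnn)]
  rw [lintegral_rpow_eq_lintegral_meas_le_mul μ (f := fun x => (φ x)⁻¹) (Filter.Eventually.of_forall fun x => inv_nonneg.2 (h0 x)) (by fun_prop) hp]
  refine ENNReal.mul_lt_top ENNReal.ofReal_lt_top ?_
  set t1 := 2 / s0 + 1 with ht1
  have ht10 : 0 < t1 := by positivity
  rw [← Set.Ioc_union_Ioi_eq_Ioi ht10.le]
  refine (lintegral_union_le _ _ _).trans_lt (ENNReal.add_lt_top.2 ⟨?_, ?_⟩)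
  · have hi : IntegrableOn (fun t : ℝ => t ^ (p - 1)) (Set.Ioc 0 t1) := by
      rw [← intervalIntegrable_iff_integrableOn_Ioc_of_le ht10.le]
      exact intervalIntegral.intervalIntegrable_rpow' (by linarith)
    calc _ ≤ ∫⁻ t in Set.Ioc 0 t1, μ Set.univ * ENNReal.ofReal (t ^ (p - 1)) := by
          refine lintegral_mono fun t => ?_
          exact mul_le_mul_left (measure_mono (Set.subset_univ _)) _
      _ = μ Set.univ * ∫⁻ t in Set.Ioc 0 t1, ENNReal.ofReal (t ^ (p - 1)) := by
          rw [lintegral_const_mul _ (by fun_prop)]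
      _ < ⊤ := ENNReal.mul_lt_top (measure_lt_top _ _) (Integrable.lintegral_lt_top hi)
  · have hi : IntegrableOn (fun t : ℝ => (C * 2 ^ α) * t ^ (p - 1 - α)) (Set.Ioi t1) :=
      (integrableOn_Ioi_rpow_of_lt (by linarith) ht10).const_mul _
    refine lt_of_le_of_lt ?_ (Integrable.lintegral_lt_top hi)
    refine setLIntegral_mono' measurableSet_Ioi fun t ht => ?_
    have ht : t1 < t := ht
    have ht0 : 0 < t := ht10.trans ht
    have hs : 2 / t < s0 := by
      rw [div_lt_iff₀ ht0]
      have : 2 / s0 < t := by linarith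
      rw [div_lt_iff₀ hs0] at this; linarith
    have hm := h (2 / t) (by positivity) hs
    have hsub : {a | t ≤ (φ a)⁻¹} ⊆ {x | φ x < 2 / t} := by
      intro a ha
      have ha : t ≤ (φ a)⁻¹ := ha
      have hpos : 0 < φ a := inv_pos.1 (ht0.trans_le ha)
      have : φ a ≤ 1 / t := by
        rw [le_div_iff₀ ht0]
        rw [← one_div, le_div_iff₀ hpos] at ha; linarith
      have h2 : 1 / t < 2 / t := by gcongr; norm_num
      exact this.trans_lt h2
    calc _ ≤ μ {x | φ x < 2 / t} * ENNReal.ofReal (t ^ (p - 1)) := mul_le_mul_left (measure_mono hsub) _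
      _ = ENNReal.ofReal (μ.real {x | φ x < 2 / t}) * ENNReal.ofReal (t ^ (p - 1)) := by rw [ofReal_measureReal]
      _ = ENNReal.ofReal (μ.real {x | φ x < 2 / t} * t ^ (p - 1)) := (ENNReal.ofReal_mul measureReal_nonneg).symm
      _ ≤ _ := by
        refine ENNReal.ofReal_le_ofReal ?_
        calc μ.real {x | φ x < 2 / t} * t ^ (p - 1) ≤ (C * (2 / t) ^ α) * t ^ (p - 1) :=
              mul_le_mul_of_nonneg_right hm (by positivity)
          _ = _ := by
            rw [Real.div_rpow (by norm_num) ht0.le, Real.rpow_sub ht0 (p - 1) α]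
            ring

/-- the set of integrability exponents -/
def SS {E : Type*} [NormedAddCommGroup E] [MeasureSpace E] (f : E → ℂ) : Set ℝ :=
  {c : ℝ | 0 < c ∧ ∃ ε > 0, IntegrableOn (fun z => ‖f z‖ ^ (-(2 * c))) (Metric.ball 0 ε)}

variable {E : Type*} [NormedAddCommGroup E] [MeasureSpace E]

lemma SS_congr [OpensMeasurableSpace E] {f f' : E → ℂ} (h : f =ᶠ[𝓝 0] f') : SS f = SS f' := by
  have key : ∀ f f' : E → ℂ, f =ᶠ[𝓝 0] f' → SS f ⊆ SS f' := by
    rintro f f' h c ⟨hc, ε, hε, hi⟩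
    obtain ⟨ε', hε', h'⟩ := Metric.eventually_nhds_iff_ball.1 h
    refine ⟨hc, min ε ε', by positivity, ?_⟩
    refine (hi.mono_set (Metric.ball_subset_ball (min_le_left _ _))).congr_fun (fun x hx => ?_) measurableSet_ball
    simp only
    rw [h' x (Metric.ball_subset_ball (min_le_right _ _) hx)]
  exact (key _ _ h).antisymm (key _ _ h.symm)

lemma CH {X : Type*} [MeasurableSpace X] (μ : Measure X) (A : Set X) (hA : MeasurableSet A) (hAt : μ A < ⊤) (f : X → ℂ) (hf : Measurable f)
    (c : ℝ) (hc : 0 < c) (hi : IntegrableOn (fun z => ‖f z‖ ^ (-(2 * c))) A μ) (h0 : μ {x ∈ A | f x = 0} = 0) :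
    ∃ K, 0 ≤ K ∧ ∀ s > 0, μ.real {x ∈ A | ‖f x‖ < s} ≤ K * s ^ (2 * c) := by
  set K := ∫ x in A, ‖f x‖ ^ (-(2 * c)) ∂μ with hK
  have hK0 : 0 ≤ K := integral_nonneg fun x => by positivity
  refine ⟨K, hK0, fun s hs => ?_⟩
  have hm : MeasurableSet {x ∈ A | ‖f x‖ < s} := hA.inter (measurableSet_lt hf.norm measurable_const : MeasurableSet {x | ‖f x‖ < s})
  have hlt : μ {x ∈ A | ‖f x‖ < s} < ⊤ := (measure_mono (Set.sep_subset _ _)).trans_lt hAt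
  have h1 : ∫ x in {x ∈ A | ‖f x‖ < s}, s ^ (-(2 * c)) ∂μ ≤ ∫ x in {x ∈ A | ‖f x‖ < s}, ‖f x‖ ^ (-(2 * c)) ∂μ := by
    refine setIntegral_mono_on_ae (integrableOn_const hlt.ne) (hi.mono_set (Set.sep_subset _ _)) hm ?_
    have : ∀ᵐ x ∂μ, x ∉ {x ∈ A | f x = 0} := measure_eq_zero_iff_ae_notMem.1 h0
    filter_upwards [this] with x hx hx2
    have hne : f x ≠ 0 := fun h => hx ⟨hx2.1, h⟩
    exact Real.rpow_le_rpow_of_nonpos (norm_pos_iff.2 hne) hx2.2.le (by linarith)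
  have h2 : ∫ x in {x ∈ A | ‖f x‖ < s}, ‖f x‖ ^ (-(2 * c)) ∂μ ≤ K :=
    setIntegral_mono_set hi (Filter.Eventually.of_forall fun x => by positivity) (Filter.Eventually.of_forall (Set.sep_subset _ _))
  rw [setIntegral_const, smul_eq_mul] at h1
  have h3 := h1.trans h2
  rw [Real.rpow_neg hs.le, ← div_eq_mul_inv, div_le_iff₀ (by positivity)] at h3
  exact h3

/-- sufficient condition -/
lemma SS_of_vol [OpensMeasurableSpace E] (f : E → ℂ) (hf : Measurable f) (W : Set E) (hW : W ∈ 𝓝 0) (hWt : volume W < ⊤)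
    (C α c s0 : ℝ) (hs0 : 0 < s0) (hc : 0 < c) (hα : 2 * c < α)
    (h : ∀ s, 0 < s → s < s0 → volume.real {x ∈ W | ‖f x‖ < s} ≤ C * s ^ α) : c ∈ SS f := by
  obtain ⟨ε, hε, hb⟩ := Metric.mem_nhds_iff.1 hW
  refine ⟨hc, ε, hε, ?_⟩
  have : IsFiniteMeasure (volume.restrict (Metric.ball (0 : E) ε)) := ⟨by
    rw [Measure.restrict_apply_univ]; exact (measure_mono hb).trans_lt hWt⟩
  refine LC _ (fun x => ‖f x‖) (by fun_prop) (fun x => norm_nonneg _) C α (2 * c) s0 hs0 (by linarith) hα fun s h1 h2 => ?_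
  refine le_trans ?_ (h s h1 h2)
  have hm : MeasurableSet {x | ‖f x‖ < s} := measurableSet_lt (by fun_prop) (by fun_prop)
  rw [measureReal_restrict_apply hm]
  refine measureReal_mono (fun x hx => ⟨hb hx.2, hx.1⟩) ?_
  exact ((measure_mono (Set.sep_subset _ _)).trans_lt hWt).ne

lemma SS_down [OpensMeasurableSpace E] [IsLocallyFiniteMeasure (volume : Measure E)] (f : E → ℂ) (hf : Measurable f) {c c' : ℝ} (hc : c ∈ SS f) (h0 : 0 < c') (h : c' ≤ c) : c' ∈ SS f := by
  obtain ⟨hc0, ε, hε, hi⟩ := hc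
  obtain ⟨ε', hε', hfin⟩ : ∃ ε' > 0, volume (Metric.ball (0:E) ε') < ⊤ := by
    obtain ⟨s, hs, hlt⟩ := (volume : Measure E).finiteAt_nhds 0
    obtain ⟨ε', hε', hb⟩ := Metric.mem_nhds_iff.1 hs
    exact ⟨ε', hε', (measure_mono hb).trans_lt hlt⟩
  refine ⟨h0, min ε ε', by positivity, ?_⟩
  have hi2 := hi.mono_set (Metric.ball_subset_ball (min_le_left ε ε') (x := 0))
  have hi3 : IntegrableOn (fun _ : E => (1:ℝ)) (Metric.ball (0:E) (min ε ε')) :=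
    integrableOn_const ((measure_mono (Metric.ball_subset_ball (min_le_right ε ε'))).trans_lt hfin).ne
  refine (hi2.add hi3).mono' ((hf.norm.pow_const _).aestronglyMeasurable) (Filter.Eventually.of_forall fun x => ?_)
  simp only [Pi.add_apply]
  rw [Real.norm_of_nonneg (by positivity)]
  have p1 : 0 ≤ ‖f x‖ ^ (-(2 * c)) := by positivity
  rcases (norm_nonneg (f x)).eq_or_lt with hz | hz
  · rw [← hz, Real.zero_rpow (by linarith : -(2 * c') ≠ 0), Real.zero_rpow (by linarith : -(2 * c) ≠ 0)]; norm_num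
  · rcases le_total ‖f x‖ 1 with h1 | h1
    · have := Real.rpow_le_rpow_of_exponent_ge hz h1 (show -(2 * c) ≤ -(2 * c') by linarith)
      linarith
    · have := Real.rpow_le_one_of_one_le_of_nonpos h1 (show -(2 * c') ≤ 0 by linarith)
      linarith

end Kuw

namespace Kuw
open Topology

noncomputable def FB {X : Type*} (B : ℝ) (g : X → ℂ) (T : ℝ) (q : X × ℂ) : ℝ := -B * (1 - lg 1 T (g q.1 - q.2))

lemma FB_exp {X : Type*} (B : ℝ) (g : X → ℂ) {T : ℝ} (hT : 0 < T) (q : X × ℂ) :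
    Real.exp (T * FB B g T q) = (Real.exp (-T) / (‖g q.1 - q.2‖ + Real.exp (-T))) ^ B := by
  have h1 := lg_exp 1 hT (g q.1 - q.2)
  rw [one_mul] at h1
  have h2 : Real.exp (-T) / (‖g q.1 - q.2‖ + Real.exp (-T)) = Real.exp (-T + T * lg 1 T (g q.1 - q.2)) := by
    rw [← h1, ← Real.exp_sub]; ring_nf
  rw [h2, ← Real.exp_mul]
  congr 1
  unfold FB; ring

lemma FB_meas {X : Type*} [MeasurableSpace X] (B : ℝ) (g : X → ℂ) (hg : Measurable g) (T : ℝ) : Measurable (FB B g T) := by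
  unfold FB lg
  fun_prop

lemma FB_bd {X : Type*} (B : ℝ) (hB : 0 < B) (g : X → ℂ) {T : ℝ} (hT : 1 ≤ T) (q : X × ℂ) (hq : ‖g q.1 - q.2‖ ≤ 1) :
    |FB B g T q| ≤ 2 * B := by
  have h1 := lg_le 1 (by linarith : 0 < T) (g q.1 - q.2)
  have h2 : -1 ≤ lg 1 T (g q.1 - q.2) := by
    unfold lg
    rw [le_div_iff₀ (by linarith)]
    have : Real.log (‖g q.1 - q.2‖ + Real.exp (-(1 * T))) ≤ ‖g q.1 - q.2‖ + Real.exp (-(1 * T)) - 1 := Real.log_le_sub_one_of_pos (by positivity)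
    have h3 : Real.exp (-(1*T)) ≤ 1 := Real.exp_le_one_iff.2 (by linarith)
    linarith
  unfold FB
  rw [abs_le]; constructor <;> nlinarith

/-- volume of sublevel sets -/
noncomputable def Vol {X : Type*} [MeasureSpace X] (W : Set X) (g : X → ℂ) (s : ℝ) (w : ℂ) : ℝ :=
  volume.real {x ∈ W | ‖g x - w‖ < s}

lemma J1 {X : Type*} [MeasureSpace X] (W : Set X) (hW : MeasurableSet W) (g : X → ℂ) (hg : Measurable g) (B : ℝ) (hB : 0 < B) {T : ℝ} (hT : 0 < T)
    (w : ℂ) (hi : IntegrableOn (fun x => Real.exp (T * FB B g T (x, w))) W) (hWt : volume W < ⊤) :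
    Vol W g (Real.exp (-T)) w ≤ 2 ^ B * ∫ x in W, Real.exp (T * FB B g T (x, w)) := by
  set s := Real.exp (-T)
  have hs : 0 < s := Real.exp_pos _
  set A := {x ∈ W | ‖g x - w‖ < s} with hAdef
  have hm : MeasurableSet A := hW.inter (measurableSet_lt (hg.sub_const w).norm measurable_const : MeasurableSet {x | ‖g x - w‖ < s})
  have hlt : volume A < ⊤ := (measure_mono (Set.sep_subset _ _)).trans_lt hWt
  have h1 : ∫ x in A, ((2:ℝ) ^ B)⁻¹ ≤ ∫ x in A, Real.exp (T * FB B g T (x, w)) := by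
    refine setIntegral_mono_on (integrableOn_const hlt.ne) (hi.mono_set (Set.sep_subset _ _)) hm fun x hx => ?_
    rw [FB_exp B g hT, ← Real.inv_rpow (by norm_num)]
    refine Real.rpow_le_rpow (by norm_num) ?_ hB.le
    have := hx.2
    rw [le_div_iff₀ (by positivity)]
    simp only
    change _ ≤ s
    change 2⁻¹ * (‖g x - w‖ + s) ≤ s
    linarith
  have h2 : ∫ x in A, Real.exp (T * FB B g T (x, w)) ≤ ∫ x in W, Real.exp (T * FB B g T (x, w)) :=
    setIntegral_mono_set hi (Filter.Eventually.of_forall fun x => by positivity) (Filter.Eventually.of_forall (Set.sep_subset _ _))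
  rw [setIntegral_const, smul_eq_mul] at h1
  have h3 := h1.trans h2
  rw [← div_eq_mul_inv, div_le_iff₀ (by positivity)] at h3
  unfold Vol
  linarith

lemma J2 {X : Type*} [MeasureSpace X] (W : Set X) (hW : MeasurableSet W) (g : X → ℂ) (hg : Measurable g) (B : ℝ) (hB : 0 < B) {T : ℝ} (hT : 0 < T)
    (w : ℂ) (hi : IntegrableOn (fun x => Real.exp (T * FB B g T (x, w))) W) (hWt : volume W < ⊤) (t : ℝ) (ht : 0 < t) :
    ∫ x in W, Real.exp (T * FB B g T (x, w)) ≤ Vol W g t w + volume.real W * (Real.exp (-T) / t) ^ B := by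
  set s := Real.exp (-T) with hsdef
  have hs : 0 < s := Real.exp_pos _
  set A := {x ∈ W | ‖g x - w‖ < t} with hAdef
  have hm' : MeasurableSet {x | ‖g x - w‖ < t} := measurableSet_lt (hg.sub_const w).norm measurable_const
  have hm : MeasurableSet A := hW.inter hm'
  have hlt : volume A < ⊤ := (measure_mono (Set.sep_subset _ _)).trans_lt hWt
  have hintg : IntegrableOn (fun x => Set.indicator {x | ‖g x - w‖ < t} (fun _ => (1:ℝ)) x + (s / t) ^ B) W := by
    have : IsFiniteMeasure (volume.restrict W) := ⟨by rwa [Measure.restrict_apply_univ]⟩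
    exact ((integrable_const (1:ℝ)).indicator hm').add (integrable_const _)
  have : IsFiniteMeasure (volume.restrict W) := ⟨by rwa [Measure.restrict_apply_univ]⟩
  calc _ ≤ ∫ x in W, (Set.indicator {x | ‖g x - w‖ < t} (fun _ => (1:ℝ)) x + (s / t) ^ B) := by
        refine setIntegral_mono_on hi hintg hW fun x hx => ?_
        rw [FB_exp B g hT]
        simp only [← hsdef]
        have hp : 0 ≤ (s / t) ^ B := by positivity
        by_cases hx2 : ‖g x - w‖ < t
        · rw [Set.indicator_of_mem (show x ∈ {x | ‖g x - w‖ < t} from hx2)]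
          have : (s / (‖g x - w‖ + s)) ^ B ≤ 1 := by
            refine Real.rpow_le_one (by positivity) ?_ hB.le
            rw [div_le_one (by positivity)]; linarith [norm_nonneg (g x - w)]
          linarith
        · rw [Set.indicator_of_notMem (show x ∉ {x | ‖g x - w‖ < t} from hx2), zero_add]
          push Not at hx2
          refine Real.rpow_le_rpow (by positivity) ?_ hB.le
          gcongr; linarith
    _ = _ := by
        rw [integral_add ((integrable_const (1:ℝ)).indicator hm') (integrable_const _), integral_indicator hm', setIntegral_const, setIntegral_const]
        rw [smul_eq_mul, smul_eq_mul, mul_one, measureReal_restrict_apply hm']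
        unfold Vol
        congr 2
        ext x; exact and_comm

/-- main consequence of RP -/
lemma VRcore (n : ℕ) (g : (Fin n → ℂ) → ℂ) (hg : ContDiffAt ℂ 1 g 0) (hgm : Measurable g) (hg0 : g 0 = 0) (U : Set (Fin n → ℂ)) (hU : U ∈ 𝓝 0) :
    ∃ W ∈ 𝓝 (0 : Fin n → ℂ), ∃ ε > 0, MeasurableSet W ∧ volume W < ⊤ ∧ W ⊆ U ∧ ∃ M0 > 0,
      (∀ B > 0, ∀ T ≥ (1:ℝ), ∀ w ∈ Metric.ball (0:ℂ) ε, IntegrableOn (fun x => Real.exp (T * FB B g T (x, w))) W ∧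
        0 < ∫ x in W, Real.exp (T * FB B g T (x, w))) ∧
      ∀ B > 0, AUC (Metric.ball (0:ℂ) ε) (fun (_ : Unit) T w => lg M0 T w)
        (fun T w => (1/T) * Real.log (∫ x in W, Real.exp (T * FB B g T (x, w)))) := by
  have hc : ContDiffAt ℂ 1 (fun q : (Fin n → ℂ) × ℂ => g q.1 - q.2) 0 := by
    refine ContDiffAt.sub ?_ contDiffAt_snd
    exact ContDiffAt.comp (0 : (Fin n → ℂ) × ℂ) (g := g) (f := Prod.fst) hg contDiffAt_fst
  have hcont : ContinuousAt (fun q : (Fin n → ℂ) × ℂ => g q.1 - q.2) 0 := hc.continuousAt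
  have hN1 : ∀ᶠ q in 𝓝 (0 : (Fin n → ℂ) × ℂ), ‖g q.1 - q.2‖ < 1 := by
    have : Filter.Tendsto (fun q : (Fin n → ℂ) × ℂ => ‖g q.1 - q.2‖) (𝓝 0) (𝓝 0) := by
      have := hcont.norm
      unfold ContinuousAt at this
      simpa [hg0] using this
    exact this.eventually_lt_const (by norm_num)
  have hN2 : ∀ᶠ q in 𝓝 (0 : (Fin n → ℂ) × ℂ), q.1 ∈ U :=
    (continuous_fst.tendsto' (0 : (Fin n → ℂ) × ℂ) 0 rfl) hU
  obtain ⟨W, hW, ε, hε, hWm, hWt, hsub, hall⟩ := RP_all n Unit (fun _ q => g q.1 - q.2) (fun _ => hc) _ (hN1.and hN2)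
  obtain ⟨M0, hM0, hF⟩ := hall 1 one_pos
  refine ⟨W, hW, ε, hε, hWm, hWt, fun x hx => (hsub (show (x, (0:ℂ)) ∈ W ×ˢ Metric.ball 0 ε from ⟨hx, Metric.mem_ball_self hε⟩)).2, M0, hM0, ?_, ?_⟩
  · intro B hB T hT w hw
    have hpos : 0 < volume.real W := ENNReal.toReal_pos (Measure.measure_pos_of_mem_nhds _ hW).ne' hWt.ne
    have := log_int_bd volume W hWm hpos hWt (fun x => FB B g T (x, w)) ((FB_meas B g hgm T).comp (by fun_prop)) (2 * B) T (by linarith)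
      (fun x hx => FB_bd B hB g hT (x, w) (hsub (show (x, w) ∈ W ×ˢ Metric.ball 0 ε from ⟨hx, hw⟩)).1.le)
    exact ⟨this.1, this.2.1⟩
  · intro B hB
    refine hF (FB B g) (fun T => FB_meas B g hgm T) ⟨2 * B, 1, fun T hT q hq => FB_bd B hB g hT q (hsub hq).1.le⟩ ?_
    intro η hη
    refine ⟨η / B, by positivity, 1, one_pos, fun T hT S hS x hx y hy h => ?_⟩
    have h1 := (abs_le.1 (h ())).2
    simp only at h1
    rw [le_div_iff₀ hB] at h1
    unfold FB
    nlinarith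

end Kuw

namespace Kuw
open Topology

lemma VR (n : ℕ) (g : (Fin n → ℂ) → ℂ) (hg : ContDiffAt ℂ 1 g 0) (hgm : Measurable g) (hg0 : g 0 = 0) (U : Set (Fin n → ℂ)) (hU : U ∈ 𝓝 0) :
    ∃ W ∈ 𝓝 (0 : Fin n → ℂ), ∃ ε > 0, MeasurableSet W ∧ volume W < ⊤ ∧ W ⊆ U ∧
      (∀ η : ℝ, 0 < η → η < 1 → ∃ s0 > (0:ℝ), ∀ s, 0 < s → s < s0 → ∀ w ∈ Metric.ball (0:ℂ) ε, ∀ w' ∈ Metric.ball (0:ℂ) ε,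
        ‖w‖ / 2 ≤ ‖w'‖ → ‖w'‖ ≤ ‖w‖ → Vol W g s w ≤ s ^ (-η) * (Vol W g (s ^ (1 - η)) w' + s ^ (2:ℝ))) ∧
      (∀ β : ℝ, 0 < β → (∃ s0 > (0:ℝ), ∀ s, 0 < s → s < s0 → Vol W g s 0 ≤ s ^ (2 * β)) ∨
        ∀ η : ℝ, 0 < η → ∃ t0 > (0:ℝ), ∀ t, 0 < t → t < t0 → t ^ (2 * β + η) ≤ Vol W g t 0) := by
  obtain ⟨W, hW, ε, hε, hWm, hWt, hWU, M0, hM0, hJ, hA⟩ := VRcore n g hg hgm hg0 U hU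
  have hv0 : 0 ≤ volume.real W := measureReal_nonneg
  refine ⟨W, hW, ε, hε, hWm, hWt, hWU, ?_, ?_⟩
  · intro η hη hη1
    set B := 3 / η with hBdef
    have hB : 0 < B := by positivity
    obtain ⟨δ, hδ, T0, hT0, hAUC⟩ := hA B hB (η / 2) (by positivity)
    set T1 := 1 + T0 + Real.log 2 / δ + B * Real.log 2 / (η / 2) + volume.real W with hT1
    have l2 : 0 < Real.log 2 := Real.log_pos (by norm_num)
    have q1 : 0 < Real.log 2 / δ := by positivity
    have q2 : 0 < B * Real.log 2 / (η / 2) := by positivity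
    refine ⟨Real.exp (-T1), Real.exp_pos _, fun s hs hs1 w hw w' hw' h1 h2 => ?_⟩
    obtain ⟨T, rfl⟩ : ∃ T, s = Real.exp (-T) := ⟨-Real.log s, by rw [neg_neg, Real.exp_log hs]⟩
    rw [Real.exp_lt_exp] at hs1
    have hT : T1 < T := by linarith
    have hTpos : 0 < T := by linarith
    have hJw := hJ B hB T (by linarith) w hw
    have hJw' := hJ B hB T (by linarith) w' hw'
    have hdiff : |lg M0 T w - lg M0 T w'| ≤ δ := by
      unfold lg
      set e := Real.exp (-(M0 * T)) with he
      have hepos : 0 < e := Real.exp_pos _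
      have a1 : Real.log (‖w'‖ + e) ≤ Real.log (‖w‖ + e) := Real.log_le_log (by positivity) (by linarith)
      have a2 : Real.log (‖w‖ + e) ≤ Real.log 2 + Real.log (‖w'‖ + e) := by
        rw [← Real.log_mul (by norm_num) (by positivity)]
        exact Real.log_le_log (by positivity) (by linarith)
      have : Real.log 2 / δ < T := by linarith
      rw [div_lt_iff₀ hδ] at this
      rw [← sub_div, abs_div, abs_of_pos hTpos, div_le_iff₀ hTpos, abs_le]
      constructor <;> linarith
    have key := hAUC T (by linarith) T (by linarith) w hw w' hw' (fun _ => hdiff)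
    simp only at key
    have j1 := J1 W hWm g hgm B hB hTpos w hJw.1 hWt
    have j2 := J2 W hWm g hgm B hB hTpos w' hJw'.1 hWt (Real.exp (-T) ^ (1 - η)) (by positivity)
    set Jw := ∫ x in W, Real.exp (T * FB B g T (x, w)) with hJwd
    set Jw' := ∫ x in W, Real.exp (T * FB B g T (x, w')) with hJwd'
    have k1 : Real.log Jw ≤ Real.log Jw' + η / 2 * T := by
      have := mul_le_mul_of_nonneg_left key hTpos.le
      have e1 : T * (1 / T * Real.log Jw) = Real.log Jw := by field_simp
      have e2 : T * (1 / T * Real.log Jw' + η / 2) = Real.log Jw' + η / 2 * T := by field_simp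
      rw [e1, e2] at this; exact this
    have k2 : Jw ≤ Jw' * Real.exp (η / 2 * T) := by
      have := Real.exp_le_exp.2 k1
      rwa [Real.exp_add, Real.exp_log hJw.2, Real.exp_log hJw'.2] at this
    have k3 : (2:ℝ) ^ B ≤ Real.exp (η / 2 * T) := by
      rw [Real.rpow_def_of_pos (by norm_num), Real.exp_le_exp]
      have : B * Real.log 2 / (η / 2) < T := by linarith
      rw [div_lt_iff₀ (by positivity)] at this
      linarith
    have k4 : Real.exp (-T) ^ (-η) = Real.exp (η / 2 * T) * Real.exp (η / 2 * T) := by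
      rw [← Real.exp_mul, ← Real.exp_add]; congr 1; ring
    have k5 : volume.real W * (Real.exp (-T) / Real.exp (-T) ^ (1 - η)) ^ B ≤ Real.exp (-T) ^ (2:ℝ) := by
      have e1 : (Real.exp (-T) / Real.exp (-T) ^ (1 - η)) ^ B = Real.exp (-T) * Real.exp (-T) ^ (2:ℝ) := by
        rw [← Real.exp_mul, ← Real.exp_mul, ← Real.exp_sub, ← Real.exp_mul, ← Real.exp_add]
        congr 1
        rw [hBdef]; field_simp; ring
      rw [e1, ← mul_assoc]
      refine mul_le_of_le_one_left (by positivity) ?_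
      rw [Real.exp_neg, ← div_eq_mul_inv, div_le_one (Real.exp_pos _)]
      linarith [Real.add_one_le_exp T]
    rw [k4]
    calc _ ≤ 2 ^ B * Jw := j1
      _ ≤ Real.exp (η / 2 * T) * (Jw' * Real.exp (η / 2 * T)) := mul_le_mul k3 k2 hJw.2.le (Real.exp_pos _).le
      _ = Real.exp (η / 2 * T) * Real.exp (η / 2 * T) * Jw' := by ring
      _ ≤ _ := mul_le_mul_of_nonneg_left (by linarith) (by positivity)
  · intro β hβ
    by_cases hcase : ∃ s0 > (0:ℝ), ∀ s, 0 < s → s < s0 → Vol W g s 0 ≤ s ^ (2 * β)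
    · exact Or.inl hcase
    right
    push Not at hcase
    intro η hη
    set θ := (2 * β + η / 2) / (2 * β + η) with hθ
    have hθ0 : 0 < θ := by positivity
    have hθ1 : θ < 1 := by rw [hθ, div_lt_one (by positivity)]; linarith
    set B := (2 * β + η) / (1 - θ) with hBdef
    have hθ2 : 0 < 1 - θ := by linarith
    have hB : 0 < B := by positivity
    obtain ⟨δ, hδ, T0, hT0, hAUC⟩ := hA B hB (η / 6) (by positivity)
    set T1 := 1 + T0 + 6 * volume.real W / η with hT1
    have q3 : 0 ≤ 6 * volume.real W / η := by positivity
    have l2 : 0 < Real.log 2 := Real.log_pos (by norm_num)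
    have q2 : 0 < B * Real.log 2 / (η / 6) := by positivity
    have hb0 : (0:ℂ) ∈ Metric.ball (0:ℂ) ε := Metric.mem_ball_self hε
    refine ⟨Real.exp (-(θ * T1)), Real.exp_pos _, fun t ht ht1 => ?_⟩
    obtain ⟨S, rfl⟩ : ∃ S, t = Real.exp (-(θ * S)) := ⟨-Real.log t / θ, by
      rw [mul_div_cancel₀ _ hθ0.ne', neg_neg, Real.exp_log ht]⟩
    rw [Real.exp_lt_exp] at ht1
    have hS : T1 < S := by
      have : θ * T1 < θ * S := by linarith
      exact lt_of_mul_lt_mul_left this hθ0.le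
    have hSpos : 0 < S := by linarith
    obtain ⟨s, hs, hs1, hs2⟩ := hcase (Real.exp (-(1 + T0 + B * Real.log 2 / (η / 6)))) (Real.exp_pos _)
    obtain ⟨T, rfl⟩ : ∃ T, s = Real.exp (-T) := ⟨-Real.log s, by rw [neg_neg, Real.exp_log hs]⟩
    rw [Real.exp_lt_exp] at hs1
    have hT : 1 + T0 + B * Real.log 2 / (η / 6) < T := by linarith
    have hTpos : 0 < T := by linarith
    have hJT := hJ B hB T (by linarith) 0 hb0
    have hJS := hJ B hB S (by linarith) 0 hb0
    have key := hAUC T (by linarith) S (by linarith) 0 hb0 0 hb0 (fun _ => by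
      simp only
      rw [lg_zero M0 T hTpos, lg_zero M0 S hSpos, sub_self, abs_zero]; exact hδ.le)
    simp only at key
    have j1 := J1 W hWm g hgm B hB hTpos 0 hJT.1 hWt
    have j2 := J2 W hWm g hgm B hB hSpos 0 hJS.1 hWt (Real.exp (-(θ * S))) (by positivity)
    set JT := ∫ x in W, Real.exp (T * FB B g T (x, 0)) with hJTd
    set JS := ∫ x in W, Real.exp (S * FB B g S (x, 0)) with hJSd
    have k1 : -(2 * β + η / 6) ≤ 1 / T * Real.log JT := by
      have a1 : Real.exp (-T) ^ (2 * β) < 2 ^ B * JT := hs2.trans_le j1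
      have a2 := Real.log_lt_log (by positivity) a1
      rw [Real.log_mul (by positivity) hJT.2.ne', Real.log_rpow (show (0:ℝ) < 2 by norm_num), Real.log_rpow (Real.exp_pos _), Real.log_exp] at a2
      have a3 : B * Real.log 2 / (η / 6) < T := by linarith
      rw [div_lt_iff₀ (by positivity)] at a3
      rw [one_div, inv_mul_eq_div, le_div_iff₀ hTpos]
      linarith
    have k2 : -(2 * β + η / 3) * S ≤ Real.log JS := by
      have : -(2 * β + η / 3) ≤ 1 / S * Real.log JS := by linarith
      rwa [one_div, inv_mul_eq_div, le_div_iff₀ hSpos] at this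
    have k3 : Real.exp (-(2 * β + η / 3) * S) ≤ JS := by
      have := Real.exp_le_exp.2 k2
      rwa [Real.exp_log hJS.2] at this
    have k4 : (Real.exp (-S) / Real.exp (-(θ * S))) ^ B = Real.exp (-(2 * β + η) * S) := by
      rw [← Real.exp_sub, ← Real.exp_mul]; congr 1
      have : B * (1 - θ) = 2 * β + η := by rw [hBdef]; field_simp
      rw [← this]; ring
    have k5 : Real.exp (-(θ * S)) ^ (2 * β + η) = Real.exp (-(2 * β + η / 2) * S) := by
      rw [← Real.exp_mul]; congr 1
      have : θ * (2 * β + η) = 2 * β + η / 2 := by rw [hθ]; field_simp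
      rw [← this]; ring
    have k6 : Real.exp (-(2 * β + η) * S) ≤ Real.exp (-(2 * β + η / 2) * S) := by
      rw [Real.exp_le_exp]; nlinarith
    have k7 : (volume.real W + 1) * Real.exp (-(2 * β + η / 2) * S) ≤ Real.exp (-(2 * β + η / 3) * S) := by
      have e1 : Real.exp (-(2 * β + η / 3) * S) = Real.exp (η / 6 * S) * Real.exp (-(2 * β + η / 2) * S) := by
        rw [← Real.exp_add]; congr 1; ring
      rw [e1]
      refine mul_le_mul_of_nonneg_right ?_ (Real.exp_pos _).le
      have : 6 * volume.real W / η < S := by linarith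
      rw [div_lt_iff₀ hη] at this
      linarith [Real.add_one_le_exp (η / 6 * S)]
    rw [k4] at j2
    rw [k5]
    have k8 := mul_le_mul_of_nonneg_left k6 hv0
    linarith

end Kuw

namespace Kuw
open Topology

lemma Vol_ofReal {X : Type*} [MeasureSpace X] (W : Set X) (hWt : volume W < ⊤) (g : X → ℂ) (s : ℝ) (w : ℂ) :
    ENNReal.ofReal (Vol W g s w) = volume {x ∈ W | ‖g x - w‖ < s} := by
  unfold Vol
  exact ofReal_measureReal ((measure_mono (Set.sep_subset _ _)).trans_lt hWt).ne

lemma Vol_mono {X : Type*} [MeasureSpace X] (W : Set X) (hWt : volume W < ⊤) (g : X → ℂ) (s s' : ℝ) (w w' : ℂ)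
    (h : s + ‖w - w'‖ ≤ s') : Vol W g s w ≤ Vol W g s' w' := by
  unfold Vol
  refine measureReal_mono (fun x hx => ⟨hx.1, ?_⟩) ((measure_mono (Set.sep_subset _ _)).trans_lt hWt).ne
  have h1 := hx.2
  have : g x - w' = (g x - w) + (w - w') := by ring
  change ‖g x - w'‖ < s'
  rw [this]
  exact (norm_add_le _ _).trans_lt (by linarith)

lemma Vol_nonneg {X : Type*} [MeasureSpace X] (W : Set X) (g : X → ℂ) (s : ℝ) (w : ℂ) : 0 ≤ Vol W g s w := measureReal_nonneg

lemma FubA {X : Type*} [MeasureSpace X] [SFinite (volume : Measure X)] (W : Set X) (hW : MeasurableSet W) (hWt : volume W < ⊤) (g : X → ℂ) (hg : Measurable g)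
    (V0 s ρ R : ℝ) (a : ℂ) (hρ : 0 < ρ) (hs : 0 < s) (hR : ∀ w ∈ Metric.ball a ρ, ‖w‖ ≤ R) (hV0 : 0 ≤ V0)
    (h : ∀ w ∈ Metric.ball a ρ, V0 ≤ Vol W g s w) : V0 * ρ ^ 2 ≤ s ^ 2 * Vol W g (R + s) 0 := by
  set Z : Set (X × ℂ) := {q | q.1 ∈ W ∧ ‖g q.1 - q.2‖ < s ∧ q.2 ∈ Metric.ball a ρ} with hZ
  have hZm : MeasurableSet Z := by
    have e1 : MeasurableSet {q : X × ℂ | q.1 ∈ W} := measurable_fst hW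
    have e2 : MeasurableSet {q : X × ℂ | ‖g q.1 - q.2‖ < s} := measurableSet_lt ((hg.comp measurable_fst).sub measurable_snd).norm measurable_const
    have e3 : MeasurableSet {q : X × ℂ | q.2 ∈ Metric.ball a ρ} := measurable_snd measurableSet_ball
    exact e1.inter (e2.inter e3)
  have lower : ENNReal.ofReal V0 * volume (Metric.ball a ρ) ≤ (volume.prod volume) Z := by
    rw [Measure.prod_apply_symm hZm, ← setLIntegral_const]
    refine (setLIntegral_mono' measurableSet_ball fun w hw => ?_).trans (setLIntegral_le_lintegral _ _)
    refine (ENNReal.ofReal_le_ofReal (h w hw)).trans ?_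
    rw [Vol_ofReal W hWt]
    exact measure_mono fun x hx => ⟨hx.1, hx.2, hw⟩
  have upper : (volume.prod volume) Z ≤ (ENNReal.ofReal s ^ 2 * NNReal.pi) * volume {x ∈ W | ‖g x - 0‖ < R + s} := by
    rw [Measure.prod_apply hZm, ← setLIntegral_const]
    have hm : MeasurableSet {x ∈ W | ‖g x - 0‖ < R + s} :=
      hW.inter (measurableSet_lt (hg.sub_const 0).norm measurable_const : MeasurableSet {x | ‖g x - 0‖ < R + s})
    rw [← lintegral_indicator hm]
    refine lintegral_mono fun x => ?_
    by_cases hx : x ∈ {x ∈ W | ‖g x - 0‖ < R + s}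
    · rw [Set.indicator_of_mem hx, ← Complex.volume_ball (g x) s]
      refine measure_mono fun w hw => ?_
      have := hw.2.1
      rw [Metric.mem_ball, dist_comm, dist_eq_norm]; exact this
    · rw [Set.indicator_of_notMem hx]
      have : Prod.mk x ⁻¹' Z = ∅ := by
        rw [Set.eq_empty_iff_forall_notMem]
        intro w hw
        refine hx ⟨hw.1, ?_⟩
        have h1 : ‖g x - w‖ < s := hw.2.1
        have h2 := hR w hw.2.2
        have e : g x - 0 = (g x - w) + w := by ring
        rw [e]
        exact (norm_add_le _ _).trans_lt (by linarith)
      rw [this]; simp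
  have h1 := lower.trans upper
  rw [Complex.volume_ball, ← Vol_ofReal W hWt] at h1
  have hpi : (NNReal.pi : ENNReal) = ENNReal.ofReal Real.pi := by
    rw [← NNReal.coe_real_pi, ENNReal.ofReal_coe_nnreal]
  rw [hpi, ← ENNReal.ofReal_pow hρ.le, ← ENNReal.ofReal_pow hs.le, ← ENNReal.ofReal_mul (by positivity), ← ENNReal.ofReal_mul hV0, ← ENNReal.ofReal_mul (by positivity),
    ← ENNReal.ofReal_mul (by positivity),
    ENNReal.ofReal_le_ofReal_iff (by have := Vol_nonneg W g (R + s) 0; positivity)] at h1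
  have h2 : Real.pi * (V0 * ρ ^ 2) ≤ Real.pi * (s ^ 2 * Vol W g (R + s) 0) := by linarith
  exact le_of_mul_le_mul_left h2 Real.pi_pos

lemma D1 {X : Type*} [MeasureSpace X] [SFinite (volume : Measure X)] (W : Set X) (hW : MeasurableSet W) (hWt : volume W < ⊤) (g : X → ℂ) (hg : Measurable g)
    (ε : ℝ) (hi : ∀ η : ℝ, 0 < η → η < 1 → ∃ s0 > (0:ℝ), ∀ s, 0 < s → s < s0 → ∀ w ∈ Metric.ball (0:ℂ) ε, ∀ w' ∈ Metric.ball (0:ℂ) ε,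
        ‖w‖ / 2 ≤ ‖w'‖ → ‖w'‖ ≤ ‖w‖ → Vol W g s w ≤ s ^ (-η) * (Vol W g (s ^ (1 - η)) w' + s ^ (2:ℝ)))
    (K c1 c : ℝ) (hK : 0 ≤ K) (hc1 : 0 ≤ c1) (hc : 0 < c) (hcc : c1 ≤ c) (hclt : c < 1)
    (hVK : ∀ r > 0, Vol W g r 0 ≤ K * r ^ (2 * c1)) (η : ℝ) (hη : 0 < η) (hη1 : η < 1) :
    ∃ s0 > (0:ℝ), ∃ C ≥ 0, ∀ s, 0 < s → s < s0 → ∀ w : ℂ, w ≠ 0 → ‖w‖ < ε → ‖w‖ ≤ 1 →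
      Vol W g s w ≤ C * s ^ (2 * c - 3 * η) * ‖w‖ ^ (-(2 * (c - c1))) := by
  obtain ⟨s0, hs0, hi⟩ := hi η hη hη1
  set K' := K * 2 ^ (2 * c1) with hK'
  have hK'0 : 0 ≤ K' := by positivity
  have hV2 : ∀ r > 0, Vol W g (2 * r) 0 ≤ K' * r ^ (2 * c1) := fun r hr => by
    have := hVK (2 * r) (by positivity)
    rwa [Real.mul_rpow (by norm_num) hr.le, ← mul_assoc] at this
  refine ⟨min s0 1, by positivity, 16 * K' + 1, by positivity, fun s hs hs1 w hw hwε hw1 => ?_⟩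
  have hss0 : s < s0 := hs1.trans_le (min_le_left _ _)
  have hs1 : s < 1 := hs1.trans_le (min_le_right _ _)
  have hwpos : 0 < ‖w‖ := norm_pos_iff.2 hw
  set s' := s ^ (1 - η) with hs'
  have hs'0 : 0 < s' := by positivity
  have hss' : s ≤ s' := by
    conv_lhs => rw [← Real.rpow_one s]
    exact Real.rpow_le_rpow_of_exponent_ge hs hs1.le (by linarith)
  set P := ‖w‖ ^ (-(2 * (c - c1))) with hP
  have hP1 : 1 ≤ P := Real.one_le_rpow_of_pos_of_le_one_of_nonpos hwpos hw1 (by linarith)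
  have hs'c : s' ^ (2 * c) ≤ s ^ (2 * c - 2 * η) := by
    rw [hs', ← Real.rpow_mul hs.le]
    exact Real.rpow_le_rpow_of_exponent_ge hs hs1.le (by nlinarith)
  have hsη : s ^ (2 * c - 2 * η) * s ^ (-η) = s ^ (2 * c - 3 * η) := by
    rw [← Real.rpow_add hs]; congr 1; ring
  have hQ : 0 ≤ s ^ (2 * c - 3 * η) := by positivity
  rcases le_or_gt s' ‖w‖ with hcase | hcase
  · have hfub := FubA W hW hWt g hg (Vol W g s w * s ^ η - s ^ (2:ℝ)) s' (‖w‖ / 4) ‖w‖ ((3 / 4 : ℝ) * w) (by positivity) hs'0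
    have hnormball : ∀ w' ∈ Metric.ball ((3 / 4 : ℝ) * w) (‖w‖ / 4), ‖w'‖ ≤ ‖w‖ ∧ ‖w‖ / 2 ≤ ‖w'‖ := by
      intro w' hw'
      rw [Metric.mem_ball, dist_eq_norm] at hw'
      have e : ‖((3 / 4 : ℝ) : ℂ) * w‖ = 3 / 4 * ‖w‖ := by rw [norm_mul, Complex.norm_real]; norm_num
      have a1 := norm_sub_norm_le w' (((3 / 4 : ℝ) : ℂ) * w)
      have a2 := norm_sub_norm_le (((3 / 4 : ℝ) : ℂ) * w) w'
      rw [norm_sub_rev] at a2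
      rw [e] at a1 a2
      constructor <;> linarith
    have hb : ∀ w' ∈ Metric.ball ((3 / 4 : ℝ) * w) (‖w‖ / 4), Vol W g s w * s ^ η - s ^ (2:ℝ) ≤ Vol W g s' w' := by
      intro w' hw'
      have hn := hnormball w' hw'
      have := hi s hs hss0 w (by simpa using hwε) w' (by simpa using hn.1.trans_lt hwε) hn.2 hn.1
      rw [Real.rpow_neg hs.le, inv_mul_eq_div, le_div_iff₀ (by positivity)] at this
      linarith
    have hmain : Vol W g s w * s ^ η - s ^ (2:ℝ) ≤ 16 * K' * (s ^ (2 * c - 2 * η) * P) := by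
      by_cases hneg : 0 ≤ Vol W g s w * s ^ η - s ^ (2:ℝ)
      · have h1 := hfub (fun w' hw' => (hnormball w' hw').1) hneg hb
        have h2 : Vol W g (‖w‖ + s') 0 ≤ K' * ‖w‖ ^ (2 * c1) :=
          (Vol_mono W hWt g _ (2 * ‖w‖) 0 0 (by rw [sub_self, norm_zero]; linarith)).trans (hV2 _ hwpos)
        set V0 := Vol W g s w * s ^ η - s ^ (2:ℝ)
        have h3 : V0 * ‖w‖ ^ 2 ≤ 16 * (s' ^ 2 * (K' * ‖w‖ ^ (2 * c1))) := by
          have := mul_le_mul_of_nonneg_left h2 (sq_nonneg s')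
          nlinarith
        have h4 : s' ^ 2 * ‖w‖ ^ (2 * c1) ≤ s' ^ (2 * c) * P * ‖w‖ ^ 2 := by
          have e1 : s' ^ 2 = s' ^ (2 * c) * s' ^ (2 - 2 * c) := by
            rw [← Real.rpow_add hs'0, ← Real.rpow_natCast]; congr 1; push_cast; ring
          have e2 : ‖w‖ ^ (2 * c1) * ‖w‖ ^ (2 - 2 * c) = P * ‖w‖ ^ 2 := by
            rw [hP, ← Real.rpow_natCast, ← Real.rpow_add hwpos, ← Real.rpow_add hwpos]; congr 1; push_cast; ring
          have e3 : s' ^ (2 - 2 * c) ≤ ‖w‖ ^ (2 - 2 * c) := Real.rpow_le_rpow hs'0.le hcase (by linarith)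
          calc _ = s' ^ (2 * c) * (‖w‖ ^ (2 * c1) * s' ^ (2 - 2 * c)) := by rw [e1]; ring
            _ ≤ s' ^ (2 * c) * (‖w‖ ^ (2 * c1) * ‖w‖ ^ (2 - 2 * c)) := by gcongr
            _ = _ := by rw [e2]; ring
        have h5 : V0 * ‖w‖ ^ 2 ≤ (16 * K' * (s' ^ (2 * c) * P)) * ‖w‖ ^ 2 := by
          have := mul_le_mul_of_nonneg_left h4 hK'0
          nlinarith
        have h6 := le_of_mul_le_mul_right h5 (by positivity)
        refine h6.trans ?_
        gcongr
      · push Not at hneg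
        refine hneg.le.trans ?_
        positivity
    have h7 : Vol W g s w ≤ (16 * K' * (s ^ (2 * c - 2 * η) * P) + s ^ (2:ℝ)) * s ^ (-η) := by
      rw [Real.rpow_neg hs.le, ← div_eq_mul_inv, le_div_iff₀ (by positivity)]
      linarith
    have h8 : s ^ (2:ℝ) * s ^ (-η) ≤ s ^ (2 * c - 3 * η) := by
      rw [← Real.rpow_add hs]
      exact Real.rpow_le_rpow_of_exponent_ge hs hs1.le (by linarith)
    calc _ ≤ _ := h7
      _ = 16 * K' * (s ^ (2 * c - 2 * η) * s ^ (-η)) * P + s ^ (2:ℝ) * s ^ (-η) := by ring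
      _ ≤ 16 * K' * s ^ (2 * c - 3 * η) * P + s ^ (2 * c - 3 * η) * P := by
          rw [hsη]
          have := mul_le_mul_of_nonneg_left hP1 hQ
          linarith
      _ = _ := by ring
  · have h1 : Vol W g s w ≤ K' * s' ^ (2 * c1) :=
      (Vol_mono W hWt g s (2 * s') w 0 (by rw [sub_zero]; linarith)).trans (hV2 _ hs'0)
    have h2 : s' ^ (2 * c1) ≤ s' ^ (2 * c) * P := by
      have e1 : s' ^ (2 * c1) = s' ^ (2 * c) * s' ^ (-(2 * (c - c1))) := by
        rw [← Real.rpow_add hs'0]; congr 1; ring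
      rw [e1]
      have : s' ^ (-(2 * (c - c1))) ≤ P := Real.rpow_le_rpow_of_nonpos hwpos hcase.le (by linarith)
      gcongr
    have h3 : s ^ (2 * c - 2 * η) ≤ s ^ (2 * c - 3 * η) := Real.rpow_le_rpow_of_exponent_ge hs hs1.le (by linarith)
    have h4 : s' ^ (2 * c1) ≤ s ^ (2 * c - 3 * η) * P := h2.trans (by gcongr; exact hs'c.trans h3)
    have h5 : 0 ≤ s ^ (2 * c - 3 * η) * P := by positivity
    calc _ ≤ K' * s' ^ (2 * c1) := h1
      _ ≤ K' * (s ^ (2 * c - 3 * η) * P) := by gcongr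
      _ ≤ (16 * K' + 1) * (s ^ (2 * c - 3 * η) * P) := mul_le_mul_of_nonneg_right (by linarith) h5
      _ = _ := by ring

lemma D2 {X Y : Type*} [MeasureSpace X] [SFinite (volume : Measure X)] [MeasureSpace Y] [SFinite (volume : Measure Y)]
    (W : Set X) (hW : MeasurableSet W) (hWt : volume W < ⊤) (g : X → ℂ) (hg : Measurable g)
    (W' : Set Y) (hW' : MeasurableSet W') (h : Y → ℂ) (hh : Measurable h) (C e c2 s : ℝ) (hC : 0 ≤ C) (hs : 0 < s)
    (hi : IntegrableOn (fun y => ‖h y‖ ^ (-(2 * c2))) W')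
    (hb : ∀ᵐ y, y ∈ W' → Vol W g s (-h y) ≤ C * s ^ e * ‖h y‖ ^ (-(2 * c2))) :
    volume.real {q ∈ W ×ˢ W' | ‖g q.1 + h q.2‖ < s} ≤ (C * ∫ y in W', ‖h y‖ ^ (-(2 * c2))) * s ^ e := by
  set Z := {q ∈ W ×ˢ W' | ‖g q.1 + h q.2‖ < s} with hZ
  have hZm : MeasurableSet Z :=
    (hW.prod hW').inter (measurableSet_lt ((hg.comp measurable_fst).add (hh.comp measurable_snd)).norm measurable_const :
      MeasurableSet {q : X × Y | ‖g q.1 + h q.2‖ < s})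
  have hint0 : 0 ≤ ∫ y in W', ‖h y‖ ^ (-(2 * c2)) := integral_nonneg fun y => by positivity
  have hR : 0 ≤ (C * ∫ y in W', ‖h y‖ ^ (-(2 * c2))) * s ^ e := by positivity
  refine ENNReal.toReal_le_of_le_ofReal hR ?_
  rw [Measure.volume_eq_prod, Measure.prod_apply_symm hZm]
  have e1 : (C * ∫ y in W', ‖h y‖ ^ (-(2 * c2))) * s ^ e = ∫ y in W', C * s ^ e * ‖h y‖ ^ (-(2 * c2)) := by
    rw [integral_const_mul]; ring
  rw [e1, ofReal_integral_eq_lintegral_ofReal (hi.const_mul _) (Filter.Eventually.of_forall fun y => by positivity),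
    ← lintegral_indicator hW']
  refine lintegral_mono_ae ?_
  filter_upwards [hb] with y hy
  by_cases hyW : y ∈ W'
  · rw [Set.indicator_of_mem hyW]
    refine le_trans ?_ (ENNReal.ofReal_le_ofReal (hy hyW))
    rw [Vol_ofReal W hWt]
    refine measure_mono fun x hx => ⟨hx.1.1, ?_⟩
    have : ‖g x + h y‖ < s := hx.2
    rwa [sub_neg_eq_add]
  · have : (fun x => (x, y)) ⁻¹' Z = ∅ := by
      rw [Set.eq_empty_iff_forall_notMem]
      intro x hx
      exact hyW hx.1.2
    rw [this]; simp

end Kuw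

namespace Kuw
open Topology

lemma pol_fact (d : ℕ) (p : Fin d → ℂ) : ∃ ρ : Fin d → ℂ, ∀ z, pol d p z = ∏ j, (z - ρ j) := by
  obtain ⟨ρ, hρ⟩ := monic_roots d (polP d p) (polP_monic d p) (polP_natDegree d p)
  refine ⟨ρ, fun z => ?_⟩
  rw [← polP_eval, hρ, Polynomial.eval_prod]
  simp

lemma LB1 (n : ℕ) (h : (Fin (n+1) → ℂ) → ℂ) (hhm : Measurable h) (hh0 : h 0 = 0)
    (U : Set (Fin (n+1) → ℂ)) (hU : U ∈ 𝓝 0) (L : ((Fin n → ℂ) × ℂ) ≃L[ℂ] (Fin (n+1) → ℂ)) (d : ℕ)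
    (p : (Fin n → ℂ) × ℂ → Fin d → ℂ) (C : ℝ) (hC : 1 ≤ C) (hp : ContinuousAt p 0) (hp0 : p 0 = 0)
    (hq : ∀ᶠ q in 𝓝 (0 : ((Fin n → ℂ) × ℂ) × ℂ), ‖h (L (q.1.1, q.2)) - q.1.2‖ ≤ C * ‖pol d (p q.1) q.2‖ ∧
      ‖pol d (p q.1) q.2‖ ≤ C * ‖h (L (q.1.1, q.2)) - q.1.2‖) :
    ∃ W ∈ 𝓝 (0 : Fin (n+1) → ℂ), MeasurableSet W ∧ volume W < ⊤ ∧ W ⊆ U ∧ ∃ ε > (0:ℝ), ∃ c0 > (0:ℝ), ∃ s1 > (0:ℝ),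
      ∀ w : ℂ, ‖w‖ < ε → volume {y ∈ W | h y = w} = 0 ∧ ∀ s, 0 < s → s < s1 → c0 * s ^ 2 ≤ Vol W h s w := by
  have hCpos : 0 < C := by linarith
  have hd : d ≠ 0 := by
    rintro rfl
    have := hq.self_of_nhds.2
    simp [pol, hh0] at this
    have h2 : h (L ((0 : Fin n → ℂ), (0:ℂ))) = 0 := by
      have : ((0 : Fin n → ℂ), (0:ℂ)) = 0 := rfl
      rw [this, map_zero, hh0]
    rw [h2] at this
    norm_num at this
  obtain ⟨δ1, hδ1, hq⟩ := Metric.eventually_nhds_iff_ball.1 hq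
  have hLU : ∀ᶠ v in 𝓝 (0 : (Fin n → ℂ) × ℂ), L v ∈ U := (L.continuous.tendsto' 0 0 (map_zero L)) hU
  obtain ⟨δ2, hδ2, hLU⟩ := Metric.eventually_nhds_iff_ball.1 hLU
  set δ := min (min δ1 δ2) (1/2) with hδdef
  have hδ : 0 < δ := by positivity
  have hδ_1 : δ ≤ δ1 := (min_le_left _ _).trans (min_le_left _ _)
  have hδ_2 : δ ≤ δ2 := (min_le_left _ _).trans (min_le_right _ _)
  have hδ_3 : δ ≤ 1/2 := min_le_right _ _
  obtain ⟨ε', hε', hroot⟩ := root_small d (δ / 2) (by positivity) (by linarith)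
  have hpe : ∀ᶠ v in 𝓝 (0 : (Fin n → ℂ) × ℂ), ‖p v‖ < ε' := by
    have : Filter.Tendsto (fun v => ‖p v‖) (𝓝 0) (𝓝 0) := by
      have := hp.norm
      unfold ContinuousAt at this
      simpa [hp0] using this
    exact this.eventually_lt_const hε'
  obtain ⟨δ3, hδ3, hpe⟩ := Metric.eventually_nhds_iff_ball.1 hpe
  set ε := min δ δ3 with hε
  have hεpos : 0 < ε := by positivity
  have hεδ : ε ≤ δ := min_le_left _ _
  have hεδ3 : ε ≤ δ3 := min_le_right _ _
  set Bx : Set ((Fin n → ℂ) × ℂ) := Metric.ball 0 ε ×ˢ Metric.ball 0 δ with hBx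
  have hBxo : IsOpen Bx := Metric.isOpen_ball.prod Metric.isOpen_ball
  set W := L.symm ⁻¹' Bx with hWdef
  have hWo : IsOpen W := hBxo.preimage L.symm.continuous
  have h0W : (0 : Fin (n+1) → ℂ) ∈ W := by
    change L.symm 0 ∈ Bx
    rw [map_zero]
    exact ⟨Metric.mem_ball_self hεpos, Metric.mem_ball_self hδ⟩
  obtain ⟨κ, hκ, hmap⟩ := haar_scale L
  have hscale : ∀ A : Set (Fin (n+1) → ℂ), MeasurableSet A → volume (L ⁻¹' A) = κ * volume A := by
    intro A hA
    rw [← Measure.map_apply L.continuous.measurable hA, hmap]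
    simp
  have hpre : L ⁻¹' W = Bx := by ext v; simp [hWdef]
  have hvolx : volume (Metric.ball (0 : Fin n → ℂ) ε) < ⊤ := measure_ball_lt_top
  have hBxt : volume Bx < ⊤ := by
    rw [hBx, Measure.volume_eq_prod, Measure.prod_prod]
    exact ENNReal.mul_lt_top hvolx measure_ball_lt_top
  have hκE : (κ : ENNReal) ≠ 0 := by exact_mod_cast hκ.ne'
  have hWt : volume W < ⊤ := by
    have := hscale W hWo.measurableSet
    rw [hpre] at this
    rw [this] at hBxt
    by_contra hcon
    rw [not_lt, top_le_iff] at hcon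
    rw [hcon, ENNReal.mul_top hκE] at hBxt
    exact lt_irrefl _ hBxt
  -- facts on the box
  have fact : ∀ w : ℂ, ‖w‖ < ε → ∀ x ∈ Metric.ball (0 : Fin n → ℂ) ε, ∀ z ∈ Metric.ball (0:ℂ) δ,
      ‖h (L (x, z)) - w‖ ≤ C * ‖pol d (p (x, w)) z‖ ∧ ‖pol d (p (x, w)) z‖ ≤ C * ‖h (L (x, z)) - w‖ := by
    intro w hw x hx z hz
    refine hq ((x, w), z) ?_
    rw [mem_ball_zero_iff] at hx hz ⊢
    simp only [Prod.norm_def, max_lt_iff]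
    exact ⟨⟨by linarith, by linarith⟩, by linarith⟩
  have hpsmall : ∀ w : ℂ, ‖w‖ < ε → ∀ x ∈ Metric.ball (0 : Fin n → ℂ) ε, ∀ z, pol d (p (x, w)) z = 0 → ‖z‖ ≤ δ / 2 := by
    intro w hw x hx z hz
    refine hroot _ (fun i => ?_) z hz
    refine (norm_le_pi_norm _ i).trans (hpe (x, w) ?_).le
    rw [mem_ball_zero_iff] at hx ⊢
    simp only [Prod.norm_def, max_lt_iff]
    exact ⟨by linarith, by linarith⟩
  set vx := volume.real (Metric.ball (0 : Fin n → ℂ) ε) with hvx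
  have hvxpos : 0 < vx := ENNReal.toReal_pos (Metric.measure_ball_pos volume _ hεpos).ne' hvolx.ne
  refine ⟨W, hWo.mem_nhds h0W, hWo.measurableSet, hWt, ?_, ε, hεpos, vx * Real.pi / C ^ 2 / κ, by positivity, C * (δ / 2), by positivity, ?_⟩
  · intro y hy
    have hy : L.symm y ∈ Bx := hy
    have := hLU (L.symm y) (by
      rw [mem_ball_zero_iff, Prod.norm_def, max_lt_iff]
      have h1 := hy.1; have h2 := hy.2
      rw [mem_ball_zero_iff] at h1 h2
      exact ⟨by linarith, by linarith⟩)
    simpa using this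
  intro w hw
  constructor
  · have hAm : MeasurableSet {y ∈ W | h y = w} := hWo.measurableSet.inter (hhm (measurableSet_singleton w))
    have h1 := hscale _ hAm
    have h2 : volume (L ⁻¹' {y ∈ W | h y = w}) = 0 := by
      rw [Measure.volume_eq_prod, Measure.measure_prod_null (L.continuous.measurable hAm)]
      refine Filter.Eventually.of_forall fun x => ?_
      obtain ⟨ρ, hρ⟩ := pol_fact d (p (x, w))
      refine measure_mono_null ?_ ((Set.finite_range ρ).measure_zero volume)
      intro z hz
      have hz1 : (x, z) ∈ Bx := by rw [← hpre]; exact hz.1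
      have hz2 : h (L (x, z)) = w := hz.2
      have h3 := (fact w hw x hz1.1 z hz1.2).2
      rw [hz2, sub_self, norm_zero, mul_zero, hρ, norm_le_zero_iff, Finset.prod_eq_zero_iff] at h3
      obtain ⟨j, -, hj⟩ := h3
      exact ⟨j, (sub_eq_zero.1 hj).symm⟩
    rw [h2] at h1
    rcases mul_eq_zero.1 h1.symm with h4 | h4
    · exact absurd h4 hκE
    · exact h4
  · intro s hs hs1
    have hAm : MeasurableSet {y ∈ W | ‖h y - w‖ < s} := hWo.measurableSet.inter
      (measurableSet_lt (hhm.sub_const w).norm measurable_const : MeasurableSet {y | ‖h y - w‖ < s})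
    have h1 := hscale _ hAm
    set t := s / C with ht
    have htpos : 0 < t := by positivity
    have htδ : t < δ / 2 := by rw [ht, div_lt_iff₀ hCpos]; linarith
    have h2 : (ENNReal.ofReal t ^ 2 * NNReal.pi) * volume (Metric.ball (0 : Fin n → ℂ) ε) ≤ volume (L ⁻¹' {y ∈ W | ‖h y - w‖ < s}) := by
      rw [Measure.volume_eq_prod, Measure.prod_apply (L.continuous.measurable hAm), ← setLIntegral_const]
      refine (setLIntegral_mono' measurableSet_ball fun x hx => ?_).trans (setLIntegral_le_lintegral _ _)
      obtain ⟨ρ, hρ⟩ := pol_fact d (p (x, w))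
      have hρsmall : ∀ j, ‖ρ j‖ ≤ δ / 2 := fun j => hpsmall w hw x hx _ (by
        rw [hρ, Finset.prod_eq_zero (Finset.mem_univ j) (sub_self _)])
      obtain ⟨d', rfl⟩ := Nat.exists_eq_succ_of_ne_zero hd
      rw [← Complex.volume_ball (ρ 0) t]
      refine measure_mono fun z hz => ?_
      rw [Metric.mem_ball, dist_eq_norm] at hz
      have hznorm : ‖z‖ < δ := by
        have := norm_sub_norm_le z (ρ 0)
        linarith [hρsmall 0]
      have hzb : z ∈ Metric.ball (0:ℂ) δ := by rwa [mem_ball_zero_iff]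
      have h3 := (fact w hw x hx z hzb).1
      have h4 : ‖pol (d'+1) (p (x, w)) z‖ < t := by
        rw [hρ, Fin.prod_univ_succ, norm_mul]
        refine lt_of_le_of_lt ?_ hz
        refine mul_le_of_le_one_right (norm_nonneg _) ?_
        rw [norm_prod]
        refine Finset.prod_le_one (fun j _ => norm_nonneg _) fun j _ => ?_
        refine (norm_sub_le _ _).trans ?_
        linarith [hρsmall j.succ]
      refine ⟨?_, ?_⟩
      · change (x, z) ∈ L ⁻¹' W
        rw [hpre]; exact ⟨hx, hzb⟩
      · change ‖h (L (x, z)) - w‖ < s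
        refine h3.trans_lt ?_
        have : C * t = s := by rw [ht]; field_simp
        rw [← this]
        exact mul_lt_mul_of_pos_left h4 hCpos
    rw [h1, ← Vol_ofReal W hWt] at h2
    have hpi : (NNReal.pi : ENNReal) = ENNReal.ofReal Real.pi := by
      rw [← NNReal.coe_real_pi, ENNReal.ofReal_coe_nnreal]
    have hκ2 : (κ : ENNReal) = ENNReal.ofReal κ := by rw [ENNReal.ofReal_coe_nnreal]
    have hvx2 : volume (Metric.ball (0 : Fin n → ℂ) ε) = ENNReal.ofReal vx := (ofReal_measureReal hvolx.ne).symm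
    rw [hpi, hκ2, hvx2, ← ENNReal.ofReal_pow htpos.le, ← ENNReal.ofReal_mul (by positivity), ← ENNReal.ofReal_mul (by positivity),
      ← ENNReal.ofReal_mul (by positivity), ENNReal.ofReal_le_ofReal_iff (by have := Vol_nonneg W h s w; positivity)] at h2
    have hκr : (0:ℝ) < κ := hκ
    have : vx * Real.pi / C ^ 2 / κ * s ^ 2 = (t ^ 2 * Real.pi * vx) / κ := by rw [ht]; field_simp
    rw [this, div_le_iff₀ hκr]
    linarith

lemma LB (n : ℕ) (h : (Fin n → ℂ) → ℂ) (hh : ContDiffAt ℂ 1 h 0) (hhm : Measurable h) (hh0 : h 0 = 0) (hne : ¬ ∀ᶠ x in 𝓝 0, h x = 0)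
    (U : Set (Fin n → ℂ)) (hU : U ∈ 𝓝 0) :
    ∃ W ∈ 𝓝 (0 : Fin n → ℂ), MeasurableSet W ∧ volume W < ⊤ ∧ W ⊆ U ∧ ∃ ε > (0:ℝ), ∃ c0 > (0:ℝ), ∃ s1 > (0:ℝ),
      ∀ w : ℂ, ‖w‖ < ε → volume {y ∈ W | h y = w} = 0 ∧ ∀ s, 0 < s → s < s1 → c0 * s ^ 2 ≤ Vol W h s w := by
  rcases n with _ | n
  · exfalso
    refine hne (Filter.Eventually.of_forall fun x => ?_)
    rw [Subsingleton.elim x 0, hh0]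
  have hc : ContDiffAt ℂ 1 (fun q : (Fin (n+1) → ℂ) × ℂ => h q.1 - q.2) 0 := by
    refine ContDiffAt.sub ?_ contDiffAt_snd
    exact ContDiffAt.comp (0 : (Fin (n+1) → ℂ) × ℂ) (g := h) (f := Prod.fst) hh contDiffAt_fst
  obtain ⟨L, D, sc, p, C, hC, -, hp, hp0, -, hsc, hq⟩ := SP n (Λ := Unit) (fun _ q => h q.1 - q.2) (fun _ => hc)
  have hsc1 := hsc () (by simpa using hne)
  have hq := hq ()
  simp only [hsc1, one_mul] at hq
  exact LB1 n h hhm hh0 U hU ((ContinuousLinearEquiv.prodComm ℂ (Fin n → ℂ) ℂ).trans L) (D ()) (p ()) C hC (hp ()).continuousAt (hp0 ()) hq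

end Kuw

namespace Kuw
open Topology

lemma pow_contra (c0 K a b s1 : ℝ) (hc0 : 0 < c0) (hab : a < b) (hs1 : 0 < s1)
    (h : ∀ s, 0 < s → s < s1 → c0 * s ^ a ≤ K * s ^ b) : False := by
  have h1 : Filter.Tendsto (fun s : ℝ => K * s ^ (b - a)) (𝓝[>] 0) (𝓝 0) := by
    have h2 : ContinuousAt (fun s : ℝ => K * s ^ (b - a)) 0 :=
      continuousAt_const.mul (Real.continuousAt_rpow_const 0 (b - a) (Or.inr (by linarith)))
    have h3 := h2.tendsto
    rw [Real.zero_rpow (by linarith), mul_zero] at h3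
    exact h3.mono_left nhdsWithin_le_nhds
  have h2 : ∀ᶠ s in 𝓝[>] (0:ℝ), c0 ≤ K * s ^ (b - a) := by
    filter_upwards [Ioo_mem_nhdsGT hs1] with s hs
    have h3 := h s hs.1 hs.2
    have e : s ^ b = s ^ (b - a) * s ^ a := by rw [← Real.rpow_add hs.1]; congr 1; ring
    rw [e, ← mul_assoc] at h3
    exact le_of_mul_le_mul_right h3 (Real.rpow_pos_of_pos hs.1 _)
  exact absurd (ge_of_tendsto h1 h2) (not_le.2 hc0)

lemma SS_nonneg {E : Type*} [NormedAddCommGroup E] [MeasureSpace E] (f : E → ℂ) : 0 ≤ sSup (SS f) :=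
  Real.sSup_nonneg fun _ hx => hx.1.le

lemma SS_zero {E : Type*} [NormedAddCommGroup E] [MeasureSpace E] [OpensMeasurableSpace E] (f : E → ℂ) (hf : ∀ᶠ x in 𝓝 0, f x = 0) :
    sSup (SS f) = 0 := by
  have h1 : SS f = SS (fun _ : E => (0:ℂ)) := SS_congr hf
  refine Real.sSup_of_not_bddAbove ?_
  rintro ⟨B, hB⟩
  have : |B| + 1 ∈ SS f := by
    rw [h1]
    refine ⟨by positivity, 1, one_pos, ?_⟩
    have : (fun _ : E => ‖(0:ℂ)‖ ^ (-(2 * (|B| + 1)))) = fun _ => (0:ℝ) := by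
      ext x; rw [norm_zero, Real.zero_rpow]
      have := abs_nonneg B
      linarith
    rw [this]
    exact integrableOn_zero
  have := hB this
  linarith [le_abs_self B]

lemma SS_mem {E : Type*} [NormedAddCommGroup E] [MeasureSpace E] [OpensMeasurableSpace E] [IsLocallyFiniteMeasure (volume : Measure E)]
    (f : E → ℂ) (hf : Measurable f) (c : ℝ) (hc : 0 < c) (h : c < sSup (SS f)) : c ∈ SS f := by
  have hne : (SS f).Nonempty := by
    rw [Set.nonempty_iff_ne_empty]
    intro he
    rw [he, Real.sSup_empty] at h
    linarith
  obtain ⟨c', hc', hlt⟩ := exists_lt_of_lt_csSup hne h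
  exact SS_down f hf hc' hc hlt.le

lemma SS_le_one (n : ℕ) (h : (Fin n → ℂ) → ℂ) (hh : ContDiffAt ℂ 1 h 0) (hhm : Measurable h) (hh0 : h 0 = 0) (hne : ¬ ∀ᶠ x in 𝓝 0, h x = 0)
    (c : ℝ) (hc : c ∈ SS h) : c ≤ 1 := by
  obtain ⟨hc0, ε, hε, hi⟩ := hc
  obtain ⟨W, hW, hWm, hWt, hWU, ε', hε', c0, hc00, s1, hs1, hall⟩ := LB n h hh hhm hh0 hne _ (Metric.ball_mem_nhds 0 hε)
  have h0 := hall 0 (by simpa using hε')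
  obtain ⟨K, hK, hKs⟩ := CH volume W hWm hWt h hhm c hc0 (hi.mono_set hWU) h0.1
  by_contra hcon
  push Not at hcon
  refine pow_contra c0 K 2 (2 * c) s1 hc00 (by linarith) hs1 fun s hs hss => ?_
  have h1 := h0.2 s hs hss
  unfold Vol at h1
  simp only [sub_zero] at h1
  rw [Real.rpow_two]
  exact h1.trans (hKs s hs)

lemma notA (n : ℕ) (g : (Fin n → ℂ) → ℂ) (hg : ContDiffAt ℂ 1 g 0) (hgm : Measurable g) (hg0 : g 0 = 0)
    (W : Set (Fin n → ℂ)) (hW : W ∈ 𝓝 0) (hWt : volume W < ⊤) (β : ℝ) (hβ : sSup (SS g) < β)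
    (hA : ∃ s0 > (0:ℝ), ∀ s, 0 < s → s < s0 → Vol W g s 0 ≤ s ^ (2 * β)) : False := by
  obtain ⟨s0, hs0, hA⟩ := hA
  have hnn := SS_nonneg g
  by_cases hz : ∀ᶠ x in 𝓝 0, g x = 0
  · have hN : W ∩ {x | g x = 0} ∈ 𝓝 (0 : Fin n → ℂ) := Filter.inter_mem hW hz
    have hlt : volume (W ∩ {x | g x = 0}) < ⊤ := (measure_mono Set.inter_subset_left).trans_lt hWt
    have hpos : 0 < volume.real (W ∩ {x | g x = 0}) := ENNReal.toReal_pos (Measure.measure_pos_of_mem_nhds _ hN).ne' hlt.ne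
    refine pow_contra _ 1 0 (2 * β) s0 hpos (by linarith) hs0 fun s hs hss => ?_
    rw [Real.rpow_zero, mul_one, one_mul]
    refine le_trans ?_ (hA s hs hss)
    refine measureReal_mono (fun x hx => ⟨hx.1, ?_⟩) ((measure_mono (Set.sep_subset _ _)).trans_lt hWt).ne
    have : g x = 0 := hx.2
    rw [this, sub_zero, norm_zero]; exact hs
  · have hmem : (sSup (SS g) + β) / 2 ∈ SS g := by
      refine SS_of_vol g hgm W hW hWt 1 (2 * β) _ s0 hs0 (by linarith) (by linarith) fun s hs hss => ?_
      have := hA s hs hss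
      unfold Vol at this
      simp only [sub_zero] at this
      rwa [one_mul]
    have := le_csSup ⟨1, fun c hc => SS_le_one n g hg hgm hg0 hz c hc⟩ hmem
    linarith

/-- Fubini facts for the sum -/
lemma F1 {X Y : Type*} [MeasureSpace X] [SFinite (volume : Measure X)] [MeasureSpace Y] [SFinite (volume : Measure Y)]
    (W : Set X) (hW : MeasurableSet W) (hWt : volume W < ⊤) (g : X → ℂ) (hg : Measurable g)
    (W' : Set Y) (hW' : MeasurableSet W') (hWt' : volume W' < ⊤) (h : Y → ℂ) (hh : Measurable h) (ε : ℝ) (hgε : ∀ x ∈ W, ‖g x‖ < ε)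
    (hn : ∀ w : ℂ, ‖w‖ < ε → volume {y ∈ W' | h y = w} = 0) :
    volume {q ∈ W ×ˢ W' | g q.1 + h q.2 = 0} = 0 ∧
    ∀ s c, 0 ≤ c → (∀ w : ℂ, ‖w‖ < ε → c ≤ Vol W' h s w) → c * volume.real W ≤ volume.real {q ∈ W ×ˢ W' | ‖g q.1 + h q.2‖ < s} := by
  constructor
  · have hm : MeasurableSet {q ∈ W ×ˢ W' | g q.1 + h q.2 = 0} :=
      (hW.prod hW').inter (((hg.comp measurable_fst).add (hh.comp measurable_snd)) (measurableSet_singleton 0))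
    rw [Measure.volume_eq_prod, Measure.measure_prod_null hm]
    refine Filter.Eventually.of_forall fun x => ?_
    by_cases hx : x ∈ W
    · refine measure_mono_null ?_ (hn (-g x) (by rw [norm_neg]; exact hgε x hx))
      intro y hy
      refine ⟨hy.1.2, ?_⟩
      have : g x + h y = 0 := hy.2
      linear_combination this
    · have : Prod.mk x ⁻¹' {q ∈ W ×ˢ W' | g q.1 + h q.2 = 0} = ∅ := by
        rw [Set.eq_empty_iff_forall_notMem]
        intro y hy
        exact hx hy.1.1
      simp only [this, measure_empty, Pi.zero_apply]
  · intro s c hc hV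
    have hm : MeasurableSet {q ∈ W ×ˢ W' | ‖g q.1 + h q.2‖ < s} :=
      (hW.prod hW').inter (measurableSet_lt ((hg.comp measurable_fst).add (hh.comp measurable_snd)).norm measurable_const :
        MeasurableSet {q : X × Y | ‖g q.1 + h q.2‖ < s})
    have hfin : volume {q ∈ W ×ˢ W' | ‖g q.1 + h q.2‖ < s} < ⊤ := by
      refine (measure_mono (Set.sep_subset _ _)).trans_lt ?_
      rw [Measure.volume_eq_prod, Measure.prod_prod]
      exact ENNReal.mul_lt_top hWt hWt'
    have key : ENNReal.ofReal c * volume W ≤ volume {q ∈ W ×ˢ W' | ‖g q.1 + h q.2‖ < s} := by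
      rw [Measure.volume_eq_prod, Measure.prod_apply hm, ← setLIntegral_const]
      refine (setLIntegral_mono' hW fun x hx => ?_).trans (setLIntegral_le_lintegral _ _)
      refine (ENNReal.ofReal_le_ofReal (hV (-g x) (by rw [norm_neg]; exact hgε x hx))).trans ?_
      rw [Vol_ofReal W' hWt']
      refine measure_mono fun y hy => ⟨⟨hx, hy.1⟩, ?_⟩
      have h1 : ‖h y - -g x‖ < s := hy.2
      change ‖g x + h y‖ < s
      have e : g x + h y = h y - -g x := by ring
      rwa [e]
    have := ENNReal.toReal_mono hfin.ne key
    rw [ENNReal.toReal_mul, ENNReal.toReal_ofReal hc] at this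
    exact this

lemma F2 {X Y : Type*} [MeasureSpace X] [SFinite (volume : Measure X)] [MeasureSpace Y] [SFinite (volume : Measure Y)]
    (W : Set X) (hWt : volume W < ⊤) (g : X → ℂ)
    (W' W'' : Set Y) (hWt' : volume W' < ⊤) (hWW : W'' ⊆ W') (h : Y → ℂ) (t : ℝ) :
    Vol W g t 0 * Vol W'' h t 0 ≤ volume.real {q ∈ W ×ˢ W' | ‖g q.1 + h q.2‖ < 2 * t} := by
  unfold Vol
  rw [← measureReal_prod_prod]
  refine measureReal_mono ?_ ?_
  · rintro ⟨x, y⟩ ⟨hx, hy⟩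
    refine ⟨⟨hx.1, hWW hy.1⟩, ?_⟩
    have h1 : ‖g x - 0‖ < t := hx.2
    have h2 : ‖h y - 0‖ < t := hy.2
    rw [sub_zero] at h1 h2
    exact (norm_add_le _ _).trans_lt (by simp only; linarith)
  · refine ((measure_mono (Set.sep_subset _ _)).trans_lt ?_).ne
    rw [Measure.prod_prod]
    exact ENNReal.mul_lt_top hWt hWt'

end Kuw

namespace Kuw
open Topology

lemma small_nhds {n : ℕ} (g : (Fin n → ℂ) → ℂ) (hg : ContDiffAt ℂ 1 g 0) (hg0 : g 0 = 0) (ε : ℝ) (hε : 0 < ε) :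
    {x | ‖g x‖ < ε} ∈ 𝓝 (0 : Fin n → ℂ) := by
  have : Filter.Tendsto (fun v => ‖g v‖) (𝓝 0) (𝓝 0) := by
    have := hg.continuousAt.norm
    unfold ContinuousAt at this
    simpa [hg0] using this
  exact this.eventually_lt_const hε

lemma mainUB (m n : ℕ) (g : (Fin m → ℂ) → ℂ) (h : (Fin n → ℂ) → ℂ) (hg : ContDiffAt ℂ 1 g 0) (hgm : Measurable g) (hg0 : g 0 = 0)
    (hh : ContDiffAt ℂ 1 h 0) (hhm : Measurable h) (hh0 : h 0 = 0) (hne : ¬ ∀ᶠ x in 𝓝 0, h x = 0) (c : ℝ)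
    (hc : c ∈ SS (fun p : (Fin m → ℂ) × (Fin n → ℂ) => g p.1 + h p.2)) : c ≤ 1 ∧ c ≤ sSup (SS g) + sSup (SS h) := by
  obtain ⟨hc0, ε, hε, hi⟩ := hc
  obtain ⟨W', hW', hWm', hWt', hWU', εh, hεh, c0, hc00, s1, hs1, hall⟩ := LB n h hh hhm hh0 hne _ (Metric.ball_mem_nhds 0 hε)
  obtain ⟨W, hW, -, -, hWm, hWt, hWU, -, hdg⟩ := VR m g hg hgm hg0 (Metric.ball 0 ε ∩ {x | ‖g x‖ < εh})
    (Filter.inter_mem (Metric.ball_mem_nhds 0 hε) (small_nhds g hg hg0 εh hεh))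
  obtain ⟨W'', hW'', -, -, hWm'', hWt'', hWU'', -, hdh⟩ := VR n h hh hhm hh0 W' hW'
  have hF := F1 W hWm hWt g hgm W' hWm' hWt' h hhm εh (fun x hx => (hWU hx).2) (fun w hw => (hall w hw).1)
  have hsub : W ×ˢ W' ⊆ Metric.ball (0 : (Fin m → ℂ) × (Fin n → ℂ)) ε := by
    rintro ⟨x, y⟩ ⟨hx, hy⟩
    have h1 := (hWU hx).1
    have h2 := hWU' hy
    rw [mem_ball_zero_iff] at h1 h2 ⊢
    rw [Prod.norm_def, max_lt_iff]
    exact ⟨h1, h2⟩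
  have hprodt : volume (W ×ˢ W') < ⊤ := by
    rw [Measure.volume_eq_prod, Measure.prod_prod]
    exact ENNReal.mul_lt_top hWt hWt'
  have hfm : Measurable (fun p : (Fin m → ℂ) × (Fin n → ℂ) => g p.1 + h p.2) :=
    (hgm.comp measurable_fst).add (hhm.comp measurable_snd)
  obtain ⟨K, hK, hKs⟩ := CH volume (W ×ˢ W') (hWm.prod hWm') hprodt _ hfm c hc0 (hi.mono_set hsub) hF.1
  have hvW : 0 < volume.real W := ENNReal.toReal_pos (Measure.measure_pos_of_mem_nhds _ hW).ne' hWt.ne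
  constructor
  · by_contra hcon
    push Not at hcon
    refine pow_contra (c0 * volume.real W) K 2 (2 * c) s1 (by positivity) (by linarith) hs1 fun s hs hss => ?_
    rw [Real.rpow_two]
    have h1 := hF.2 s (c0 * s ^ 2) (by positivity) (fun w hw => (hall w hw).2 s hs hss)
    have h2 := hKs s hs
    linarith
  · by_contra hcon
    push Not at hcon
    set a := sSup (SS g) with ha
    set b := sSup (SS h) with hb
    have ha0 : 0 ≤ a := SS_nonneg g
    have hb0 : 0 ≤ b := SS_nonneg h
    set γ := (c - a - b) / 3 with hγ
    have hγ0 : 0 < γ := by rw [hγ]; linarith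
    obtain ⟨t1, ht1, hB1⟩ := (hdg (a + γ) (by linarith)).resolve_left
      (fun hA => notA m g hg hgm hg0 W hW hWt (a + γ) (by linarith) hA) (γ / 2) (by positivity)
    obtain ⟨t2, ht2, hB2⟩ := (hdh (b + γ) (by linarith)).resolve_left
      (fun hA => notA n h hh hhm hh0 W'' hW'' hWt'' (b + γ) (by linarith) hA) (γ / 2) (by positivity)
    refine pow_contra 1 (K * 2 ^ (2 * c)) ((2 * (a + γ) + γ / 2) + (2 * (b + γ) + γ / 2)) (2 * c) (min t1 t2) one_pos
      (by linarith) (by positivity) fun t ht htt => ?_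
    have h1 := hB1 t ht (htt.trans_le (min_le_left _ _))
    have h2 := hB2 t ht (htt.trans_le (min_le_right _ _))
    have h3 := F2 W hWt g W' W'' hWt' hWU'' h t
    have h4 := hKs (2 * t) (by positivity)
    rw [one_mul, Real.rpow_add ht]
    rw [Real.mul_rpow (by norm_num) ht.le, ← mul_assoc] at h4
    exact (mul_le_mul h1 h2 (by positivity) (Vol_nonneg _ _ _ _)).trans (h3.trans h4)

lemma mainLB (m n : ℕ) (g : (Fin m → ℂ) → ℂ) (h : (Fin n → ℂ) → ℂ) (hg : ContDiffAt ℂ 1 g 0) (hgm : Measurable g) (hg0 : g 0 = 0)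
    (hh : ContDiffAt ℂ 1 h 0) (hhm : Measurable h) (hh0 : h 0 = 0) (hne : ¬ ∀ᶠ x in 𝓝 0, h x = 0) (c' : ℝ) (hc' : 0 < c')
    (hc1' : c' < 1) (hcab : c' < sSup (SS g) + sSup (SS h)) :
    c' ∈ SS (fun p : (Fin m → ℂ) × (Fin n → ℂ) => g p.1 + h p.2) := by
  set a := sSup (SS g) with ha
  set b := sSup (SS h) with hb
  obtain ⟨c, hcc, hc⟩ := exists_between (lt_min hc1' hcab)
  have hclt : c < 1 := hc.trans_le (min_le_left _ _)
  have hcab : c < a + b := hc.trans_le (min_le_right _ _)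
  have hcpos : 0 < c := by linarith
  obtain ⟨c1, hc10, hc1c, hc1, hc2⟩ : ∃ c1, 0 ≤ c1 ∧ c1 ≤ c ∧ (c1 = 0 ∨ (0 < c1 ∧ c1 < a)) ∧ (c - c1 = 0 ∨ (0 < c - c1 ∧ c - c1 < b)) := by
    set γ := (a + b - c) / 2 with hγ
    have hγ0 : 0 < γ := by rw [hγ]; linarith
    by_cases h1 : a ≤ γ
    · exact ⟨0, le_rfl, hcpos.le, Or.inl rfl, Or.inr ⟨by linarith, by linarith⟩⟩
    by_cases h2 : b ≤ γ
    · exact ⟨c, hcpos.le, le_rfl, Or.inr ⟨hcpos, by linarith⟩, Or.inl (by ring)⟩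
    push Not at h1 h2
    exact ⟨a - γ, by linarith, by linarith, Or.inr ⟨by linarith, by linarith⟩, Or.inr ⟨by linarith, by linarith⟩⟩
  -- the g side
  obtain ⟨W, hW, ε, hε, hWm, hWt, hi, K, hK, hVK⟩ : ∃ W ∈ 𝓝 (0 : Fin m → ℂ), ∃ ε > (0:ℝ), MeasurableSet W ∧ volume W < ⊤ ∧
      (∀ η : ℝ, 0 < η → η < 1 → ∃ s0 > (0:ℝ), ∀ s, 0 < s → s < s0 → ∀ w ∈ Metric.ball (0:ℂ) ε, ∀ w' ∈ Metric.ball (0:ℂ) ε,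
        ‖w‖ / 2 ≤ ‖w'‖ → ‖w'‖ ≤ ‖w‖ → Vol W g s w ≤ s ^ (-η) * (Vol W g (s ^ (1 - η)) w' + s ^ (2:ℝ))) ∧
      ∃ K, 0 ≤ K ∧ ∀ r > 0, Vol W g r 0 ≤ K * r ^ (2 * c1) := by
    rcases hc1 with rfl | ⟨hp, hlt⟩
    · obtain ⟨W, hW, ε, hε, hWm, hWt, -, hi, -⟩ := VR m g hg hgm hg0 Set.univ Filter.univ_mem
      refine ⟨W, hW, ε, hε, hWm, hWt, hi, volume.real W, measureReal_nonneg, fun r hr => ?_⟩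
      rw [mul_zero, Real.rpow_zero, mul_one]
      exact measureReal_mono (Set.sep_subset _ _) hWt.ne
    · have hgne : ¬ ∀ᶠ x in 𝓝 0, g x = 0 := fun hz => by
        have := SS_zero g hz
        linarith
      obtain ⟨-, ε1, hε1, hintg⟩ := SS_mem g hgm c1 hp hlt
      obtain ⟨W1, hW1, -, -, hWU1, ε2, hε2, _c0, _hc0, _s1, _hs1, hall⟩ := LB m g hg hgm hg0 hgne _ (Metric.ball_mem_nhds 0 hε1)
      obtain ⟨W, hW, ε, hε, hWm, hWt, hWU, hi, -⟩ := VR m g hg hgm hg0 W1 hW1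
      have hnull : volume {x ∈ W | g x = 0} = 0 :=
        by
        have h0 : volume {x ∈ W1 | g x = 0} = 0 := (hall 0 (by simpa using hε2)).1
        have hsub : {x ∈ W | g x = 0} ⊆ {x ∈ W1 | g x = 0} := fun x hx => ⟨hWU hx.1, hx.2⟩
        exact measure_mono_null hsub h0
      obtain ⟨K, hK, hKs⟩ := CH volume W hWm hWt g hgm c1 hp (hintg.mono_set (hWU.trans hWU1)) hnull
      refine ⟨W, hW, ε, hε, hWm, hWt, hi, K, hK, fun r hr => ?_⟩
      unfold Vol
      simp only [sub_zero]
      exact hKs r hr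
  -- the h side
  set U := {y : Fin n → ℂ | ‖h y‖ < min ε 1} with hU
  have hUn : U ∈ 𝓝 (0 : Fin n → ℂ) := small_nhds h hh hh0 _ (by positivity)
  obtain ⟨W', hW', hWm', hWt', hWU', hnull, hintg⟩ : ∃ W' ∈ 𝓝 (0 : Fin n → ℂ), MeasurableSet W' ∧ volume W' < ⊤ ∧ W' ⊆ U ∧
      volume {y ∈ W' | h y = 0} = 0 ∧ IntegrableOn (fun y => ‖h y‖ ^ (-(2 * (c - c1)))) W' := by
    rcases hc2 with h0 | ⟨hp, hlt⟩
    · obtain ⟨W', hW', hWm', hWt', hWU', ε2, hε2, _c0, _hc0, _s1, _hs1, hall⟩ := LB n h hh hhm hh0 hne U hUn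
      refine ⟨W', hW', hWm', hWt', hWU', (hall 0 (by simpa using hε2)).1, ?_⟩
      rw [h0]
      simp only [mul_zero, neg_zero, Real.rpow_zero]
      exact integrableOn_const hWt'.ne
    · obtain ⟨-, ε1, hε1, hintg⟩ := SS_mem h hhm (c - c1) hp hlt
      obtain ⟨W', hW', hWm', hWt', hWU', ε2, hε2, _c0, _hc0, _s1, _hs1, hall⟩ := LB n h hh hhm hh0 hne (U ∩ Metric.ball 0 ε1)
        (Filter.inter_mem hUn (Metric.ball_mem_nhds 0 hε1))
      exact ⟨W', hW', hWm', hWt', fun y hy => (hWU' hy).1, (hall 0 (by simpa using hε2)).1, hintg.mono_set fun y hy => (hWU' hy).2⟩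
  set η := min (1/2) ((c - c') / 3) with hη
  have hη0 : 0 < η := lt_min (by norm_num) (by linarith)
  have hη1 : η ≤ 1/2 := min_le_left _ _
  have hη2 : η ≤ (c - c') / 3 := min_le_right _ _
  obtain ⟨s0, hs0, C, hC, hD⟩ := D1 W hWm hWt g hgm ε hi K c1 c hK hc10 hcpos hc1c hclt hVK η hη0 (by linarith)
  have hprodt : volume (W ×ˢ W') < ⊤ := by
    rw [Measure.volume_eq_prod, Measure.prod_prod]
    exact ENNReal.mul_lt_top hWt hWt'
  have hfm : Measurable (fun p : (Fin m → ℂ) × (Fin n → ℂ) => g p.1 + h p.2) :=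
    (hgm.comp measurable_fst).add (hhm.comp measurable_snd)
  refine SS_of_vol _ hfm (W ×ˢ W') (prod_mem_nhds hW hW') hprodt (C * ∫ y in W', ‖h y‖ ^ (-(2 * (c - c1)))) (2 * c - 3 * η) c' s0 hs0 hc' (by linarith) fun s hs hss => ?_
  refine D2 W hWm hWt g hgm W' hWm' h hhm C (2 * c - 3 * η) (c - c1) s hC hs hintg ?_
  have : ∀ᵐ y, y ∉ {y ∈ W' | h y = 0} := measure_eq_zero_iff_ae_notMem.1 hnull
  filter_upwards [this] with y hy hyW
  have hyne : h y ≠ 0 := fun h0 => hy ⟨hyW, h0⟩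
  have hyU : ‖h y‖ < min ε 1 := hWU' hyW
  have := hD s hs hss (-h y) (neg_ne_zero.2 hyne) (by rw [norm_neg]; exact hyU.trans_le (min_le_left _ _))
    (by rw [norm_neg]; exact (hyU.trans_le (min_le_right _ _)).le)
  rwa [norm_neg] at this

lemma mainM (m n : ℕ) (g : (Fin m → ℂ) → ℂ) (h : (Fin n → ℂ) → ℂ) (hg : ContDiffAt ℂ 1 g 0) (hgm : Measurable g) (hg0 : g 0 = 0)
    (hh : ContDiffAt ℂ 1 h 0) (hhm : Measurable h) (hh0 : h 0 = 0) (hne : ¬ ∀ᶠ x in 𝓝 0, h x = 0) :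
    sSup (SS (fun p : (Fin m → ℂ) × (Fin n → ℂ) => g p.1 + h p.2)) = min 1 (sSup (SS g) + sSup (SS h)) := by
  have hUB := mainUB m n g h hg hgm hg0 hh hhm hh0 hne
  have hLB := mainLB m n g h hg hgm hg0 hh hhm hh0 hne
  set f := fun p : (Fin m → ℂ) × (Fin n → ℂ) => g p.1 + h p.2
  apply le_antisymm
  · refine Real.sSup_le (fun c hc => le_min (hUB c hc).1 (hUB c hc).2) ?_
    exact le_min zero_le_one (add_nonneg (SS_nonneg g) (SS_nonneg h))
  · refine le_of_forall_lt fun c hc => ?_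
    obtain ⟨c', hcc', hc'⟩ := exists_between hc
    by_cases h0 : 0 < c'
    · exact hcc'.trans_le (le_csSup ⟨1, fun x hx => (hUB x hx).1⟩
        (hLB c' h0 (hc'.trans_le (min_le_left _ _)) (hc'.trans_le (min_le_right _ _))))
    · push Not at h0
      exact (hcc'.trans_le h0).trans_le (SS_nonneg f)

lemma SS_swap (m n : ℕ) (f : (Fin m → ℂ) × (Fin n → ℂ) → ℂ) : SS f = SS (fun q : (Fin n → ℂ) × (Fin m → ℂ) => f q.swap) := by
  ext c
  refine and_congr_right fun _ => exists_congr fun ε => and_congr_right fun _ => ?_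
  have hmp : MeasurePreserving (Prod.swap : (Fin n → ℂ) × (Fin m → ℂ) → (Fin m → ℂ) × (Fin n → ℂ)) volume volume :=
    Measure.measurePreserving_swap
  have hpre : (Prod.swap : (Fin n → ℂ) × (Fin m → ℂ) → (Fin m → ℂ) × (Fin n → ℂ)) ⁻¹' Metric.ball 0 ε = Metric.ball 0 ε := by
    ext ⟨x, y⟩
    simp [Prod.norm_def, and_comm]
  have := hmp.integrableOn_comp_preimage (MeasurableEquiv.prodComm (α := Fin n → ℂ) (β := Fin m → ℂ)).measurableEmbedding
    (f := fun z => ‖f z‖ ^ (-(2 * c))) (s := Metric.ball 0 ε)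
  rw [hpre] at this
  exact this.symm

lemma mainAll (m n : ℕ) (g : (Fin m → ℂ) → ℂ) (h : (Fin n → ℂ) → ℂ) (hg : ContDiffAt ℂ 1 g 0) (hgm : Measurable g) (hg0 : g 0 = 0)
    (hh : ContDiffAt ℂ 1 h 0) (hhm : Measurable h) (hh0 : h 0 = 0) :
    sSup (SS (fun p : (Fin m → ℂ) × (Fin n → ℂ) => g p.1 + h p.2)) = min 1 (sSup (SS g) + sSup (SS h)) := by
  by_cases hhz : ∀ᶠ x in 𝓝 0, h x = 0
  · by_cases hgz : ∀ᶠ x in 𝓝 0, g x = 0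
    · rw [SS_zero g hgz, SS_zero h hhz, SS_zero]
      · norm_num
      · have h1 := (continuous_fst.tendsto' (0 : (Fin m → ℂ) × (Fin n → ℂ)) 0 rfl).eventually hgz
        have h2 := (continuous_snd.tendsto' (0 : (Fin m → ℂ) × (Fin n → ℂ)) 0 rfl).eventually hhz
        filter_upwards [h1, h2] with q hq1 hq2
        rw [hq1, hq2, add_zero]
    · rw [SS_swap, add_comm (sSup (SS g)), ← mainM n m h g hh hhm hh0 hg hgm hg0 hgz]
      congr 2
      ext q
      exact add_comm _ _
  · exact mainM m n g h hg hgm hg0 hh hhm hh0 hhz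

open Classical in
lemma meas_rep (n : ℕ) (g : (Fin n → ℂ) → ℂ) (hg : AnalyticAt ℂ g 0) (hg0 : g 0 = 0) :
    ∃ g' : (Fin n → ℂ) → ℂ, Measurable g' ∧ ContDiffAt ℂ 1 g' 0 ∧ g' 0 = 0 ∧ g =ᶠ[𝓝 0] g' := by
  obtain ⟨ε, hε, hb⟩ := Metric.eventually_nhds_iff_ball.1 hg.eventually_analyticAt
  have hcont : ContinuousOn g (Metric.ball 0 ε) := fun x hx => (hb x hx).continuousAt.continuousWithinAt
  have heq : g =ᶠ[𝓝 0] (Metric.ball (0 : Fin n → ℂ) ε).piecewise g (fun _ => 0) := by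
    filter_upwards [Metric.ball_mem_nhds 0 hε] with x hx
    rw [Set.piecewise_eq_of_mem _ _ _ hx]
  refine ⟨(Metric.ball (0 : Fin n → ℂ) ε).piecewise g (fun _ => 0),
    ContinuousOn.measurable_piecewise hcont continuousOn_const measurableSet_ball, ?_, ?_, heq⟩
  · exact hg.contDiffAt.congr_of_eventuallyEq heq.symm
  · rw [← heq.self_of_nhds, hg0]

lemma final (m n : ℕ) (g : (Fin m → ℂ) → ℂ) (h : (Fin n → ℂ) → ℂ)
    (hg : AnalyticAt ℂ g 0) (hh : AnalyticAt ℂ h 0) (hg0 : g 0 = 0) (hh0 : h 0 = 0) :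
    sSup (SS (fun p : (Fin m → ℂ) × (Fin n → ℂ) => g p.1 + h p.2)) = min 1 (sSup (SS g) + sSup (SS h)) := by
  obtain ⟨g', hgm, hg1, hg2, hg3⟩ := meas_rep m g hg hg0
  obtain ⟨h', hhm, hh1, hh2, hh3⟩ := meas_rep n h hh hh0
  rw [SS_congr hg3, SS_congr hh3, ← mainAll m n g' h' hg1 hgm hg2 hh1 hhm hh2]
  congr 1
  refine SS_congr ?_
  have h1 := (continuous_fst.tendsto' (0 : (Fin m → ℂ) × (Fin n → ℂ)) 0 rfl).eventually hg3
  have h2 := (continuous_snd.tendsto' (0 : (Fin m → ℂ) × (Fin n → ℂ)) 0 rfl).eventually hh3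
  filter_upwards [h1, h2] with q hq1 hq2
  rw [hq1, hq2]

end Kuw

/-- Kuwata's summation formula: for holomorphic germs
`g` at `0 ∈ ℂᵐ` and `h` at `0 ∈ ℂⁿ` vanishing at the origin,
`lct₀(g + h) = min {1, lct₀(g) + lct₀(h)}`. -/
theorem lct_sum_formula (m n : ℕ)
    (g : (Fin m → ℂ) → ℂ) (h : (Fin n → ℂ) → ℂ)
    (hg : AnalyticAt ℂ g 0) (hh : AnalyticAt ℂ h 0)
    (hg0 : g 0 = 0) (hh0 : h 0 = 0) :
    lct₀ (fun p : (Fin m → ℂ) × (Fin n → ℂ) => g p.1 + h p.2) =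
      min 1 (lct₀ g + lct₀ h) := by
  exact Kuw.final m n g h hg hh hg0 hh0
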